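/- arXiv:1702.07049 — 4 statements merged into one kernel-verified Lean document; each statement's English description precedes it below -/
import Mathlib

section
/- Let n ≥ 1, and for j = 1, …, n let Λ_j = (λ_{j,m})_{m ∈ ℕ} be a strictly increasing sequence of positive integers with λ_{j,m+1} ≥ 2 λ_{j,m} for all m, and let k_j ∈ ℕ. For each j let Λ_j^{(k_j)} = { ε₁ λ_{j,n₁} + ⋯ + ε_{k_j} λ_{j,n_{k_j}} : n₁ > n₂ > ⋯ > n_{k_j}, ε_i ∈ {+1, −1} } ⊂ ℤ, and set K_n = k₁ + ⋯ + k_n. Then there exist positive constants A and B, depending only on the sequences Λ_j and the k_j, such that for every integrable function f : 𝕋ⁿ → ℂ, ( ∑_{(m₁,…,mₙ) ∈ Λ₁^{(k₁)} × ⋯ × Λₙ^{(kₙ)}} |f̂(m₁,…,mₙ)|² )^{1/2} ≤ A ∫_{𝕋ⁿ} |f(θ)| log^{K_n/2}(1 + |f(θ)|) dθ + B. -/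
open MeasureTheory ENNReal NNReal

/-- The Fourier coefficient of `f : 𝕋ⁿ → ℂ` at frequency `m ∈ ℤⁿ`, with respect to the
normalized Haar (product) measure on `𝕋ⁿ = (ℝ/ℤ)ⁿ`. -/
noncomputable def piFourierCoeff {n : ℕ} (f : (Fin n → AddCircle (1 : ℝ)) → ℂ)
    (m : Fin n → ℤ) : ℂ :=
  ∫ θ, (∏ j, fourier (-(m j)) (θ j)) * f θ
    ∂(Measure.pi fun _ : Fin n => AddCircle.haarAddCircle)

/-- The `k`-fold signed sumset `Λ^{(k)} = {ε₁ λ_{n₁} + ⋯ + ε_k λ_{n_k} : n₁ > ⋯ > n_k, ε_i = ±1}`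
of a sequence `λ : ℕ → ℕ`. -/
def lacunarySumset (lam : ℕ → ℕ) (k : ℕ) : Set ℤ :=
  { x | ∃ (idx : Fin k → ℕ) (ε : Fin k → ℤ), StrictAnti idx ∧ (∀ i, ε i = 1 ∨ ε i = -1) ∧
      x = ∑ i, ε i * (lam (idx i) : ℤ) }

namespace LacunaryZygmund

/-- A symmetric two-point bound for powers of `x + y ± B` when `B² ≤ 4xy`. -/
theorem add_pow_add_sub_pow_le {x y B : ℝ} (hx : 0 ≤ x) (hy : 0 ≤ y) (hB : B ^ 2 ≤ 4 * x * y)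
    {Q : ℕ} (q : ℕ) (hq : q ≤ Q) :
    (x + y + B) ^ q + (x + y - B) ^ q ≤ 2 * (x + (1 + 4 * Q) * y) ^ q := by
  have hBA : |B| ≤ x + y := abs_le_of_sq_le_sq (by nlinarith [sq_nonneg (x - y)]) (by positivity)
  obtain ⟨h1, h2⟩ := abs_le.1 hBA
  set A := x + y with hA
  have hE : ∀ r : ℕ, 0 ≤ (A + B) ^ r + (A - B) ^ r := fun r =>
    add_nonneg (pow_nonneg (by linarith) _) (pow_nonneg (by linarith) _)
  have hO : ∀ r : ℕ, 0 ≤ B * ((A + B) ^ r - (A - B) ^ r) ∧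
      A * (B * ((A + B) ^ r - (A - B) ^ r)) ≤ r * B ^ 2 * ((A + B) ^ r + (A - B) ^ r) := by
    intro r
    induction r with
    | zero => simp
    | succ r ih =>
      obtain ⟨i1, i2⟩ := ih
      have hA0 : 0 ≤ A := by positivity
      have e1 : B * ((A + B) ^ (r + 1) - (A - B) ^ (r + 1)) =
          A * (B * ((A + B) ^ r - (A - B) ^ r)) + B ^ 2 * ((A + B) ^ r + (A - B) ^ r) := by ring
      have e2 : (A + B) ^ (r + 1) + (A - B) ^ (r + 1) =
          A * ((A + B) ^ r + (A - B) ^ r) + B * ((A + B) ^ r - (A - B) ^ r) := by ring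
      rw [e1, e2]
      refine ⟨add_nonneg (mul_nonneg hA0 i1) (mul_nonneg (sq_nonneg B) (hE r)), ?_⟩
      have := mul_le_mul_of_nonneg_left i2 hA0
      have h3 : 0 ≤ ((r : ℝ) + 1) * B ^ 2 * (B * ((A + B) ^ r - (A - B) ^ r)) := by positivity
      push_cast
      nlinarith
  have hstep : ∀ r : ℕ, B * ((A + B) ^ r - (A - B) ^ r) ≤
      4 * r * y * ((A + B) ^ r + (A - B) ^ r) := by
    intro r
    rcases (show 0 ≤ A by positivity).eq_or_lt with h0 | h0
    · have hB0 : B = 0 := by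
        apply abs_eq_zero.1
        exact le_antisymm (h0 ▸ hBA) (abs_nonneg _)
      rw [hB0]
      have := hE r
      rw [hB0] at this
      rw [zero_mul]
      positivity
    · have h3 := (hO r).2
      have h4 : (r : ℝ) * B ^ 2 * ((A + B) ^ r + (A - B) ^ r) ≤
          A * (4 * r * y * ((A + B) ^ r + (A - B) ^ r)) := by
        have : B ^ 2 ≤ 4 * A * y := by nlinarith
        calc _ ≤ (r : ℝ) * (4 * A * y) * ((A + B) ^ r + (A - B) ^ r) := by
              gcongr
              exact hE r
          _ = _ := by ring
      exact le_of_mul_le_mul_left (h3.trans h4) h0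
  induction q with
  | zero => norm_num
  | succ r ih =>
    have hr : (r : ℝ) ≤ Q := by exact_mod_cast (Nat.le_of_succ_le hq)
    have e2 : (A + B) ^ (r + 1) + (A - B) ^ (r + 1) =
          A * ((A + B) ^ r + (A - B) ^ r) + B * ((A + B) ^ r - (A - B) ^ r) := by ring
    calc _ ≤ (x + (1 + 4 * Q) * y) * ((A + B) ^ r + (A - B) ^ r) := by
          rw [e2]
          have h5 : 4 * r * y * ((A + B) ^ r + (A - B) ^ r) ≤
            4 * Q * y * ((A + B) ^ r + (A - B) ^ r) := by
            gcongr
            exact hE r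
          have := hstep r
          rw [hA] at *
          nlinarith
      _ ≤ (x + (1 + 4 * Q) * y) * (2 * (x + (1 + 4 * Q) * y) ^ r) := by
          gcongr
          exact ih (Nat.le_of_succ_le hq)
      _ = _ := by ring

theorem norm_add_pow_add_norm_sub_pow_le (u b : ℂ) (q : ℕ) :
    ‖u + b‖ ^ (2 * q) + ‖u - b‖ ^ (2 * q) ≤ 2 * (‖u‖ ^ 2 + (1 + 4 * q) * ‖b‖ ^ 2) ^ q := by
  have h1 : ‖u + b‖ ^ 2 = ‖u‖ ^ 2 + ‖b‖ ^ 2 + 2 * inner ℝ u b := by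
    rw [norm_add_sq_real]; ring
  have h2 : ‖u - b‖ ^ 2 = ‖u‖ ^ 2 + ‖b‖ ^ 2 - 2 * inner ℝ u b := by
    rw [norm_sub_sq_real]; ring
  rw [pow_mul, pow_mul, h1, h2]
  refine add_pow_add_sub_pow_le (by positivity) (by positivity) ?_ q le_rfl
  have := sq_le_sq' (neg_le_of_abs_le (abs_real_inner_le_norm u b)) (real_inner_le_norm u b)
  nlinarith

/-- The Minkowski inequality in `ℓ^q` for a finite sum of nonnegative functions. -/
theorem sum_sum_pow_le {Ω D : Type*} [Fintype Ω] [Fintype D] (q : ℕ) (hq : q ≠ 0)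
    (X : D → Ω → ℝ) (x : D → ℝ) (c : ℝ) (hX : ∀ d ω, 0 ≤ X d ω) (hx : ∀ d, 0 ≤ x d) (hc : 0 ≤ c)
    (h : ∀ d, ∑ ω, X d ω ^ q ≤ c * x d ^ q) :
    ∑ ω, (∑ d, X d ω) ^ q ≤ c * (∑ d, x d) ^ q := by
  have hzero : ∀ d, x d = 0 → ∀ ω, X d ω = 0 := by
    intro d hd ω
    have h1 := h d
    rw [hd, zero_pow hq, mul_zero] at h1
    have h2 := (Finset.sum_eq_zero_iff_of_nonneg (fun ω _ => pow_nonneg (hX d ω) q)).1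
      (le_antisymm h1 (Finset.sum_nonneg fun ω _ => pow_nonneg (hX d ω) q)) ω (Finset.mem_univ _)
    exact pow_eq_zero_iff hq |>.1 h2
  set S := ∑ d, x d with hS
  rcases (Finset.sum_nonneg fun d _ => hx d : 0 ≤ ∑ d, x d).eq_or_lt with h0 | h0
  · have hx0 : ∀ d, x d = 0 := fun d =>
      (Finset.sum_eq_zero_iff_of_nonneg (fun d _ => hx d)).1 h0.symm d (Finset.mem_univ _)
    have : ∀ ω, ∑ d, X d ω = 0 := fun ω => Finset.sum_eq_zero fun d _ => hzero d (hx0 d) ω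
    simp only [this, zero_pow hq, Finset.sum_const_zero]
    exact mul_nonneg hc (pow_nonneg (h0.le.trans_eq hS.symm) _)
  rw [← hS] at h0
  have hpt : ∀ ω, (∑ d, X d ω) ^ q ≤ S ^ q * ∑ d, x d / S * (X d ω / x d) ^ q := by
    intro ω
    have e : ∑ d, X d ω = S * ∑ d, x d / S * (X d ω / x d) := by
      rw [Finset.mul_sum]
      refine Finset.sum_congr rfl fun d _ => ?_
      by_cases hd : x d = 0
      · simp [hd, hzero d hd ω]
      · field_simp
    rw [e, mul_pow]
    gcongr
    refine Real.pow_arith_mean_le_arith_mean_pow _ _ _ (fun d _ => div_nonneg (hx d) h0.le) ?_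
      (fun d _ => div_nonneg (hX d ω) (hx d)) q
    rw [← Finset.sum_div, ← hS, div_self h0.ne']
  calc _ ≤ ∑ ω, S ^ q * ∑ d, x d / S * (X d ω / x d) ^ q := Finset.sum_le_sum fun ω _ => hpt ω
    _ = S ^ q * ∑ d, x d / S * ∑ ω, (X d ω / x d) ^ q := by
      rw [← Finset.mul_sum, Finset.sum_comm]
      simp_rw [Finset.mul_sum]
    _ ≤ S ^ q * ∑ d, x d / S * c := by
      gcongr with d
      · exact div_nonneg (hx d) h0.le
      · simp_rw [div_pow]
        rw [← Finset.sum_div]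
        exact div_le_of_le_mul₀ (pow_nonneg (hx d) _) hc (h d)
    _ = _ := by
      rw [← Finset.sum_mul, ← Finset.sum_div, ← hS, div_self h0.ne']
      ring

/-- Tensorization of an `L² → L^{2q}` bound for a kernel on finite spaces. -/
theorem tensor_pow_le {W D : Type} [Fintype W] [Fintype D] (k : W → D → ℂ) (q : ℕ) (hq : q ≠ 0)
    (h : ∀ b : D → ℂ, ∑ w, ‖∑ d, k w d * b d‖ ^ (2 * q) ≤
      Fintype.card W * (∑ d, ‖b d‖ ^ 2) ^ q)
    {ι : Type} [Fintype ι] [DecidableEq ι] (a : (ι → D) → ℂ) :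
    ∑ ω : ι → W, ‖∑ δ : ι → D, (∏ i, k (ω i) (δ i)) * a δ‖ ^ (2 * q) ≤
      (Fintype.card W : ℝ) ^ Fintype.card ι * (∑ δ, ‖a δ‖ ^ 2) ^ q := by
  suffices H : ∀ [DecidableEq ι] (a : (ι → D) → ℂ),
    ∑ ω : ι → W, ‖∑ δ : ι → D, (∏ i, k (ω i) (δ i)) * a δ‖ ^ (2 * q) ≤
      (Fintype.card W : ℝ) ^ Fintype.card ι * (∑ δ, ‖a δ‖ ^ 2) ^ q from H a
  clear a
  refine Fintype.induction_empty_option (P := fun ι _ => ∀ [DecidableEq ι] (a : (ι → D) → ℂ),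
    ∑ ω : ι → W, ‖∑ δ : ι → D, (∏ i, k (ω i) (δ i)) * a δ‖ ^ (2 * q) ≤
      (Fintype.card W : ℝ) ^ Fintype.card ι * (∑ δ, ‖a δ‖ ^ 2) ^ q) ?_ ?_ ?_ ι
  · intro α β _ e ih _ a
    classical
    let _ := Fintype.ofEquiv β e.symm
    have := ih (fun δ => a (δ ∘ e.symm))
    rw [Fintype.card_congr e] at this
    convert this using 2
    · refine (Fintype.sum_equiv (e.arrowCongr (Equiv.refl W)) _ _ fun ω => ?_).symm
      congr 2
      refine Fintype.sum_equiv (e.arrowCongr (Equiv.refl D)) _ _ fun δ => ?_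
      congr 1
      refine Fintype.prod_equiv e _ _ fun i => ?_
      simp
    · refine congrArg (· ^ q) ?_
      refine (Fintype.sum_equiv (e.arrowCongr (Equiv.refl D)) _ _ fun δ => ?_).symm
      rfl
  · intro _ a
    simp [pow_mul]
  · intro α _ ih _ a
    classical
    have ih' := fun d => ih (fun δ => a (fun o => o.elim d δ))
    have key := sum_sum_pow_le q hq
      (fun d (ω : α → W) => ‖∑ δ : α → D, (∏ i, k (ω i) (δ i)) * a (fun o => o.elim d δ)‖ ^ 2)
      (fun d => ∑ δ : α → D, ‖a (fun o => o.elim d δ)‖ ^ 2)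
      ((Fintype.card W : ℝ) ^ Fintype.card α) (fun _ _ => by positivity)
      (fun _ => by positivity) (by positivity) (fun d => by simpa only [← pow_mul] using ih' d)
    have eD : ∀ {M : Type} [AddCommMonoid M] (F : (Option α → D) → M),
        ∑ δ, F δ = ∑ d, ∑ δ : α → D, F (fun o => o.elim d δ) := by
      intro M _ F
      rw [← Fintype.sum_prod_type']
      refine Fintype.sum_equiv (Equiv.piOptionEquivProd (β := fun _ => D)) _ _ fun δ => ?_
      congr 1
      ext o
      cases o <;> rfl
    have eW : ∀ {M : Type} [AddCommMonoid M] (F : (Option α → W) → M),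
        ∑ δ, F δ = ∑ δ : α → W, ∑ d, F (fun o => o.elim d δ) := by
      intro M _ F
      rw [Finset.sum_comm, ← Fintype.sum_prod_type']
      refine Fintype.sum_equiv (Equiv.piOptionEquivProd (β := fun _ => W)) _ _ fun δ => ?_
      congr 1
      ext o
      cases o <;> rfl
    rw [eW, eD]
    simp_rw [eD]
    calc _ = ∑ ω : α → W, ∑ w, ‖∑ d, k w d *
            ∑ δ : α → D, (∏ i, k (ω i) (δ i)) * a (fun o => o.elim d δ)‖ ^ (2 * q) := by
          simp [Fintype.prod_option, Finset.mul_sum, mul_assoc]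
      _ ≤ ∑ ω : α → W, (Fintype.card W : ℝ) * (∑ d,
            ‖∑ δ : α → D, (∏ i, k (ω i) (δ i)) * a (fun o => o.elim d δ)‖ ^ 2) ^ q :=
          Finset.sum_le_sum fun ω _ => h _
      _ ≤ _ := by
          rw [← Finset.mul_sum, Fintype.card_option, pow_succ', mul_assoc]
          gcongr


/-- The power `z ^ d` of a unimodular number `z`, for `d ∈ {-1, 0, 1}`. -/
def signPow (z : ℂ) (d : SignType) : ℂ :=
  match d with
  | 0 => 1
  | 1 => z
  | -1 => starRingEnd ℂ z

@[simp] theorem signPow_zero (z : ℂ) : signPow z 0 = 1 := rfl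
@[simp] theorem signPow_one (z : ℂ) : signPow z 1 = z := rfl
@[simp] theorem signPow_neg_one (z : ℂ) : signPow z (-1) = starRingEnd ℂ z := rfl

theorem signPow_mul (z w : ℂ) (d : SignType) : signPow (z * w) d = signPow z d * signPow w d := by
  cases d <;> simp [signPow]

theorem norm_signPow {z : ℂ} (hz : ‖z‖ = 1) (d : SignType) : ‖signPow z d‖ = 1 := by
  cases d <;> simp [signPow, hz]

theorem continuous_signPow (d : SignType) : Continuous fun z => signPow z d := by
  cases d
  · exact continuous_const
  · exact Complex.continuous_conj
  · exact continuous_id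

theorem sum_signType {M : Type*} [AddCommMonoid M] (F : SignType → M) :
    ∑ d, F d = F 0 + F (-1) + F 1 := by
  rw [SignType.univ_eq, Finset.sum_insert (by decide), Finset.sum_insert (by decide),
    Finset.sum_singleton, add_assoc]

/-- The `w`-th fourth root of unity. -/
def root (w : Fin 4) : ℂ := Complex.I ^ (w : ℕ)

theorem norm_root (w : Fin 4) : ‖root w‖ = 1 := by simp [root]

theorem sum_root_two_pow_le {ρ : ℝ} {q : ℕ} (h : 2 * (1 + 4 * q) * ρ ^ 2 ≤ 1)
    (b : SignType → ℂ) :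
    ∑ w, ‖∑ d, ((if d = 0 then 1 else (ρ : ℂ)) * signPow (root w) d) * b d‖ ^ (2 * q) ≤
      Fintype.card (Fin 4) * (∑ d, ‖b d‖ ^ 2) ^ q := by
  have key : ∀ z : ℂ, ‖z‖ = 1 →
      ‖b 0 + ρ * (starRingEnd ℂ z * b (-1) + z * b 1)‖ ^ (2 * q) +
      ‖b 0 - ρ * (starRingEnd ℂ z * b (-1) + z * b 1)‖ ^ (2 * q) ≤
        2 * (‖b 0‖ ^ 2 + ‖b (-1)‖ ^ 2 + ‖b 1‖ ^ 2) ^ q := by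
    intro z hz
    refine (norm_add_pow_add_norm_sub_pow_le _ _ q).trans ?_
    have h1 : ‖starRingEnd ℂ z * b (-1) + z * b 1‖ ≤ ‖b (-1)‖ + ‖b 1‖ := by
      refine (norm_add_le _ _).trans ?_
      simp [hz]
    have h2 : ‖starRingEnd ℂ z * b (-1) + z * b 1‖ ^ 2 ≤ 2 * (‖b (-1)‖ ^ 2 + ‖b 1‖ ^ 2) := by
      have := pow_le_pow_left₀ (norm_nonneg _) h1 2
      nlinarith [sq_nonneg (‖b (-1)‖ - ‖b 1‖)]
    gcongr 2 * ?_ ^ q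
    rw [norm_mul, mul_pow, Complex.norm_real, Real.norm_eq_abs, sq_abs]
    calc _ ≤ ‖b 0‖ ^ 2 + (1 + 4 * q) * (ρ ^ 2 * (2 * (‖b (-1)‖ ^ 2 + ‖b 1‖ ^ 2))) := by gcongr
      _ = ‖b 0‖ ^ 2 + (2 * (1 + 4 * q) * ρ ^ 2) * (‖b (-1)‖ ^ 2 + ‖b 1‖ ^ 2) := by ring
      _ ≤ ‖b 0‖ ^ 2 + 1 * (‖b (-1)‖ ^ 2 + ‖b 1‖ ^ 2) := by gcongr
      _ = _ := by ring
  have k1 := key 1 (by simp)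
  have k2 := key Complex.I (by simp)
  have e : ∀ w, ∑ d, ((if d = 0 then 1 else (ρ : ℂ)) * signPow (root w) d) * b d =
      b 0 + ρ * (starRingEnd ℂ (root w) * b (-1) + root w * b 1) := by
    intro w
    rw [sum_signType]
    simp
    ring
  simp_rw [e]
  rw [Fin.sum_univ_four, sum_signType]
  have e0 : root 0 = 1 := by simp [root]
  have e1 : root 1 = Complex.I := by simp [root]
  have e2 : root 2 = -1 := by simp [root]
  have e3 : root 3 = -Complex.I := by simp [root, pow_succ]
  have r2 : b 0 + ρ * (starRingEnd ℂ (root 2) * b (-1) + root 2 * b 1) =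
      b 0 - ρ * (starRingEnd ℂ 1 * b (-1) + 1 * b 1) := by
    rw [e2]; simp; ring
  have r3 : b 0 + ρ * (starRingEnd ℂ (root 3) * b (-1) + root 3 * b 1) =
      b 0 - ρ * (starRingEnd ℂ Complex.I * b (-1) + Complex.I * b 1) := by
    rw [e3]; simp; ring
  rw [r2, r3, e0, e1]
  simp only [Fintype.card_fin, Nat.cast_ofNat]
  linarith

/-- The monomial `∏ z_i ^ δ_i`. -/
def monomial {ι : Type} [Fintype ι] (z : ι → ℂ) (δ : ι → SignType) : ℂ := ∏ i, signPow (z i) (δ i)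

theorem norm_monomial {ι : Type} [Fintype ι] {z : ι → ℂ} (hz : ∀ i, ‖z i‖ = 1) (δ : ι → SignType) :
    ‖monomial z δ‖ = 1 := by
  simp [monomial, norm_prod, norm_signPow (hz _)]

theorem sum_monomial_root_pow_le {ι : Type} [Fintype ι] [DecidableEq ι] (K q : ℕ)
    (hq : q ≠ 0) (a : (ι → SignType) → ℂ)
    (ha : ∀ δ, a δ ≠ 0 → (Finset.univ.filter fun i => δ i ≠ 0).card = K) :
    ∑ ω : ι → Fin 4, ‖∑ δ, monomial (fun i => root (ω i)) δ * a δ‖ ^ (2 * q) ≤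
      (4 : ℝ) ^ Fintype.card ι * ((10 * q : ℝ) ^ K * ∑ δ, ‖a δ‖ ^ 2) ^ q := by
  have hq1 : (1 : ℝ) ≤ q := by exact_mod_cast Nat.one_le_iff_ne_zero.2 hq
  set ρ : ℝ := Real.sqrt (10 * q)⁻¹ with hρ
  have hρ2 : ρ ^ 2 = (10 * q : ℝ)⁻¹ := Real.sq_sqrt (by positivity)
  have hρ0 : 0 < ρ := Real.sqrt_pos.2 (by positivity)
  have h := tensor_pow_le
    (fun (w : Fin 4) (d : SignType) => (if d = 0 then 1 else (ρ : ℂ)) * signPow (root w) d) q hq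
    (sum_root_two_pow_le (by
      rw [hρ2, ← div_eq_mul_inv, div_le_one (by positivity)]; linarith)) a
  have e : ∀ ω : ι → Fin 4,
      ∑ δ : ι → SignType, (∏ i, ((if δ i = 0 then 1 else (ρ : ℂ)) * signPow (root (ω i)) (δ i))) *
        a δ = ρ ^ K * ∑ δ, monomial (fun i => root (ω i)) δ * a δ := by
    intro ω
    rw [Finset.mul_sum]
    refine Finset.sum_congr rfl fun δ _ => ?_
    by_cases h0 : a δ = 0
    · simp [h0]
    · rw [Finset.prod_mul_distrib, Finset.prod_ite, Finset.prod_const_one, one_mul,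
        Finset.prod_const, ha δ h0, monomial, mul_assoc]
  simp_rw [e, norm_mul, mul_pow] at h
  rw [← Finset.mul_sum] at h
  have e2 : (‖(ρ : ℂ) ^ K‖) ^ (2 * q) = ((10 * q : ℝ)⁻¹ ^ K) ^ q := by
    rw [norm_pow, Complex.norm_real, Real.norm_eq_abs, abs_of_pos hρ0, ← hρ2]
    ring
  rw [e2, inv_pow, inv_pow, inv_mul_le_iff₀ (by positivity)] at h
  rw [mul_pow]
  calc _ ≤ _ := h
    _ = _ := by simp; ring

theorem sum_monomial_mul_prod {ι : Type} [Fintype ι] [DecidableEq ι] (δ : ι → SignType)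
    (z : ι → ℂ) :
    ∑ ω : ι → Fin 4, monomial (fun i => root (ω i)) δ *
      ∏ i, (1 + (starRingEnd ℂ (root (ω i)) * z i + root (ω i) * starRingEnd ℂ (z i)) / 2) =
    4 ^ Fintype.card ι * ((2 : ℂ)⁻¹ ^ (Finset.univ.filter fun i => δ i ≠ 0).card *
      monomial z δ) := by
  have h1 : ∀ (d : SignType) (z : ℂ), ∑ w : Fin 4, signPow (root w) d *
      (1 + (starRingEnd ℂ (root w) * z + root w * starRingEnd ℂ z) / 2) =
        4 * ((if d = 0 then 1 else (2 : ℂ)⁻¹) * signPow z d) := by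
    intro d z
    have e0 : root 0 = 1 := by simp [root]
    have e1 : root 1 = Complex.I := by simp [root]
    have e2 : root 2 = -1 := by simp [root]
    have e3 : root 3 = -Complex.I := by simp [root, pow_succ]
    rw [Fin.sum_univ_four, e0, e1, e2, e3]
    have hI := Complex.I_sq
    cases d
    · simp [signPow]; ring
    · simp [signPow]; ring_nf; simp only [hI]; ring
    · simp [signPow]; ring_nf; simp only [hI]; ring
  simp_rw [monomial, ← Finset.prod_mul_distrib]
  rw [← Fintype.prod_sum (fun i (w : Fin 4) => signPow (root w) (δ i) *
      (1 + (starRingEnd ℂ (root w) * z i + root w * starRingEnd ℂ (z i)) / 2))]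
  simp_rw [h1]
  rw [Finset.prod_mul_distrib, Finset.prod_mul_distrib, Finset.prod_ite]
  simp


/-- The Riesz product `∏ (1 + Re (conj ω_i z_i))`. -/
noncomputable def riesz {ι : Type} [Fintype ι] (ω : ι → Fin 4) (z : ι → ℂ) : ℝ :=
  ∏ i, (1 + (starRingEnd ℂ (root (ω i)) * z i).re)

theorem riesz_nonneg {ι : Type} [Fintype ι] (ω : ι → Fin 4) {z : ι → ℂ} (hz : ∀ i, ‖z i‖ = 1) :
    0 ≤ riesz ω z := by
  refine Finset.prod_nonneg fun i _ => ?_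
  have h := Complex.abs_re_le_norm (starRingEnd ℂ (root (ω i)) * z i)
  rw [norm_mul, RCLike.norm_conj, norm_root, hz, one_mul] at h
  linarith [(abs_le.1 h).1]

theorem ofReal_riesz {ι : Type} [Fintype ι] (ω : ι → Fin 4) (z : ι → ℂ) :
    (riesz ω z : ℂ) =
      ∏ i, (1 + (starRingEnd ℂ (root (ω i)) * z i + root (ω i) * starRingEnd ℂ (z i)) / 2) := by
  rw [riesz, Complex.ofReal_prod]
  refine Finset.prod_congr rfl fun i _ => ?_
  have : root (ω i) * starRingEnd ℂ (z i) = starRingEnd ℂ (starRingEnd ℂ (root (ω i)) * z i) := by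
    simp
  rw [this, Complex.add_conj]
  push_cast
  ring

theorem ofReal_riesz_eq_sum {ι : Type} [Fintype ι] [DecidableEq ι] (ω : ι → Fin 4) (z : ι → ℂ) :
    (riesz ω z : ℂ) = ∑ δ : ι → SignType,
      (∏ i, (if δ i = 0 then 1 else 2⁻¹ * starRingEnd ℂ (signPow (root (ω i)) (δ i)))) *
        monomial z δ := by
  simp_rw [ofReal_riesz, monomial, ← Finset.prod_mul_distrib]
  rw [← Fintype.prod_sum (fun i (d : SignType) =>
    (if d = 0 then 1 else 2⁻¹ * starRingEnd ℂ (signPow (root (ω i)) d)) * signPow (z i) d)]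
  refine Finset.prod_congr rfl fun i _ => ?_
  rw [sum_signType]
  simp
  ring

theorem sum_riesz {ι : Type} [Fintype ι] [DecidableEq ι] (z : ι → ℂ) :
    ∑ ω : ι → Fin 4, riesz ω z = 4 ^ Fintype.card ι := by
  have h := sum_monomial_mul_prod (0 : ι → SignType) z
  simp_rw [← ofReal_riesz] at h
  simp [monomial] at h
  exact_mod_cast h

theorem sum_monomial_mul_riesz {ι : Type} [Fintype ι] [DecidableEq ι] {K : ℕ}
    {a : (ι → SignType) → ℂ}
    (ha : ∀ δ, a δ ≠ 0 → (Finset.univ.filter fun i => δ i ≠ 0).card = K) (x y : ι → ℂ) :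
    ∑ ω : ι → Fin 4, (riesz ω y : ℂ) *
        ∑ δ, monomial (fun i => root (ω i)) δ * (a δ * monomial x δ) =
      4 ^ Fintype.card ι * (2⁻¹ ^ K * ∑ δ, a δ * monomial (fun i => x i * y i) δ) := by
  simp_rw [Finset.mul_sum]
  rw [Finset.sum_comm]
  refine Finset.sum_congr rfl fun δ _ => ?_
  by_cases h0 : a δ = 0
  · simp [h0]
  have h := sum_monomial_mul_prod δ y
  simp_rw [← ofReal_riesz] at h
  rw [ha δ h0] at h
  calc _ = (∑ ω : ι → Fin 4, monomial (fun i => root (ω i)) δ * (riesz ω y : ℂ)) *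
          (a δ * monomial x δ) := by
        rw [Finset.sum_mul]
        exact Finset.sum_congr rfl fun ω _ => by ring
    _ = _ := by
        rw [h]
        simp only [monomial, signPow_mul, Finset.prod_mul_distrib]
        ring

theorem continuous_monomial {X : Type} [TopologicalSpace X] {ι : Type} [Fintype ι] {χ : ι → X → ℂ}
    (hχ : ∀ i, Continuous (χ i)) (δ : ι → SignType) :
    Continuous fun x => monomial (fun i => χ i x) δ :=
  continuous_finsetProd _ fun i _ => (continuous_signPow _).comp (hχ i)

theorem integrable_of_continuous {X : Type} [TopologicalSpace X] [CompactSpace X]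
    [MeasurableSpace X] [BorelSpace X] {μ : Measure X} [IsProbabilityMeasure μ] {E : Type}
    [NormedAddCommGroup E] [SecondCountableTopology E] {f : X → E} (hf : Continuous f) : Integrable f μ := by
  obtain ⟨C, hC⟩ := (isCompact_range hf).isBounded.exists_norm_le
  borelize E
  exact Integrable.of_bound hf.measurable.aestronglyMeasurable C
    (Filter.Eventually.of_forall fun x => hC _ ⟨x, rfl⟩)

theorem integral_riesz {X : Type} [TopologicalSpace X] [CompactSpace X]
    [MeasurableSpace X] [BorelSpace X] {μ : Measure X} [IsProbabilityMeasure μ] {ι : Type}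
    [Fintype ι] [DecidableEq ι] {χ : ι → X → ℂ} (hχ : ∀ i, Continuous (χ i))
    (hdiss : ∀ δ : ι → SignType, δ ≠ 0 → ∫ x, monomial (fun i => χ i x) δ ∂μ = 0)
    (ω : ι → Fin 4) : ∫ x, riesz ω (fun i => χ i x) ∂μ = 1 := by
  have h : ((∫ x, riesz ω (fun i => χ i x) ∂μ : ℝ) : ℂ) = 1 := by
    rw [← integral_complex_ofReal]
    simp_rw [ofReal_riesz_eq_sum]
    rw [integral_finsetSum _ fun δ _ =>
      (integrable_of_continuous (continuous_monomial hχ δ)).const_mul _]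
    simp_rw [integral_const_mul]
    rw [Finset.sum_eq_single (0 : ι → SignType)]
    · simp [monomial]
    · intro δ _ hδ
      rw [hdiss δ hδ, mul_zero]
    · simp
  exact_mod_cast h

/-- Moment bounds for homogeneous polynomials in a dissociate family of characters. -/
theorem integral_norm_pow_le {X : Type} [AddCommGroup X] [TopologicalSpace X] [CompactSpace X]
    [MeasurableSpace X] [BorelSpace X] [MeasurableAdd X] {μ : Measure X} [IsProbabilityMeasure μ]
    [μ.IsAddRightInvariant] {ι : Type} [Fintype ι] [DecidableEq ι] {χ : ι → X → ℂ}
    (hχ : ∀ i, Continuous (χ i)) (hnorm : ∀ i x, ‖χ i x‖ = 1)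
    (hadd : ∀ i x y, χ i (x - y) * χ i y = χ i x)
    (hdiss : ∀ δ : ι → SignType, δ ≠ 0 → ∫ x, monomial (fun i => χ i x) δ ∂μ = 0)
    (K q : ℕ) (hq : q ≠ 0) (a : (ι → SignType) → ℂ)
    (ha : ∀ δ, a δ ≠ 0 → (Finset.univ.filter fun i => δ i ≠ 0).card = K) :
    ∫ x, ‖∑ δ, a δ * monomial (fun i => χ i x) δ‖ ^ (2 * q) ∂μ ≤
      ((40 * q : ℝ) ^ K * ∑ δ, ‖a δ‖ ^ 2) ^ q := by
  set N : ℝ := 4 ^ Fintype.card ι with hN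
  have hN0 : 0 < N := by positivity
  set g : X → ℂ := fun x => ∑ δ, a δ * monomial (fun i => χ i x) δ with hg
  set G : (ι → Fin 4) → X → ℂ := fun ω x =>
    ∑ δ, monomial (fun i => root (ω i)) δ * (a δ * monomial (fun i => χ i x) δ) with hG
  set R : (ι → Fin 4) → X → ℝ := fun ω x => riesz ω (fun i => χ i x) with hR
  have hgc : Continuous g :=
    continuous_finsetSum _ fun δ _ => continuous_const.mul (continuous_monomial hχ δ)
  have hGc : ∀ ω, Continuous (G ω) := fun ω =>
    continuous_finsetSum _ fun δ _ => continuous_const.mul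
      (continuous_const.mul (continuous_monomial hχ δ))
  have hRc : ∀ ω, Continuous (R ω) := fun ω =>
    continuous_finsetProd _ fun i _ => continuous_const.add
      (Complex.continuous_re.comp (continuous_const.mul (hχ i)))
  have hR0 : ∀ ω y, 0 ≤ R ω y := fun ω y => riesz_nonneg ω fun i => hnorm i y
  have hRsum : ∀ y, ∑ ω, R ω y / N = 1 := fun y => by
    rw [← Finset.sum_div, sum_riesz, div_self hN0.ne']
  have hpt : ∀ x y, ((2 : ℝ)⁻¹ ^ K) ^ (2 * q) * ‖g x‖ ^ (2 * q) ≤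
      ∑ ω, R ω y / N * ‖G ω (x - y)‖ ^ (2 * q) := by
    intro x y
    have h := sum_monomial_mul_riesz ha (fun i => χ i (x - y)) (fun i => χ i y)
    simp_rw [hadd] at h
    have h2 : (2 : ℝ)⁻¹ ^ K * ‖g x‖ ≤ ∑ ω, R ω y / N * ‖G ω (x - y)‖ := by
      have h3 : N * ((2 : ℝ)⁻¹ ^ K * ‖g x‖) ≤ ∑ ω, R ω y * ‖G ω (x - y)‖ := by
        calc _ = ‖(4 : ℂ) ^ Fintype.card ι * (2⁻¹ ^ K * g x)‖ := by simp [hN]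
          _ = ‖∑ ω : ι → Fin 4, (R ω y : ℂ) * G ω (x - y)‖ := by rw [← h]
          _ ≤ _ := by
            refine (norm_sum_le _ _).trans_eq (Finset.sum_congr rfl fun ω _ => ?_)
            rw [norm_mul, Complex.norm_real, Real.norm_eq_abs, abs_of_nonneg (hR0 ω y)]
      calc _ ≤ (∑ ω, R ω y * ‖G ω (x - y)‖) / N := by
            rwa [le_div_iff₀ hN0, mul_comm]
        _ = _ := by
          rw [Finset.sum_div]
          exact Finset.sum_congr rfl fun ω _ => by ring
    rw [← mul_pow]
    exact (pow_le_pow_left₀ (by positivity) h2 _).trans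
      (Real.pow_arith_mean_le_arith_mean_pow _ _ _ (fun ω _ => div_nonneg (hR0 ω y) hN0.le)
        (hRsum y) (fun ω _ => norm_nonneg _) _)
  have hGi : ∀ ω, Integrable (fun x => ‖G ω x‖ ^ (2 * q)) μ := fun ω =>
    integrable_of_continuous ((hGc ω).norm.pow _)
  have hint : ∀ y, ((2 : ℝ)⁻¹ ^ K) ^ (2 * q) * ∫ x, ‖g x‖ ^ (2 * q) ∂μ ≤
      ∑ ω, R ω y / N * ∫ x, ‖G ω x‖ ^ (2 * q) ∂μ := by
    intro y
    rw [← integral_const_mul]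
    have e : ∀ ω, ∫ x, ‖G ω x‖ ^ (2 * q) ∂μ = ∫ x, ‖G ω (x - y)‖ ^ (2 * q) ∂μ := fun ω =>
      (integral_sub_right_eq_self (fun x => ‖G ω x‖ ^ (2 * q)) y).symm
    have hi : ∀ ω, Integrable (fun x => ‖G ω (x - y)‖ ^ (2 * q)) μ := fun ω =>
      (hGi ω).comp_sub_right y
    simp_rw [e, ← integral_const_mul]
    rw [← integral_finsetSum _ fun ω _ => (hi ω).const_mul _]
    exact integral_mono ((integrable_of_continuous (hgc.norm.pow _)).const_mul _)
      (integrable_finsetSum _ fun ω _ => (hi ω).const_mul _) fun x => hpt x y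
  have hint2 : ((2 : ℝ)⁻¹ ^ K) ^ (2 * q) * ∫ x, ‖g x‖ ^ (2 * q) ∂μ ≤
      ∑ ω, 1 / N * ∫ x, ‖G ω x‖ ^ (2 * q) ∂μ := by
    have hi : ∀ ω, Integrable (fun y => R ω y / N * ∫ x, ‖G ω x‖ ^ (2 * q) ∂μ) μ := fun ω =>
      ((integrable_of_continuous (hRc ω)).div_const _).mul_const _
    have := integral_mono (integrable_const _) (integrable_finsetSum Finset.univ fun ω _ => hi ω)
      hint
    rw [integral_const, integral_finsetSum _ fun ω _ => hi ω] at this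
    simp_rw [integral_mul_const, integral_div] at this
    simpa [hR, integral_riesz hχ hdiss] using this
  have hfin : ∑ ω, 1 / N * ∫ x, ‖G ω x‖ ^ (2 * q) ∂μ ≤
      ((10 * q : ℝ) ^ K * ∑ δ, ‖a δ‖ ^ 2) ^ q := by
    rw [← Finset.mul_sum, ← integral_finsetSum _ fun ω _ => hGi ω, one_div,
      inv_mul_le_iff₀ hN0]
    have hb : ∀ x, ∑ ω, ‖G ω x‖ ^ (2 * q) ≤ N * ((10 * q : ℝ) ^ K * ∑ δ, ‖a δ‖ ^ 2) ^ q := by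
      intro x
      have := sum_monomial_root_pow_le K q hq (fun δ => a δ * monomial (fun i => χ i x) δ)
        fun δ h => ha δ (left_ne_zero_of_mul h)
      simpa [norm_monomial (fun i => hnorm i x)] using this
    have := integral_mono (integrable_finsetSum Finset.univ fun ω _ => hGi ω)
      (integrable_const (μ := μ) _) hb
    simpa using this
  have h4 := hint2.trans hfin
  have e4 : ((2 : ℝ)⁻¹ ^ K) ^ (2 * q) = (((4 : ℝ) ^ K) ^ q)⁻¹ := by
    rw [show (4 : ℝ) = 2 ^ 2 by norm_num]
    simp only [← pow_mul, inv_pow]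
    ring_nf
  rw [e4, inv_mul_le_iff₀ (by positivity)] at h4
  refine h4.trans_eq ?_
  rw [← mul_pow, ← mul_assoc, ← mul_pow]
  ring_nf


/-- A Young-type inequality between `u log^{K/2}(1 + u)` and a power series in `w`. -/
theorem exists_mul_le {K : ℕ} (hK : K ≠ 0) {u w : ℝ} (hu : 0 ≤ u) (hw : 0 ≤ w) :
    ∃ q : ℕ, u * w ≤ (2 * Real.exp 1) ^ ((K : ℝ) / 2) * (u * Real.log (1 + u) ^ ((K : ℝ) / 2)) +
      (w ^ 2 + Real.exp 1 * (w ^ (2 * q) / (q : ℝ) ^ (K * q))) := by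
  set l := Real.log (1 + u) with hl
  have hl0 : 0 ≤ l := Real.log_nonneg (by linarith)
  have he := Real.exp_pos 1
  have hul : u ≤ Real.exp l := by rw [hl, Real.exp_log (by linarith)]; linarith
  refine ⟨⌊2 * l⌋₊, ?_⟩
  set q := ⌊2 * l⌋₊ with hq
  rcases le_or_gt (w ^ 2) ((2 * Real.exp 1 * l) ^ K) with h | h
  · have h1 : w ≤ (2 * Real.exp 1) ^ ((K : ℝ) / 2) * l ^ ((K : ℝ) / 2) := by
      rw [← Real.mul_rpow (by positivity) hl0]
      refine le_of_sq_le_sq ?_ (by positivity)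
      rw [← Real.rpow_natCast (_ ^ _) 2, ← Real.rpow_mul (by positivity)]
      simpa using h
    have h2 : 0 ≤ w ^ 2 + Real.exp 1 * (w ^ (2 * q) / (q : ℝ) ^ (K * q)) := by positivity
    have h3 := mul_le_mul_of_nonneg_left h1 hu
    linarith
  · have hu2 : u ^ 2 ≤ Real.exp 1 * Real.exp 1 ^ q := by
      calc u ^ 2 ≤ Real.exp l ^ 2 := by gcongr
        _ = Real.exp (2 * l) := by rw [← Real.exp_nat_mul]; norm_num
        _ ≤ Real.exp (q + 1) := Real.exp_le_exp.2 (Nat.lt_floor_add_one (2 * l)).le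
        _ = _ := by rw [← Real.exp_nat_mul, ← Real.exp_add]; ring_nf
    have hexp : Real.exp 1 ^ q ≤ w ^ (2 * q) / (q : ℝ) ^ (K * q) := by
      rcases Nat.eq_zero_or_pos q with h0 | h0
      · rw [h0]; simp
      have h0' : (0 : ℝ) < q := by exact_mod_cast h0
      rw [le_div_iff₀ (by positivity), pow_mul, pow_mul, ← mul_pow]
      refine pow_le_pow_left₀ (by positivity) (le_trans ?_ h.le) _
      calc Real.exp 1 * (q : ℝ) ^ K ≤ Real.exp 1 ^ K * (q : ℝ) ^ K := by
            gcongr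
            exact le_self_pow₀ (Real.one_le_exp zero_le_one) hK
        _ = (Real.exp 1 * q) ^ K := (mul_pow _ _ _).symm
        _ ≤ (Real.exp 1 * (2 * l)) ^ K := by
            gcongr
            exact Nat.floor_le (by positivity)
        _ = _ := by ring_nf
    have h3 : u ^ 2 ≤ Real.exp 1 * (w ^ (2 * q) / (q : ℝ) ^ (K * q)) :=
      hu2.trans (by gcongr)
    have h4 : 0 ≤ (2 * Real.exp 1) ^ ((K : ℝ) / 2) * (u * l ^ ((K : ℝ) / 2)) := by positivity
    nlinarith [sq_nonneg (u - w)]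

/-- The constant scaling the polynomial so that its normalized moments are summable. -/
noncomputable def scale (K : ℕ) : ℝ := Real.sqrt (2 * 40 ^ K)

theorem scale_pos (K : ℕ) : 0 < scale K := Real.sqrt_pos.2 (by positivity)

/-- Duality between `L log^{K/2} L` and functions whose `2q`-th moments are at most
`(40 q)^{Kq}`. -/
theorem lintegral_mul_le {X : Type} [MeasurableSpace X] {μ : Measure X} [IsProbabilityMeasure μ]
    {K : ℕ} (hK : K ≠ 0) (f : X → ℂ) {g : X → ℂ} (hg : Measurable g)
    (hi : ∀ q : ℕ, Integrable (fun x => ‖g x‖ ^ (2 * q)) μ)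
    (hmom : ∀ q : ℕ, q ≠ 0 → ∫ x, ‖g x‖ ^ (2 * q) ∂μ ≤ ((40 * q : ℝ) ^ K) ^ q) :
    ∫⁻ x, ‖f x‖ₑ * ‖g x‖ₑ ∂μ ≤
      ENNReal.ofReal (scale K * (2 * Real.exp 1) ^ ((K : ℝ) / 2)) *
        ∫⁻ x, ‖f x‖ₑ * ENNReal.ofReal (Real.log (1 + ‖f x‖) ^ ((K : ℝ) / 2)) ∂μ +
      ENNReal.ofReal (scale K * (1 + Real.exp 1) * 2) := by
  have hM := scale_pos K
  have he := Real.exp_pos 1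
  set P : ℕ → X → ℝ := fun q x => (‖g x‖ / scale K) ^ (2 * q) / (q : ℝ) ^ (K * q) with hP
  have hP0 : ∀ q x, 0 ≤ P q x := fun q x => by positivity
  have hPm : ∀ q, Measurable (P q) := fun q => by fun_prop
  have hPi : ∀ q, Integrable (P q) μ := fun q => by
    simp only [hP, div_pow]
    exact ((hi q).div_const _).div_const _
  have hPint : ∀ q, ∫⁻ x, ENNReal.ofReal (P q x) ∂μ ≤ 2⁻¹ ^ q := by
    intro q
    rw [← ofReal_integral_eq_lintegral_ofReal (hPi q) (Filter.Eventually.of_forall (hP0 q)),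
      show (2⁻¹ : ℝ≥0∞) = ENNReal.ofReal 2⁻¹ by
        rw [ENNReal.ofReal_inv_of_pos two_pos]; simp, ← ENNReal.ofReal_pow (by norm_num)]
    refine ENNReal.ofReal_le_ofReal ?_
    rcases eq_or_ne q 0 with rfl | hq
    · simp [hP]
    have hq0 : (0 : ℝ) < q := by exact_mod_cast Nat.pos_of_ne_zero hq
    simp only [hP, div_pow]
    rw [integral_div, integral_div, div_le_iff₀ (by positivity), div_le_iff₀ (by positivity)]
    refine (hmom q hq).trans_eq ?_
    rw [pow_mul (scale K), scale, Real.sq_sqrt (by positivity), pow_mul, ← mul_pow, ← mul_pow]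
    congr 1
    rw [mul_pow]
    ring
  have hpt : ∀ x, ‖f x‖ₑ * ‖g x‖ₑ ≤
      ENNReal.ofReal (scale K * (2 * Real.exp 1) ^ ((K : ℝ) / 2)) *
        (‖f x‖ₑ * ENNReal.ofReal (Real.log (1 + ‖f x‖) ^ ((K : ℝ) / 2))) +
      ENNReal.ofReal (scale K * (1 + Real.exp 1)) * ∑' q, ENNReal.ofReal (P q x) := by
    intro x
    obtain ⟨q, h⟩ := exists_mul_le hK (norm_nonneg (f x))
      (show 0 ≤ ‖g x‖ / scale K by positivity)
    have h1 : P 1 x = (‖g x‖ / scale K) ^ 2 := by simp [hP]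
    rw [← h1] at h
    have hlog : 0 ≤ Real.log (1 + ‖f x‖) := Real.log_nonneg (by linarith [norm_nonneg (f x)])
    have h2 : ‖f x‖ * ‖g x‖ ≤ scale K * (2 * Real.exp 1) ^ ((K : ℝ) / 2) *
        (‖f x‖ * Real.log (1 + ‖f x‖) ^ ((K : ℝ) / 2)) +
        (scale K * P 1 x + scale K * Real.exp 1 * P q x) := by
      calc _ = scale K * (‖f x‖ * (‖g x‖ / scale K)) := by field_simp
        _ ≤ _ := mul_le_mul_of_nonneg_left h hM.le
        _ = _ := by simp only [hP]; ring
    have h3 := ENNReal.ofReal_le_ofReal h2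
    rw [ENNReal.ofReal_mul (norm_nonneg _), ofReal_norm, ofReal_norm,
      ENNReal.ofReal_add (by positivity) (add_nonneg (mul_nonneg hM.le (hP0 _ _))
        (mul_nonneg (by positivity) (hP0 _ _))),
      ENNReal.ofReal_mul (by positivity), ENNReal.ofReal_mul (norm_nonneg _), ofReal_norm,
      ENNReal.ofReal_add (mul_nonneg hM.le (hP0 _ _)) (mul_nonneg (by positivity) (hP0 _ _)),
      ENNReal.ofReal_mul hM.le, ENNReal.ofReal_mul (by positivity)] at h3
    refine h3.trans (add_le_add (by rw [ENNReal.ofReal_mul hM.le]) ?_)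
    calc _ ≤ ENNReal.ofReal (scale K) * ∑' q, ENNReal.ofReal (P q x) +
          ENNReal.ofReal (scale K * Real.exp 1) * ∑' q, ENNReal.ofReal (P q x) := by
          gcongr
          · exact ENNReal.le_tsum (f := fun q => ENNReal.ofReal (P q x)) 1
          · rw [ENNReal.ofReal_mul (by positivity : 0 ≤ scale K * Real.exp 1)]
            gcongr
            exact ENNReal.le_tsum (f := fun q => ENNReal.ofReal (P q x)) q
      _ = _ := by
          rw [← add_mul, ← ENNReal.ofReal_add (by positivity) (by positivity)]
          ring_nf
  refine (lintegral_mono hpt).trans ?_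
  rw [lintegral_add_right _ (by fun_prop), lintegral_const_mul' _ _ ENNReal.ofReal_ne_top,
    lintegral_const_mul' _ _ ENNReal.ofReal_ne_top, lintegral_tsum (by fun_prop),
    ENNReal.ofReal_mul (by positivity : 0 ≤ scale K * (1 + Real.exp 1))]
  gcongr
  refine (ENNReal.tsum_le_tsum hPint).trans ?_
  rw [ENNReal.tsum_geometric]
  simp

/-- Zygmund's inequality for finitely many homogeneous monomials in a dissociate family of
characters of a compact group. -/
theorem ofReal_sqrt_sum_le {X : Type} [AddCommGroup X] [TopologicalSpace X] [CompactSpace X]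
    [MeasurableSpace X] [BorelSpace X] [MeasurableAdd X] {μ : Measure X} [IsProbabilityMeasure μ]
    [μ.IsAddRightInvariant] {ι : Type} [Fintype ι] [DecidableEq ι] {χ : ι → X → ℂ}
    (hχ : ∀ i, Continuous (χ i)) (hnorm : ∀ i x, ‖χ i x‖ = 1)
    (hadd : ∀ i x y, χ i (x - y) * χ i y = χ i x)
    (hdiss : ∀ δ : ι → SignType, δ ≠ 0 → ∫ x, monomial (fun i => χ i x) δ ∂μ = 0)
    {K : ℕ} (hK : K ≠ 0) {V : Type} [Fintype V] {δ : V → ι → SignType} (hδ : δ.Injective)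
    (hcard : ∀ v, (Finset.univ.filter fun i => δ v i ≠ 0).card = K)
    {f : X → ℂ} (hf : Integrable f μ) :
    ENNReal.ofReal (Real.sqrt
        (∑ v, ‖∫ x, starRingEnd ℂ (monomial (fun i => χ i x) (δ v)) * f x ∂μ‖ ^ 2)) ≤
      ENNReal.ofReal (scale K * (2 * Real.exp 1) ^ ((K : ℝ) / 2)) *
        ∫⁻ x, ‖f x‖ₑ * ENNReal.ofReal (Real.log (1 + ‖f x‖) ^ ((K : ℝ) / 2)) ∂μ +
      ENNReal.ofReal (scale K * (1 + Real.exp 1) * 2) := by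
  set c : V → ℂ := fun v => ∫ x, starRingEnd ℂ (monomial (fun i => χ i x) (δ v)) * f x ∂μ with hc
  set S : ℝ := ∑ v, ‖c v‖ ^ 2 with hS
  rcases (show 0 ≤ S from Finset.sum_nonneg fun v _ => by positivity).eq_or_lt with h0 | h0
  · rw [← h0]; simp
  have hS0 : 0 < Real.sqrt S := Real.sqrt_pos.2 h0
  set b : V → ℂ := fun v => c v / Real.sqrt S with hb
  set a : (ι → SignType) → ℂ := Function.extend δ b 0 with ha
  have hasum : ∑ d, ‖a d‖ ^ 2 = 1 := by
    rw [← Fintype.sum_of_injective δ hδ (fun v => ‖b v‖ ^ 2) (fun d => ‖a d‖ ^ 2)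
      (fun d hd => by simp [ha, Function.extend_apply' _ _ _ (by simpa using hd)])
      (fun v => by simp [ha, hδ.extend_apply])]
    simp only [hb, norm_div, Complex.norm_real, Real.norm_eq_abs, abs_of_pos hS0, div_pow,
      Real.sq_sqrt h0.le]
    rw [← Finset.sum_div, ← hS, div_self h0.ne']
  have hacard : ∀ d, a d ≠ 0 → (Finset.univ.filter fun i => d i ≠ 0).card = K := by
    intro d hd
    by_cases h : ∃ v, δ v = d
    · obtain ⟨v, rfl⟩ := h
      exact hcard v
    · exact absurd (Function.extend_apply' _ _ _ h) hd
  set g : X → ℂ := fun x => ∑ d, a d * monomial (fun i => χ i x) d with hg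
  have hgc : Continuous g :=
    continuous_finsetSum _ fun d _ => continuous_const.mul (continuous_monomial hχ d)
  have hgb : ∀ x, g x = ∑ v, b v * monomial (fun i => χ i x) (δ v) := fun x =>
    (Fintype.sum_of_injective δ hδ (fun v => b v * monomial (fun i => χ i x) (δ v)) _
      (fun d hd => by simp [ha, Function.extend_apply' _ _ _ (by simpa using hd)])
      (fun v => by simp [ha, hδ.extend_apply])).symm
  have hint : ∀ v, Integrable
      (fun x => starRingEnd ℂ (monomial (fun i => χ i x) (δ v)) * f x) μ := fun v =>
    hf.bdd_mul (c := 1) (Complex.continuous_conj.comp (continuous_monomial hχ (δ v))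
      |>.measurable.aestronglyMeasurable) (Filter.Eventually.of_forall fun x => by
        rw [RCLike.norm_conj, norm_monomial fun i => hnorm i x])
  have hdual : (Real.sqrt S : ℂ) = ∫ x, starRingEnd ℂ (g x) * f x ∂μ := by
    have e : ∀ x, starRingEnd ℂ (g x) * f x =
        ∑ v, starRingEnd ℂ (b v) * (starRingEnd ℂ (monomial (fun i => χ i x) (δ v)) * f x) := by
      intro x
      simp [hgb, map_sum, Finset.sum_mul, mul_assoc]
    simp_rw [e]
    rw [integral_finsetSum _ fun v _ => (hint v).const_mul _]
    simp_rw [integral_const_mul]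
    have e2 : ∀ v, starRingEnd ℂ (b v) * c v = ((‖c v‖ ^ 2 / Real.sqrt S : ℝ) : ℂ) := by
      intro v
      simp only [hb, map_div₀, Complex.conj_ofReal, div_mul_eq_mul_div, Complex.conj_mul']
      push_cast
      rfl
    change _ = ∑ v, starRingEnd ℂ (b v) * c v
    simp_rw [e2]
    rw [← Complex.ofReal_sum, ← Finset.sum_div, ← hS, Real.div_sqrt]
  calc ENNReal.ofReal (Real.sqrt S) = ‖(Real.sqrt S : ℂ)‖ₑ := by
        rw [← ofReal_norm, Complex.norm_real, Real.norm_eq_abs, abs_of_pos hS0]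
    _ ≤ ∫⁻ x, ‖f x‖ₑ * ‖g x‖ₑ ∂μ := by
        rw [hdual]
        refine (enorm_integral_le_lintegral_enorm _).trans_eq (lintegral_congr fun x => ?_)
        rw [enorm_mul, mul_comm]
        simp
    _ ≤ _ := lintegral_mul_le hK f hgc.measurable
        (fun q => integrable_of_continuous (hgc.norm.pow _)) fun q hq => by
          have := integral_norm_pow_le hχ hnorm hadd hdiss K q hq a hacard
          rwa [hasum, mul_one] at this

theorem exists_sign_of_mem_lacunarySumset {lam : ℕ → ℕ} {k : ℕ} {x : ℤ}
    (hx : x ∈ lacunarySumset lam k) :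
    ∃ (d : ℕ → SignType) (s : Finset ℕ), s.card = k ∧ (∀ m, d m ≠ 0 ↔ m ∈ s) ∧
      x = ∑ m ∈ s, (d m : ℤ) * lam m := by
  obtain ⟨idx, ε, hidx, hε, rfl⟩ := hx
  have hinj := hidx.injective
  refine ⟨Function.extend idx (fun i => SignType.sign (ε i)) 0,
    Finset.univ.map ⟨idx, hinj⟩, by simp, fun m => ?_, ?_⟩
  · by_cases h : ∃ i, idx i = m
    · obtain ⟨i, rfl⟩ := h
      rw [hinj.extend_apply]
      rcases hε i with h | h <;> simp [h]
    · rw [Function.extend_apply' _ _ _ h]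
      simpa using h
  · rw [Finset.sum_map]
    refine Finset.sum_congr rfl fun i _ => ?_
    simp only [Function.Embedding.coeFn_mk, hinj.extend_apply]
    rcases hε i with h | h <;> simp [h]

theorem sum_range_lt_of_lacunary {lam : ℕ → ℕ} (hpos : ∀ m, 0 < lam m)
    (hlac : ∀ m, 2 * lam m ≤ lam (m + 1)) (M : ℕ) : ∑ m ∈ Finset.range M, lam m < lam M := by
  induction M with
  | zero => simpa using hpos 0
  | succ M ih =>
    rw [Finset.sum_range_succ]
    have := hlac M
    omega

theorem abs_sign_le_one (d : SignType) : |(d : ℤ)| ≤ 1 := by cases d <;> simp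

/-- Lacunary sequences of ratio at least `2` are dissociate. -/
theorem sign_eq_zero_of_sum_eq_zero {lam : ℕ → ℕ} (hpos : ∀ m, 0 < lam m)
    (hlac : ∀ m, 2 * lam m ≤ lam (m + 1)) (d : ℕ → SignType) (M : ℕ)
    (h : ∑ m ∈ Finset.range M, (d m : ℤ) * lam m = 0) : ∀ m < M, d m = 0 := by
  induction M with
  | zero => simp
  | succ M ih =>
    rw [Finset.sum_range_succ] at h
    have hb : |∑ m ∈ Finset.range M, (d m : ℤ) * lam m| < lam M := by
      calc _ ≤ ∑ m ∈ Finset.range M, |(d m : ℤ) * lam m| := Finset.abs_sum_le_sum_abs _ _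
        _ ≤ ∑ m ∈ Finset.range M, (lam m : ℤ) := by
          refine Finset.sum_le_sum fun m _ => ?_
          rw [abs_mul, Nat.abs_cast]
          exact mul_le_of_le_one_left (by positivity) (abs_sign_le_one _)
        _ < lam M := by exact_mod_cast sum_range_lt_of_lacunary hpos hlac M
    have hM : d M = 0 := by
      rw [abs_lt] at hb
      cases hd : d M
      · rfl
      all_goals
        rw [hd] at h
        simp at h
        omega
    rw [hM] at h
    simp only [SignType.coe_zero, zero_mul, add_zero] at h
    intro m hm
    rcases Nat.lt_succ_iff_lt_or_eq.1 hm with h1 | h1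
    · exact ih h m h1
    · rw [h1, hM]

theorem signPow_fourier (a : ℤ) (x : AddCircle (1 : ℝ)) (d : SignType) :
    signPow (fourier a x) d = fourier ((d : ℤ) * a) x := by
  cases d
  · simp [signPow]
  · simp [signPow]
  · simp [signPow]

/-- The frequency of a monomial in the characters `θ ↦ e^{2πi λ_{j,m} θ_j}`. -/
def freq {n M : ℕ} (lam : Fin n → ℕ → ℕ) (δ : Fin n × Fin M → SignType) (j : Fin n) : ℤ :=
  ∑ m : Fin M, (δ (j, m) : ℤ) * lam j m

theorem fourier_sum_apply {κ : Type} (s : Finset κ) (a : κ → ℤ) (x : AddCircle (1 : ℝ)) :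
    (fourier (∑ i ∈ s, a i) x : ℂ) = ∏ i ∈ s, fourier (a i) x := by
  classical
  induction s using Finset.induction_on with
  | empty => simp
  | insert i s hi ih => rw [Finset.sum_insert hi, Finset.prod_insert hi, fourier_add, ih]

theorem monomial_fourier {n M : ℕ} (lam : Fin n → ℕ → ℕ) (δ : Fin n × Fin M → SignType)
    (θ : Fin n → AddCircle (1 : ℝ)) :
    monomial (fun p : Fin n × Fin M => (fourier (lam p.1 p.2 : ℤ) (θ p.1) : ℂ)) δ =
      ∏ j, fourier (freq lam δ j) (θ j) := by
  simp only [monomial, signPow_fourier, Fintype.prod_prod_type, freq, fourier_sum_apply]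

theorem integral_fourier_eq_zero {a : ℤ} (ha : a ≠ 0) :
    ∫ x : AddCircle (1 : ℝ), (fourier a x : ℂ) ∂AddCircle.haarAddCircle = 0 := by
  exact integral_eq_zero_of_add_right_eq_neg (μ := AddCircle.haarAddCircle)
    (f := fun x : AddCircle (1 : ℝ) => (fourier a x : ℂ)) (fourier_add_half_inv_index ha one_pos)

theorem integral_monomial_fourier_eq_zero {n M : ℕ} {lam : Fin n → ℕ → ℕ}
    (hpos : ∀ j m, 0 < lam j m) (hlac : ∀ j m, 2 * lam j m ≤ lam j (m + 1))
    {δ : Fin n × Fin M → SignType} (hδ : δ ≠ 0) :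
    ∫ θ : Fin n → AddCircle (1 : ℝ),
      monomial (fun p : Fin n × Fin M => (fourier (lam p.1 p.2 : ℤ) (θ p.1) : ℂ)) δ
        ∂(Measure.pi fun _ : Fin n => AddCircle.haarAddCircle) = 0 := by
  simp_rw [monomial_fourier]
  rw [integral_fintype_prod_eq_prod
    (fun j (x : AddCircle (1 : ℝ)) => (fourier (freq lam δ j) x : ℂ))]
  have : ∃ j, freq lam δ j ≠ 0 := by
    by_contra! h
    refine hδ (funext fun ⟨j, m⟩ => ?_)
    have := sign_eq_zero_of_sum_eq_zero (hpos j) (hlac j)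
      (fun i => if hi : i < M then δ (j, ⟨i, hi⟩) else 0) M (by
        rw [Finset.sum_range, ← h j, freq]
        simp) m m.2
    simpa using this
  obtain ⟨j, hj⟩ := this
  exact Finset.prod_eq_zero (Finset.mem_univ j) (integral_fourier_eq_zero hj)

theorem exists_sign_of_finset {n : ℕ} {lam : Fin n → ℕ → ℕ} {k : Fin n → ℕ}
    (F : Finset {v : Fin n → ℤ // ∀ j, v j ∈ lacunarySumset (lam j) (k j)}) :
    ∃ (M : ℕ) (δ : F → Fin n × Fin M → SignType),
      (∀ v, (Finset.univ.filter fun i => δ v i ≠ 0).card = ∑ j, k j) ∧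
      ∀ v, freq lam (δ v) = v.1.1 := by
  choose d s hcard hmem hsum using
    fun (v : F) (j : Fin n) => exists_sign_of_mem_lacunarySumset (v.1.2 j)
  obtain ⟨M, hM⟩ :=
    (Finset.univ.biUnion fun v => Finset.univ.biUnion fun j => s v j).exists_nat_subset_range
  have hs : ∀ v j, s v j ⊆ Finset.range M := fun v j =>
    ((Finset.subset_biUnion_of_mem _ (Finset.mem_univ j)).trans
      (Finset.subset_biUnion_of_mem (fun v => Finset.univ.biUnion fun j => s v j)
        (Finset.mem_univ v))).trans hM
  refine ⟨M, fun v p => d v p.1 p.2, fun v => ?_, fun v => funext fun j => ?_⟩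
  · rw [Finset.card_filter, Fintype.sum_prod_type]
    refine Finset.sum_congr rfl fun j _ => ?_
    rw [Fin.sum_univ_eq_sum_range (fun m => if d v j m ≠ 0 then 1 else 0) M, ← hcard v j,
      ← Finset.card_filter]
    congr 1
    ext m
    simp only [Finset.mem_filter, hmem]
    exact ⟨fun h => h.2, fun h => ⟨hs v j h, h⟩⟩
  · rw [freq, Fin.sum_univ_eq_sum_range (fun m => (d v j m : ℤ) * lam j m) M, hsum v j]
    refine (Finset.sum_subset (hs v j) fun m _ hm => ?_).symm
    have : d v j m = 0 := by
      by_contra h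
      exact hm ((hmem v j m).1 h)
    simp [this]

theorem ofReal_sqrt_sum_piFourierCoeff_le {n : ℕ} {lam : Fin n → ℕ → ℕ}
    (hpos : ∀ j m, 0 < lam j m) (hlac : ∀ j m, 2 * lam j m ≤ lam j (m + 1))
    {k : Fin n → ℕ} (hK : ∑ j, k j ≠ 0) {f : (Fin n → AddCircle (1 : ℝ)) → ℂ}
    (hf : Integrable f (Measure.pi fun _ : Fin n => AddCircle.haarAddCircle))
    (F : Finset {v : Fin n → ℤ // ∀ j, v j ∈ lacunarySumset (lam j) (k j)}) :
    ENNReal.ofReal (Real.sqrt (∑ v ∈ F, ‖piFourierCoeff f v.1‖ ^ 2)) ≤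
      ENNReal.ofReal (scale (∑ j, k j) * (2 * Real.exp 1) ^ (((∑ j, k j : ℕ) : ℝ) / 2)) *
        ∫⁻ θ, ‖f θ‖ₑ * ENNReal.ofReal (Real.log (1 + ‖f θ‖) ^ (((∑ j, k j : ℕ) : ℝ) / 2))
          ∂(Measure.pi fun _ : Fin n => AddCircle.haarAddCircle) +
      ENNReal.ofReal (scale (∑ j, k j) * (1 + Real.exp 1) * 2) := by
  obtain ⟨M, δ, hcard, hfreq⟩ := exists_sign_of_finset F
  have hinj : δ.Injective := fun v w h =>
    Subtype.ext (Subtype.ext (by rw [← hfreq v, ← hfreq w, h]))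
  have h := ofReal_sqrt_sum_le
    (χ := fun (p : Fin n × Fin M) (θ : Fin n → AddCircle (1 : ℝ)) =>
      (fourier (lam p.1 p.2 : ℤ) (θ p.1) : ℂ))
    (fun p => (fourier (lam p.1 p.2 : ℤ)).continuous.comp (continuous_apply p.1))
    (fun p θ => Circle.norm_coe _)
    (fun p x y => by
      simp only [fourier_apply, Pi.sub_apply]
      rw [← Circle.coe_mul, ← AddCircle.toCircle_add, ← smul_add, sub_add_cancel])
    (fun δ hδ => integral_monomial_fourier_eq_zero hpos hlac hδ) hK hinj hcard hf
  rw [← Finset.sum_coe_sort F fun v => ‖piFourierCoeff f v.1‖ ^ 2]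
  convert h using 6 with v
  rw [piFourierCoeff]
  refine integral_congr_ae (Filter.Eventually.of_forall fun θ => ?_)
  simp only [monomial_fourier, hfreq, map_prod, fourier_neg]

end LacunaryZygmund

/-- **Higher-dimensional Bonami/Zygmund inequality** for products of `k_j`-fold sumsets of
lacunary sequences with ratio at least `2`. -/
theorem zygmund_for_products_of_lacunary_sumsets
    {n : ℕ} (hn : 1 ≤ n) (lam : Fin n → ℕ → ℕ)
    (hpos : ∀ j m, 0 < lam j m) (hmono : ∀ j, StrictMono (lam j))
    (hlac : ∀ j m, 2 * lam j m ≤ lam j (m + 1))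
    (k : Fin n → ℕ) (hk : ∀ j, 1 ≤ k j) :
    ∃ A B : ℝ, 0 < A ∧ 0 < B ∧
      ∀ f : (Fin n → AddCircle (1 : ℝ)) → ℂ,
        Integrable f (Measure.pi fun _ : Fin n => AddCircle.haarAddCircle) →
        (∑' v : {v : Fin n → ℤ // ∀ j, v j ∈ lacunarySumset (lam j) (k j)},
            (‖piFourierCoeff f v.1‖₊ : ℝ≥0∞) ^ 2) ^ ((1 : ℝ) / 2)
          ≤ ENNReal.ofReal A *
              (∫⁻ θ, (‖f θ‖₊ : ℝ≥0∞) *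
                ENNReal.ofReal (Real.log (1 + ‖f θ‖) ^ (((∑ j, k j : ℕ) : ℝ) / 2))
                ∂(Measure.pi fun _ : Fin n => AddCircle.haarAddCircle))
            + ENNReal.ofReal B := by
  have hK : ∑ j, k j ≠ 0 := by
    have := Finset.single_le_sum (f := k) (fun j _ => Nat.zero_le _) (Finset.mem_univ ⟨0, hn⟩)
    have := hk ⟨0, hn⟩
    omega
  have hM := LacunaryZygmund.scale_pos (∑ j, k j)
  refine ⟨LacunaryZygmund.scale (∑ j, k j) * (2 * Real.exp 1) ^ (((∑ j, k j : ℕ) : ℝ) / 2),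
    LacunaryZygmund.scale (∑ j, k j) * (1 + Real.exp 1) * 2, by positivity, by positivity,
    fun f hf => ?_⟩
  have key := LacunaryZygmund.ofReal_sqrt_sum_piFourierCoeff_le hpos hlac hK hf
  rw [one_div, ENNReal.rpow_inv_le_iff two_pos, ENNReal.tsum_eq_iSup_sum]
  refine iSup_le fun F => ?_
  rw [← ENNReal.rpow_inv_le_iff two_pos]
  refine le_trans (le_of_eq ?_) (key F)
  rw [Real.sqrt_eq_rpow, ← ENNReal.ofReal_rpow_of_nonneg
    (Finset.sum_nonneg fun v _ => by positivity) (by norm_num), one_div,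
    ENNReal.ofReal_sum_of_nonneg fun v _ => by positivity]
  congr 1
  refine Finset.sum_congr rfl fun v _ => ?_
  rw [ENNReal.ofReal_pow (norm_nonneg _), ofReal_norm]
  rfl
end

section
/- Let n ≥ 1 and let E ⊆ ℤⁿ be a set for which there exist constants C_E > 0 and N_E ∈ ℕ such that every trigonometric polynomial g on 𝕋ⁿ with Fourier coefficients supported in E satisfies ‖g‖_{L^p(𝕋ⁿ)} ≤ C_E · p^{N_E/2} · ‖g‖_{L²(𝕋ⁿ)} for all p > 2. Let Λ = (λ_m)_{m ∈ ℕ} be a strictly increasing sequence of positive integers with λ_{m+1} ≥ 2λ_m for all m, let k ∈ ℕ, and put Λ^{(k)} = { ε₁ λ_{n₁} + ⋯ + ε_k λ_{n_k} : n₁ > ⋯ > n_k, ε_i ∈ {+1, −1} } ⊂ ℤ. Then there exist positive constants A and B such that for every integrable function f : 𝕋^{n+1} → ℂ, ( ∑_{(m, l) ∈ E × Λ^{(k)}} |f̂(m, l)|² )^{1/2} ≤ A ∫_{𝕋^{n+1}} |f(θ)| log^{(N_E + k)/2}(1 + |f(θ)|) dθ + B. -/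
open MeasureTheory ENNReal NNReal

/-- The normalized Haar measure on `𝕋ⁿ`. -/
noncomputable def haarPi (n : ℕ) : Measure (Fin n → AddCircle (1 : ℝ)) :=
  Measure.pi fun _ : Fin n => AddCircle.haarAddCircle

/-- The normalized Haar measure on `𝕋^{n+1} = 𝕋ⁿ × 𝕋`. -/
noncomputable def haarPiProd (n : ℕ) :
    Measure ((Fin n → AddCircle (1 : ℝ)) × AddCircle (1 : ℝ)) :=
  (haarPi n).prod AddCircle.haarAddCircle

/-- The Fourier coefficient of `f : 𝕋^{n+1} → ℂ` at frequency `(m, l) ∈ ℤⁿ × ℤ`. -/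
noncomputable def prodFourierCoeff {n : ℕ}
    (f : (Fin n → AddCircle (1 : ℝ)) × AddCircle (1 : ℝ) → ℂ) (m : Fin n → ℤ) (l : ℤ) : ℂ :=
  ∫ θ, (∏ j, fourier (-(m j)) (θ.1 j)) * fourier (-l) θ.2 * f θ ∂(haarPiProd n)

instance (n : ℕ) : IsProbabilityMeasure (haarPi n) := by unfold haarPi; infer_instance

instance (n : ℕ) : IsProbabilityMeasure (haarPiProd n) := by unfold haarPiProd; infer_instance

/-- The torus `𝕋^{n+1} = 𝕋ⁿ × 𝕋`. -/
abbrev TorusProd (n : ℕ) := (Fin n → AddCircle (1 : ℝ)) × AddCircle (1 : ℝ)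

lemma Continuous.memLp_haarPiProd {n : ℕ} {E : Type*} [NormedAddCommGroup E]
    {u : TorusProd n → E} (hu : Continuous u) (p : ℝ≥0∞) : MemLp u p (haarPiProd n) :=
  hu.memLp_of_hasCompactSupport (HasCompactSupport.of_compactSpace u)

lemma Continuous.integrable_haarPiProd {n : ℕ} {E : Type*} [NormedAddCommGroup E]
    {u : TorusProd n → E} (hu : Continuous u) : Integrable u (haarPiProd n) :=
  hu.integrable_of_hasCompactSupport (HasCompactSupport.of_compactSpace u)

/-- The `L^{2q}` norm on `𝕋^{n+1}`. -/
noncomputable def evenNorm {n : ℕ} (q : ℕ) (u : TorusProd n → ℂ) : ℝ :=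
  lpNorm u ((2 * q : ℕ) : ℝ≥0∞) (haarPiProd n)

lemma evenNorm_nonneg {n : ℕ} (q : ℕ) (u : TorusProd n → ℂ) : 0 ≤ evenNorm q u := lpNorm_nonneg

lemma one_le_two_mul_cast {q : ℕ} (hq : 1 ≤ q) : (1 : ℝ≥0∞) ≤ ((2 * q : ℕ) : ℝ≥0∞) := by
  exact_mod_cast (by omega : 1 ≤ 2 * q)

lemma evenNorm_add_le {n q : ℕ} (hq : 1 ≤ q) {u v : TorusProd n → ℂ} (hu : Continuous u) :
    evenNorm q (u + v) ≤ evenNorm q u + evenNorm q v :=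
  lpNorm_add_le (hu.memLp_haarPiProd _) (one_le_two_mul_cast hq)

lemma evenNorm_sum_le {n q : ℕ} (hq : 1 ≤ q) {ι : Type*} {s : Finset ι}
    {u : ι → TorusProd n → ℂ} (hu : ∀ i ∈ s, Continuous (u i)) :
    evenNorm q (∑ i ∈ s, u i) ≤ ∑ i ∈ s, evenNorm q (u i) :=
  lpNorm_sum_le (fun i hi => (hu i hi).memLp_haarPiProd _) (one_le_two_mul_cast hq)

lemma evenNorm_smul {n q : ℕ} (c : ℂ) (u : TorusProd n → ℂ) :
    evenNorm q (c • u) = ‖c‖ * evenNorm q u := by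
  simp [evenNorm, lpNorm_const_smul]

lemma evenNorm_eq_rpow {n q : ℕ} (hq : 1 ≤ q) {u : TorusProd n → ℂ} (hu : Continuous u) :
    evenNorm q u = (∫ θ, ‖u θ‖ ^ (2 * q) ∂(haarPiProd n)) ^ (1 / (2 * q : ℝ)) := by
  rw [evenNorm, lpNorm_eq_integral_norm_rpow_toReal _ (ENNReal.natCast_ne_top _)
    hu.aestronglyMeasurable]
  · simp only [ENNReal.toReal_natCast, Real.rpow_natCast, one_div]
    push_cast
    rfl
  · exact_mod_cast (by omega : 2 * q ≠ 0)

lemma evenNorm_congr_norm {n q : ℕ} (hq : 1 ≤ q) {u v : TorusProd n → ℂ} (hu : Continuous u)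
    (hv : Continuous v) (h : ∀ θ, ‖u θ‖ = ‖v θ‖) : evenNorm q u = evenNorm q v := by
  simp only [evenNorm_eq_rpow hq hu, evenNorm_eq_rpow hq hv, h]

lemma integral_norm_pow_eq_evenNorm {n q : ℕ} (hq : 1 ≤ q) {u : TorusProd n → ℂ}
    (hu : Continuous u) :
    ∫ θ, ‖u θ‖ ^ (2 * q) ∂(haarPiProd n) = evenNorm q u ^ (2 * q) := by
  have h0 : 0 ≤ ∫ θ, ‖u θ‖ ^ (2 * q) ∂(haarPiProd n) := integral_nonneg fun θ => by positivity
  have hq' : (q : ℝ) ≠ 0 := by exact_mod_cast (by omega : q ≠ 0)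
  rw [evenNorm_eq_rpow hq hu, ← Real.rpow_natCast (n := 2 * q), ← Real.rpow_mul h0]
  push_cast
  rw [one_div_mul_cancel (by positivity), Real.rpow_one]

lemma ofReal_pow_rpow_inv {a : ℝ} (ha : 0 ≤ a) {r : ℕ} (hr : r ≠ 0) (m : ℕ) :
    ENNReal.ofReal (a ^ r) ^ ((m : ℝ) / r) = ENNReal.ofReal (a ^ m) := by
  rw [ENNReal.ofReal_rpow_of_nonneg (by positivity) (by positivity), ← Real.rpow_natCast,
    ← Real.rpow_mul ha, mul_div_cancel₀ _ (by exact_mod_cast hr), Real.rpow_natCast]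

/-- Hölder's inequality with exponents `2q/(2q-2)`, `2q` and `2q`. -/
lemma integral_pow_mul_mul_le {n q : ℕ} (hq : 1 ≤ q) {u v w : TorusProd n → ℂ}
    (hu : Continuous u) (hv : Continuous v) (hw : Continuous w) :
    ∫ θ, ‖u θ‖ ^ (2 * q - 2) * ‖v θ‖ * ‖w θ‖ ∂(haarPiProd n) ≤
      evenNorm q u ^ (2 * q - 2) * evenNorm q v * evenNorm q w := by
  have hq0 : 2 * q ≠ 0 := by omega
  have key := ENNReal.lintegral_prod_norm_pow_le (μ := haarPiProd n) (Finset.univ : Finset (Fin 3))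
    (f := ![fun θ => ENNReal.ofReal (‖u θ‖ ^ (2 * q)), fun θ => ENNReal.ofReal (‖v θ‖ ^ (2 * q)),
      fun θ => ENNReal.ofReal (‖w θ‖ ^ (2 * q))])
    (p := ![((2 * q - 2 : ℕ) : ℝ) / (2 * q : ℕ), ((1 : ℕ) : ℝ) / (2 * q : ℕ),
      ((1 : ℕ) : ℝ) / (2 * q : ℕ)])
    (by
      intro i _
      fin_cases i <;> simp <;> fun_prop)
    (by
      have h : ((2 * q - 2 : ℕ) : ℝ) + 1 + 1 = (2 * q : ℕ) := by
        exact_mod_cast (by omega : 2 * q - 2 + 1 + 1 = 2 * q)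
      have h0 : ((2 * q : ℕ) : ℝ) ≠ 0 := by exact_mod_cast hq0
      simp only [Fin.sum_univ_three, Matrix.cons_val_zero, Matrix.cons_val_one, Matrix.cons_val]
      rw [← add_div, ← add_div, div_eq_one_iff_eq h0, ← h, Nat.cast_one])
    (by
      intro i _
      fin_cases i <;> exact div_nonneg (Nat.cast_nonneg _) (Nat.cast_nonneg _))
  have hint : ∀ {u : TorusProd n → ℂ}, Continuous u →
      ∫⁻ θ, ENNReal.ofReal (‖u θ‖ ^ (2 * q)) ∂(haarPiProd n) =
        ENNReal.ofReal (evenNorm q u ^ (2 * q)) := fun {u} hu => by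
    rw [← integral_norm_pow_eq_evenNorm hq hu,
      ofReal_integral_eq_lintegral_ofReal (Continuous.integrable_haarPiProd (by fun_prop))
        (.of_forall fun θ => by positivity)]
  simp only [Fin.prod_univ_three, Matrix.cons_val_zero, Matrix.cons_val_one, Matrix.cons_val,
    ofReal_pow_rpow_inv (norm_nonneg _) hq0, hint hu, hint hv, hint hw,
    ofReal_pow_rpow_inv (evenNorm_nonneg _ _) hq0, pow_one] at key
  have hN := evenNorm_nonneg q u
  have hN' := evenNorm_nonneg q v
  have hN'' := evenNorm_nonneg q w
  rw [← ENNReal.ofReal_le_ofReal_iff (by positivity),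
    ofReal_integral_eq_lintegral_ofReal (Continuous.integrable_haarPiProd (by fun_prop))
      (.of_forall fun θ => by positivity)]
  refine le_trans (le_of_eq ?_) (key.trans (le_of_eq ?_))
  · refine lintegral_congr fun θ => ?_
    rw [ENNReal.ofReal_mul (by positivity), ENNReal.ofReal_mul (by positivity)]
  · rw [ENNReal.ofReal_mul (by positivity), ENNReal.ofReal_mul (by positivity)]

/-- `v` is the derivative of `u` in the last variable. -/
def HasLastDeriv {n : ℕ} (u v : TorusProd n → ℂ) : Prop :=
  ∀ (θ : Fin n → AddCircle (1 : ℝ)) (x : ℝ),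
    HasDerivAt (fun y : ℝ => u (θ, (y : AddCircle (1 : ℝ)))) (v (θ, (x : AddCircle (1 : ℝ)))) x

lemma HasLastDeriv.add {n : ℕ} {u v u' v' : TorusProd n → ℂ} (h : HasLastDeriv u u')
    (h' : HasLastDeriv v v') : HasLastDeriv (u + v) (u' + v') :=
  fun θ x => (h θ x).add (h' θ x)

lemma HasLastDeriv.sum {n : ℕ} {ι : Type*} {s : Finset ι} {u v : ι → TorusProd n → ℂ}
    (h : ∀ i ∈ s, HasLastDeriv (u i) (v i)) : HasLastDeriv (∑ i ∈ s, u i) (∑ i ∈ s, v i) :=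
  fun θ x => by
    simpa [Finset.sum_apply] using HasDerivAt.fun_sum fun i hi => h i hi θ x

lemma HasLastDeriv.const_smul {n : ℕ} {u v : TorusProd n → ℂ} (h : HasLastDeriv u v) (c : ℂ) :
    HasLastDeriv (c • u) (c • v) :=
  fun θ x => (h θ x).const_smul c

lemma HasLastDeriv.mul {n : ℕ} {u v u' v' : TorusProd n → ℂ} (h : HasLastDeriv u u')
    (h' : HasLastDeriv v v') : HasLastDeriv (u * v) (u' * v + u * v') :=
  fun θ x => (h θ x).mul (h' θ x)

lemma HasLastDeriv.integral_eq_zero {n : ℕ} {u v : TorusProd n → ℂ} (h : HasLastDeriv u v)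
    (hv : Continuous v) : ∫ θ, v θ ∂(haarPiProd n) = 0 := by
  have hi := hv.integrable_haarPiProd
  unfold haarPiProd at hi ⊢
  rw [integral_prod _ hi]
  refine integral_eq_zero_of_ae (.of_forall fun θ => ?_)
  simp only [Pi.zero_apply]
  rw [AddCircle.integral_haarAddCircle, ← AddCircle.intervalIntegral_preimage 1 0,
    intervalIntegral.integral_eq_sub_of_hasDerivAt (fun x _ => h θ x)]
  · have h1 : ((1 : ℝ) : AddCircle (1 : ℝ)) = 0 := AddCircle.coe_period 1
    simp [h1]
  · refine Continuous.intervalIntegrable ?_ _ _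
    exact hv.comp (by fun_prop)

/-- Integration by parts against a function of the form `|H|^{2r} \bar H`. -/
lemma norm_integral_mul_le_of_hasLastDeriv {n r : ℕ} {H H' G f : TorusProd n → ℂ}
    (hH : Continuous H) (hH' : Continuous H') (hG : Continuous G) (hf : Continuous f)
    (dH : HasLastDeriv H H') (dG : HasLastDeriv G f) :
    ‖∫ θ, H θ ^ r * star (H θ) ^ (r + 1) * f θ ∂(haarPiProd n)‖ ≤
      (2 * r + 1) * ∫ θ, ‖H θ‖ ^ (2 * r) * ‖H' θ‖ * ‖G θ‖ ∂(haarPiProd n) := by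
  set W : TorusProd n → ℂ := fun θ => (r * H θ ^ (r - 1) * H' θ) * star (H θ) ^ (r + 1) +
    H θ ^ r * ((r + 1 : ℕ) * star (H θ) ^ r * star (H' θ)) with hW
  have dW : HasLastDeriv (fun θ => H θ ^ r * star (H θ) ^ (r + 1)) W := fun θ x => by
    have h1 := dH θ x
    have h2 : HasDerivAt (fun y : ℝ => star (H (θ, (y : AddCircle (1 : ℝ))))) _ x := h1.star
    exact (h1.pow r).mul (h2.pow (r + 1))
  have hWc : Continuous W := by fun_prop
  have hz := (dW.mul dG).integral_eq_zero (by fun_prop)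
  simp only [Pi.add_apply, Pi.mul_apply] at hz
  rw [integral_add (Continuous.integrable_haarPiProd (by fun_prop))
    (Continuous.integrable_haarPiProd (by fun_prop))] at hz
  rw [eq_neg_of_add_eq_zero_right hz, norm_neg, ← integral_const_mul]
  refine norm_integral_le_of_norm_le (Continuous.integrable_haarPiProd (by fun_prop))
    (.of_forall fun θ => ?_)
  rw [norm_mul, ← mul_assoc, ← mul_assoc]
  refine mul_le_mul_of_nonneg_right ?_ (norm_nonneg _)
  refine (norm_add_le _ _).trans (le_of_eq ?_)
  simp only [norm_mul, norm_pow, norm_star, Complex.norm_natCast]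
  rcases r with _ | r
  · simp
  · simp only [Nat.add_sub_cancel]
    push_cast
    ring

/-- The `L^{2q}` norm grows slowly when a function of higher frequency in the last variable is
added. -/
lemma evenNorm_add_sq_le {n q : ℕ} (hq : 1 ≤ q) {F F' f f' G : TorusProd n → ℂ}
    (hF : Continuous F) (hF' : Continuous F') (hf : Continuous f) (hf' : Continuous f')
    (hG : Continuous G) (dF : HasLastDeriv F F') (df : HasLastDeriv f f')
    (dG : HasLastDeriv G f) :
    evenNorm q (F + f) ^ 2 ≤ evenNorm q F ^ 2 +
      4 * q * ((evenNorm q F' + evenNorm q f') * evenNorm q G) := by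
  have hq' : (0 : ℝ) < q := by exact_mod_cast hq
  set K := (evenNorm q F' + evenNorm q f') * evenNorm q G with hK
  have hK0 : 0 ≤ K := mul_nonneg (add_nonneg (evenNorm_nonneg _ _) (evenNorm_nonneg _ _))
    (evenNorm_nonneg _ _)
  set H : ℝ → TorusProd n → ℂ := fun s => F + (s : ℂ) • f with hHdef
  set I : ℝ → ℝ := fun s => ∫ θ, ‖H s θ‖ ^ (2 * q) ∂(haarPiProd n) with hI
  have hHc : ∀ s, Continuous (H s) := fun s => by simp only [hHdef]; fun_prop
  have hI0 : ∀ s, 0 ≤ I s := fun s => integral_nonneg fun θ => by positivity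
  have hIe : ∀ s, I s = evenNorm q (H s) ^ (2 * q) := fun s =>
    integral_norm_pow_eq_evenNorm hq (hHc s)
  set D : ℝ → TorusProd n → ℝ := fun s θ =>
    2 * q * ((H s θ ^ (q - 1) * star (H s θ) ^ (q - 1 + 1) * f θ).re) with hD
  have hDI : ∀ s, HasDerivAt I (∫ θ, D s θ ∂(haarPiProd n)) s := by
    intro s
    refine (hasDerivAt_integral_of_dominated_loc_of_deriv_le
      (bound := fun θ => 2 * q * ((‖F θ‖ + (|s| + 1) * ‖f θ‖) ^ (2 * q - 1) * ‖f θ‖))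
      (Metric.ball_mem_nhds s one_pos)
      (.of_forall fun t => ?_) ?_ ?_ ?_ ?_ ?_).2
    · exact ((hHc t).norm.pow _).aestronglyMeasurable
    · exact ((hHc s).norm.pow _).integrable_haarPiProd
    · have := hHc s
      exact Continuous.aestronglyMeasurable (by simp only [hD]; fun_prop)
    · refine .of_forall fun θ t ht => ?_
      have ht' : |t| ≤ |s| + 1 := by
        have := abs_sub_abs_le_abs_sub t s
        rw [Metric.mem_ball, Real.dist_eq] at ht
        linarith
      have hb : ‖H t θ‖ ≤ ‖F θ‖ + (|s| + 1) * ‖f θ‖ := by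
        simp only [hHdef, Pi.add_apply, Pi.smul_apply, smul_eq_mul]
        refine (norm_add_le _ _).trans ?_
        rw [norm_mul, Complex.norm_real, Real.norm_eq_abs]
        gcongr
      simp only [hD]
      rw [Real.norm_eq_abs, abs_mul, abs_of_nonneg (by positivity : (0 : ℝ) ≤ 2 * q)]
      refine mul_le_mul_of_nonneg_left ((Complex.abs_re_le_norm _).trans ?_) (by positivity)
      rw [norm_mul, norm_mul, norm_pow, norm_pow, norm_star, ← pow_add,
        show q - 1 + (q - 1 + 1) = 2 * q - 1 by omega]
      gcongr
    · exact Continuous.integrable_haarPiProd (by fun_prop)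
    · refine .of_forall fun θ t _ => ?_
      have h1 : HasDerivAt (fun t : ℝ => H t θ) (f θ) t := by
        simp only [hHdef, Pi.add_apply, Pi.smul_apply, smul_eq_mul]
        simpa using ((Complex.ofRealCLM.hasDerivAt (x := t)).mul_const (f θ)).const_add (F θ)
      have h2 := h1.norm_sq.fun_pow q
      simp only [← pow_mul _ 2 q] at h2
      refine h2.congr_deriv ?_
      simp only [hD, Complex.inner]
      have : H t θ ^ (q - 1) * star (H t θ) ^ (q - 1 + 1) * f θ =
          (((‖H t θ‖ ^ 2) ^ (q - 1) : ℝ) : ℂ) * (f θ * star (H t θ)) := by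
        have : ((‖H t θ‖ ^ 2 : ℝ) : ℂ) = H t θ * star (H t θ) := by
          simpa using (Complex.mul_conj' (H t θ)).symm
        rw [Complex.ofReal_pow, this, mul_pow]
        ring
      rw [this, Complex.re_ofReal_mul]
      simp only [starRingEnd_apply]
      ring
  have hbound : ∀ s ∈ Set.Icc (0 : ℝ) 1, |∫ θ, D s θ ∂(haarPiProd n)| ≤
      2 * q * ((2 * q) * (evenNorm q (H s) ^ (2 * q - 2) * K)) := by
    intro s hs
    have hHs := hHc s
    have hre : ∫ θ, D s θ ∂(haarPiProd n) = 2 * q *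
        (∫ θ, H s θ ^ (q - 1) * star (H s θ) ^ (q - 1 + 1) * f θ ∂(haarPiProd n)).re := by
      simp only [hD]
      rw [integral_const_mul]
      congr 1
      have hi : Continuous fun θ => H s θ ^ (q - 1) * star (H s θ) ^ (q - 1 + 1) * f θ := by
        fun_prop
      exact integral_re (𝕜 := ℂ) hi.integrable_haarPiProd
    rw [hre, abs_mul, abs_of_nonneg (by positivity : (0 : ℝ) ≤ 2 * q)]
    refine mul_le_mul_of_nonneg_left ((Complex.abs_re_le_norm _).trans ?_) (by positivity)
    have hH' : Continuous (F' + (s : ℂ) • f') := by fun_prop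
    refine (norm_integral_mul_le_of_hasLastDeriv hHs hH' hG hf
      (dF.add (df.const_smul _)) dG).trans ?_
    refine mul_le_mul ?_ ?_ (integral_nonneg fun θ => by positivity) (by positivity)
    · rw [Nat.cast_sub hq]; push_cast; linarith
    · rw [show 2 * (q - 1) = 2 * q - 2 by omega]
      refine (integral_pow_mul_mul_le hq hHs hH' hG).trans ?_
      rw [mul_assoc]
      refine mul_le_mul_of_nonneg_left ?_ (pow_nonneg (evenNorm_nonneg _ _) _)
      refine mul_le_mul_of_nonneg_right ?_ (evenNorm_nonneg _ _)
      refine (evenNorm_add_le hq hF').trans ?_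
      rw [evenNorm_smul, Complex.norm_real, Real.norm_eq_abs, abs_of_nonneg hs.1]
      have := mul_le_mul_of_nonneg_right hs.2 (evenNorm_nonneg q f')
      linarith
  have hsq : ∀ u : TorusProd n → ℂ, (evenNorm q u ^ (2 * q)) ^ (1 / (q : ℝ)) = evenNorm q u ^ 2 := by
    intro u
    rw [pow_mul, one_div, Real.pow_rpow_inv_natCast (by positivity) (by omega)]
  refine le_of_forall_pos_le_add fun δ hδ => ?_
  set ε := δ ^ q with hε
  have hε0 : 0 < ε := by positivity
  have hψ : ∀ s, HasDerivAt (fun s => (I s + ε) ^ (1 / (q : ℝ)))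
      ((∫ θ, D s θ ∂(haarPiProd n)) * (1 / (q : ℝ)) * (I s + ε) ^ (1 / (q : ℝ) - 1)) s :=
    fun s => ((hDI s).add_const ε).rpow_const (Or.inl (by linarith [hI0 s]))
  have hmain := norm_image_sub_le_of_norm_deriv_le_segment_01'
    (fun s _ => (hψ s).hasDerivWithinAt) (C := 4 * q * K) (by
      intro s hs
      have hpos : 0 < I s + ε := by linarith [hI0 s]
      rw [Real.norm_eq_abs, abs_mul, abs_mul, abs_of_nonneg (by positivity : (0 : ℝ) ≤ 1 / q),
        abs_of_nonneg (Real.rpow_nonneg hpos.le _)]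
      have h1 := hbound s ⟨hs.1, hs.2.le⟩
      have h2 : evenNorm q (H s) ^ (2 * q - 2) ≤ (I s + ε) ^ (1 - 1 / (q : ℝ)) := by
        have : evenNorm q (H s) ^ (2 * q - 2) = I s ^ (1 - 1 / (q : ℝ)) := by
          rw [hIe, ← Real.rpow_natCast, ← Real.rpow_natCast,
            ← Real.rpow_mul (evenNorm_nonneg _ _)]
          congr 1
          rw [Nat.cast_sub (by omega)]
          push_cast
          field_simp
        rw [this]
        refine Real.rpow_le_rpow (hI0 s) (by linarith) ?_
        rw [sub_nonneg, div_le_one hq']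
        exact_mod_cast hq
      calc _ ≤ 2 * q * ((2 * q) * ((I s + ε) ^ (1 - 1 / (q : ℝ)) * K)) * (1 / q) *
            (I s + ε) ^ (1 / (q : ℝ) - 1) := by
            gcongr
            exact h1.trans (by gcongr)
        _ = 4 * q * K * ((I s + ε) ^ (1 - 1 / (q : ℝ)) * (I s + ε) ^ (1 / (q : ℝ) - 1)) := by
            field_simp
            ring
        _ = 4 * q * K := by
            rw [← Real.rpow_add hpos]
            simp)
  have h1 : evenNorm q (F + f) ^ 2 ≤ (I 1 + ε) ^ (1 / (q : ℝ)) := by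
    have : F + f = H 1 := by simp [hHdef]
    rw [this, ← hsq, ← hIe]
    exact Real.rpow_le_rpow (hI0 1) (by linarith) (by positivity)
  have h0 : (I 0 + ε) ^ (1 / (q : ℝ)) ≤ evenNorm q F ^ 2 + δ := by
    have : F = H 0 := by simp [hHdef]
    refine (Real.rpow_add_le_add_rpow (hI0 0) hε0.le (by positivity) ?_).trans (le_of_eq ?_)
    · rw [div_le_one hq']
      exact_mod_cast hq
    · rw [hIe, hsq, ← this, hε, one_div, Real.pow_rpow_inv_natCast hδ.le (by omega)]
  have h2 := (le_abs_self _).trans hmain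
  linarith

/-- The character of `𝕋^{n+1}` with frequency `q = (m, l)`. -/
noncomputable def prodChar {n : ℕ} (q : (Fin n → ℤ) × ℤ) (θ : TorusProd n) : ℂ :=
  (∏ j, fourier (q.1 j) (θ.1 j)) * fourier q.2 θ.2

/-- The trigonometric polynomial on `𝕋^{n+1}` with coefficients `c` on the finite set `S`. -/
noncomputable def trigPoly {n : ℕ} (S : Finset ((Fin n → ℤ) × ℤ)) (c : (Fin n → ℤ) × ℤ → ℂ) :
    TorusProd n → ℂ :=
  ∑ q ∈ S, c q • prodChar q

lemma norm_fourier_apply_eq_one (l : ℤ) (x : AddCircle (1 : ℝ)) : ‖fourier l x‖ = 1 := by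
  rw [fourier_apply]
  exact Circle.norm_coe _

@[fun_prop]
lemma continuous_prodChar {n : ℕ} (q : (Fin n → ℤ) × ℤ) : Continuous (prodChar q) := by
  unfold prodChar
  fun_prop

lemma trigPoly_apply {n : ℕ} (S : Finset ((Fin n → ℤ) × ℤ)) (c : (Fin n → ℤ) × ℤ → ℂ)
    (θ : TorusProd n) : trigPoly S c θ = ∑ q ∈ S, c q * prodChar q θ := by
  simp [trigPoly, Finset.sum_apply]

@[fun_prop]
lemma continuous_trigPoly {n : ℕ} (S : Finset ((Fin n → ℤ) × ℤ)) (c : (Fin n → ℤ) × ℤ → ℂ) :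
    Continuous (trigPoly S c) := by
  simp only [funext (trigPoly_apply S c)]
  fun_prop

lemma hasLastDeriv_prodChar {n : ℕ} (q : (Fin n → ℤ) × ℤ) :
    HasLastDeriv (prodChar q) ((2 * Real.pi * Complex.I * q.2 : ℂ) • prodChar q) := fun θ x => by
  have h := (hasDerivAt_fourier 1 q.2 x).const_mul (∏ j, fourier (q.1 j) (θ j))
  refine h.congr_deriv ?_
  simp only [Pi.smul_apply, smul_eq_mul, prodChar, Complex.ofReal_one, div_one]
  ring

lemma hasLastDeriv_trigPoly {n : ℕ} (S : Finset ((Fin n → ℤ) × ℤ)) (c : (Fin n → ℤ) × ℤ → ℂ) :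
    HasLastDeriv (trigPoly S c) (trigPoly S fun q => 2 * Real.pi * Complex.I * q.2 * c q) := by
  unfold trigPoly
  refine HasLastDeriv.sum fun q _ => ?_
  have h := (hasLastDeriv_prodChar q).const_smul (c q)
  rwa [smul_smul, mul_comm] at h

lemma prodChar_add_snd {n : ℕ} (m : Fin n → ℤ) (l a : ℤ) (θ : TorusProd n) :
    prodChar (m, l + a) θ = fourier a θ.2 * prodChar (m, l) θ := by
  simp only [prodChar, fourier_add]
  ring

/-- `Λ` satisfies the `L^{2q}` bounds `‖g‖_{2q}² ≤ C q^N ∑ |c|²` for all `q ≥ 2`. -/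
def HasEvenBound {n : ℕ} (Λ : Set ((Fin n → ℤ) × ℤ)) (C : ℝ) (N : ℕ) : Prop :=
  ∀ q : ℕ, 2 ≤ q → ∀ (S : Finset ((Fin n → ℤ) × ℤ)) (c : (Fin n → ℤ) × ℤ → ℂ), ↑S ⊆ Λ →
    evenNorm q (trigPoly S c) ^ 2 ≤ C * q ^ N * ∑ x ∈ S, ‖c x‖ ^ 2

lemma HasEvenBound.of_translate {n : ℕ} {Λ Λ' : Set ((Fin n → ℤ) × ℤ)} {C : ℝ} {N : ℕ}
    (h : HasEvenBound Λ C N) (a : ℤ) (ha : ∀ x ∈ Λ', (x.1, x.2 - a) ∈ Λ) :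
    HasEvenBound Λ' C N := by
  classical
  intro q hq S c hS
  set φ : (Fin n → ℤ) × ℤ ↪ (Fin n → ℤ) × ℤ := ⟨fun x => (x.1, x.2 - a), fun x y hxy => by
    simp only [Prod.mk.injEq, sub_left_inj] at hxy
    exact Prod.ext hxy.1 hxy.2⟩
  have hφ : ∀ x, φ x = (x.1, x.2 - a) := fun _ => rfl
  have := h q hq (S.map φ) (fun x => c (x.1, x.2 + a)) (by
    intro x hx
    simp only [Finset.coe_map, Set.mem_image, Finset.mem_coe] at hx
    obtain ⟨y, hy, rfl⟩ := hx
    exact ha y (hS hy))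
  have hsum : ∑ x ∈ S.map φ, ‖c (x.1, x.2 + a)‖ ^ 2 = ∑ x ∈ S, ‖c x‖ ^ 2 := by
    rw [Finset.sum_map]
    simp [hφ]
  rw [hsum] at this
  refine le_trans (le_of_eq ?_) this
  congr 1
  refine evenNorm_congr_norm (by omega) (by fun_prop) (by fun_prop) fun θ => ?_
  have : trigPoly S c θ = fourier a θ.2 *
      trigPoly (S.map φ) (fun x => c (x.1, x.2 + a)) θ := by
    rw [trigPoly_apply, trigPoly_apply, Finset.sum_map, Finset.mul_sum]
    refine Finset.sum_congr rfl fun x _ => ?_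
    have := prodChar_add_snd x.1 (x.2 - a) a θ
    rw [sub_add_cancel] at this
    simp only [hφ, sub_add_cancel, Prod.mk.eta] at this ⊢
    rw [this]
    ring
  rw [this, norm_mul, norm_fourier_apply_eq_one, one_mul]

lemma HasEvenBound.union {n : ℕ} {Λ Λ' : Set ((Fin n → ℤ) × ℤ)} {C : ℝ} {N : ℕ}
    (h : HasEvenBound Λ C N) (h' : HasEvenBound Λ' C N) :
    HasEvenBound (Λ ∪ Λ') (2 * C) N := by
  classical
  intro q hq S c hS
  have h1 := h q hq (S.filter (· ∈ Λ)) c (by intro x hx; simp at hx; exact hx.2)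
  have h2 := h' q hq (S.filter (· ∉ Λ)) c (by
    intro x hx
    simp at hx
    exact (hS hx.1).resolve_left hx.2)
  have hsplit : trigPoly S c = trigPoly (S.filter (· ∈ Λ)) c + trigPoly (S.filter (· ∉ Λ)) c :=
    (Finset.sum_filter_add_sum_filter_not S _ _).symm
  have htri := evenNorm_add_le (q := q) (by omega)
    (v := trigPoly (S.filter (· ∉ Λ)) c) (continuous_trigPoly (S.filter (· ∈ Λ)) c)
  rw [← hsplit] at htri
  have hsum := Finset.sum_filter_add_sum_filter_not S (· ∈ Λ) (fun x => ‖c x‖ ^ 2)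
  rw [← hsum]
  have h3 := pow_le_pow_left₀ (evenNorm_nonneg _ _) htri 2
  nlinarith [sq_nonneg (evenNorm q (trigPoly (S.filter (· ∈ Λ)) c) -
    evenNorm q (trigPoly (S.filter (· ∉ Λ)) c))]

lemma abs_signed_lacunary_sum_le {lam : ℕ → ℕ} (hmono : StrictMono lam)
    (hlac : ∀ m, 2 * lam m ≤ lam (m + 1)) (k : ℕ) :
    ∀ (idx : Fin k → ℕ) (ε : Fin k → ℤ), StrictAnti idx → (∀ i, ε i = 1 ∨ ε i = -1) →
      ∀ m, (∀ i, idx i < m) →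
        |((∑ i, ε i * (lam (idx i) : ℤ) : ℤ) : ℝ)| ≤ (1 - (1 / 2) ^ k) * lam m := by
  induction k with
  | zero => simp
  | succ k ih =>
    intro idx ε hidx hε m hm
    have h := ih (fun i => idx i.succ) (fun i => ε i.succ)
      (fun i j hij => hidx (Fin.succ_lt_succ_iff.mpr hij)) (fun i => hε _) (idx 0)
      (fun i => hidx (Fin.succ_pos i))
    have h2 : (2 : ℝ) * lam (idx 0) ≤ lam m := by
      exact_mod_cast (hlac (idx 0)).trans (hmono.monotone (hm 0))
    rw [Fin.sum_univ_succ]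
    push_cast at h ⊢
    have h1 : |(ε 0 : ℝ) * lam (idx 0)| = lam (idx 0) := by
      rcases hε 0 with h0 | h0 <;> simp [h0]
    refine (abs_add_le _ _).trans ?_
    rw [h1]
    refine (add_le_add_right h _).trans ?_
    have h3 : (0 : ℝ) ≤ 1 - (1 / 2) ^ (k + 1) :=
      sub_nonneg.mpr (pow_le_one₀ (by norm_num) (by norm_num))
    have := mul_le_mul_of_nonneg_left h2 h3
    rw [pow_succ] at this ⊢
    linarith

lemma exists_top_of_mem_lacunarySumset {lam : ℕ → ℕ} (hmono : StrictMono lam)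
    (hlac : ∀ m, 2 * lam m ≤ lam (m + 1)) {k : ℕ} {x : ℤ}
    (hx : x ∈ lacunarySumset lam (k + 1)) :
    ∃ m, (x - lam m ∈ lacunarySumset lam k ∨ x - -lam m ∈ lacunarySumset lam k) ∧
      (1 / 2) ^ k * (lam m : ℝ) ≤ |(x : ℝ)| ∧ |(x : ℝ)| ≤ 2 * lam m := by
  obtain ⟨idx, ε, hidx, hε, rfl⟩ := hx
  have hidx' : StrictAnti fun i : Fin k => idx i.succ :=
    fun i j hij => hidx (Fin.succ_lt_succ_iff.mpr hij)
  have h := abs_signed_lacunary_sum_le hmono hlac k (fun i => idx i.succ) (fun i => ε i.succ)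
    hidx' (fun i => hε _) (idx 0) (fun i => hidx (Fin.succ_pos i))
  set y : ℤ := ∑ i : Fin k, ε i.succ * (lam (idx i.succ) : ℤ) with hy
  have hyk : y ∈ lacunarySumset lam k := ⟨_, _, hidx', fun i => hε _, hy⟩
  have hlam : (0 : ℝ) ≤ lam (idx 0) := Nat.cast_nonneg _
  have hp : (0 : ℝ) ≤ (1 / 2) ^ k * lam (idx 0) := by positivity
  have h' := abs_le.mp h
  rw [Fin.sum_univ_succ, ← hy]
  refine ⟨idx 0, ?_, ?_, ?_⟩
  · rcases hε 0 with h0 | h0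
    · left; rw [h0]; convert hyk using 1; ring
    · right; rw [h0]; convert hyk using 1; ring
  · rw [le_abs]
    push_cast
    rcases hε 0 with h0 | h0
    · left; rw [h0]; push_cast; linarith
    · right; rw [h0]; push_cast; linarith
  · rw [abs_le]
    push_cast
    rcases hε 0 with h0 | h0 <;> rw [h0] <;> push_cast <;> constructor <;> linarith

lemma sum_lacunary_average_mul_le {lam : ℕ → ℕ} (hpos : ∀ m, 0 < lam m)
    (hlac : ∀ m, 2 * lam m ≤ lam (m + 1)) {a : ℕ → ℝ} (ha : ∀ j, 0 ≤ a j) (M : ℕ) :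
    ∑ j ∈ Finset.range M, (∑ i ∈ Finset.range (j + 1), lam i * a i) / lam j * a j ≤
      3 * ∑ j ∈ Finset.range M, a j ^ 2 := by
  have hl : ∀ m, (0 : ℝ) < lam m := fun m => by exact_mod_cast hpos m
  set T : ℕ → ℝ := fun j => (∑ i ∈ Finset.range (j + 1), lam i * a i) / lam j with hT
  have hT0 : ∀ j, 0 ≤ T j := fun j =>
    div_nonneg (Finset.sum_nonneg fun i _ => mul_nonneg (hl i).le (ha i)) (hl j).le
  have key : ∑ j ∈ Finset.range M, T j ^ 2 +
      4 * ((∑ i ∈ Finset.range M, lam i * a i) / lam M) ^ 2 ≤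
      4 * ∑ j ∈ Finset.range M, a j ^ 2 := by
    induction M with
    | zero => simp
    | succ M ih =>
      set V := (∑ i ∈ Finset.range M, lam i * a i) / lam M with hV
      have h1 : T M = V + a M := by
        simp only [hT, hV, Finset.sum_range_succ, add_div]
        rw [mul_div_cancel_left₀ _ (hl M).ne']
      have h2 : (∑ i ∈ Finset.range (M + 1), lam i * a i) / lam (M + 1) ≤ T M / 2 := by
        simp only [hT]
        rw [div_div]
        refine div_le_div_of_nonneg_left
          (Finset.sum_nonneg fun i _ => mul_nonneg (hl i).le (ha i))
          (mul_pos (hl M) two_pos) ?_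
        have : (2 : ℝ) * lam M ≤ lam (M + 1) := by exact_mod_cast hlac M
        linarith
      have h3 : 0 ≤ (∑ i ∈ Finset.range (M + 1), lam i * a i) / lam (M + 1) :=
        div_nonneg (Finset.sum_nonneg fun i _ => mul_nonneg (hl i).le (ha i)) (hl _).le
      have h4 := pow_le_pow_left₀ h3 h2 2
      rw [Finset.sum_range_succ (fun j => T j ^ 2), Finset.sum_range_succ (fun j => a j ^ 2)]
      nlinarith [sq_nonneg (V - a M)]
  have h : ∑ j ∈ Finset.range M, T j * a j ≤
      ∑ j ∈ Finset.range M, (T j ^ 2 / 2 + a j ^ 2 / 2) :=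
    Finset.sum_le_sum fun j _ => by nlinarith [sq_nonneg (T j - a j)]
  rw [Finset.sum_add_distrib, ← Finset.sum_div, ← Finset.sum_div] at h
  have h5 : 0 ≤ ∑ j ∈ Finset.range M, a j ^ 2 := Finset.sum_nonneg fun _ _ => sq_nonneg _
  have h6 := sq_nonneg ((∑ i ∈ Finset.range M, lam i * a i) / (lam M : ℝ))
  change ∑ j ∈ Finset.range M, T j * a j ≤ _
  linarith

lemma trigPoly_congr {n : ℕ} {S : Finset ((Fin n → ℤ) × ℤ)} {c d : (Fin n → ℤ) × ℤ → ℂ}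
    (h : ∀ x ∈ S, c x = d x) : trigPoly S c = trigPoly S d :=
  Finset.sum_congr rfl fun x hx => by rw [h x hx]

lemma HasEvenBound.evenNorm_trigPoly_le {n : ℕ} {Λ : Set ((Fin n → ℤ) × ℤ)} {C : ℝ} {N : ℕ}
    (h : HasEvenBound Λ C N) {q : ℕ} (hq : 2 ≤ q) {S : Finset ((Fin n → ℤ) × ℤ)}
    (hS : ↑S ⊆ Λ) {c d : (Fin n → ℤ) × ℤ → ℂ} {K : ℝ} (hC : 0 ≤ C) (hK : 0 ≤ K)
    (hd : ∀ x ∈ S, ‖d x‖ ≤ K * ‖c x‖) :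
    evenNorm q (trigPoly S d) ≤ K * (√(C * q ^ N) * √(∑ x ∈ S, ‖c x‖ ^ 2)) := by
  refine le_of_sq_le_sq ?_ (by positivity)
  refine (h q hq S d hS).trans ?_
  rw [mul_pow, mul_pow, Real.sq_sqrt (by positivity),
    Real.sq_sqrt (Finset.sum_nonneg fun _ _ => by positivity)]
  have : ∑ x ∈ S, ‖d x‖ ^ 2 ≤ K ^ 2 * ∑ x ∈ S, ‖c x‖ ^ 2 := by
    rw [Finset.mul_sum]
    refine Finset.sum_le_sum fun x hx => ?_
    rw [← mul_pow]
    exact pow_le_pow_left₀ (norm_nonneg _) (hd x hx) 2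
  calc C * q ^ N * ∑ x ∈ S, ‖d x‖ ^ 2 ≤ C * q ^ N * (K ^ 2 * ∑ x ∈ S, ‖c x‖ ^ 2) := by gcongr
    _ = _ := by ring

lemma norm_two_pi_I_mul (l : ℤ) : ‖(2 * Real.pi * Complex.I * l : ℂ)‖ = 2 * Real.pi * |(l : ℝ)| := by
  simp [abs_of_pos Real.pi_pos]

/-- The `L^{2q}` bounds pass from `E × Λ^{(k)}` to `E × Λ^{(k+1)}`. -/
lemma HasEvenBound.prod_lacunarySumset_succ {n : ℕ} {E : Set (Fin n → ℤ)} {lam : ℕ → ℕ}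
    (hpos : ∀ m, 0 < lam m) (hmono : StrictMono lam) (hlac : ∀ m, 2 * lam m ≤ lam (m + 1))
    {k : ℕ} {C : ℝ} (hC : 0 ≤ C) {N : ℕ}
    (h : HasEvenBound {x : (Fin n → ℤ) × ℤ | x.1 ∈ E ∧ x.2 ∈ lacunarySumset lam k} C N) :
    HasEvenBound {x : (Fin n → ℤ) × ℤ | x.1 ∈ E ∧ x.2 ∈ lacunarySumset lam (k + 1)}
      (48 * 2 ^ k * C) (N + 1) := by
  classical
  intro q hq S c hS
  have hl : ∀ m, (0 : ℝ) < lam m := fun m => by exact_mod_cast hpos m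
  have hex : ∀ x : (Fin n → ℤ) × ℤ, ∃ m, x.2 ∈ lacunarySumset lam (k + 1) →
      (x.2 - lam m ∈ lacunarySumset lam k ∨ x.2 - -lam m ∈ lacunarySumset lam k) ∧
      (1 / 2) ^ k * (lam m : ℝ) ≤ |(x.2 : ℝ)| ∧ |(x.2 : ℝ)| ≤ 2 * lam m := fun x => by
    by_cases hx : x.2 ∈ lacunarySumset lam (k + 1)
    · obtain ⟨m, hm⟩ := exists_top_of_mem_lacunarySumset hmono hlac hx
      exact ⟨m, fun _ => hm⟩
    · exact ⟨0, fun h => absurd h hx⟩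
  choose top htop using hex
  set block : ℕ → Finset ((Fin n → ℤ) × ℤ) := fun j => S.filter (top · = j) with hblock
  have hmem : ∀ {j x}, x ∈ block j →
      x.1 ∈ E ∧ (x.2 - lam j ∈ lacunarySumset lam k ∨ x.2 - -lam j ∈ lacunarySumset lam k) ∧
      (1 / 2) ^ k * (lam j : ℝ) ≤ |(x.2 : ℝ)| ∧ |(x.2 : ℝ)| ≤ 2 * lam j := fun {j x} hx => by
    rw [hblock, Finset.mem_filter] at hx
    obtain ⟨hxS, rfl⟩ := hx
    exact ⟨(hS hxS).1, htop x (hS hxS).2⟩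
  have hlow : ∀ {j x}, x ∈ block j → 0 < |(x.2 : ℝ)| := fun {j x} hx =>
    lt_of_lt_of_le (mul_pos (by positivity) (hl j)) (hmem hx).2.2.1
  have hbd : ∀ j, HasEvenBound
      ({x : (Fin n → ℤ) × ℤ | x.1 ∈ E ∧ x.2 - lam j ∈ lacunarySumset lam k} ∪
        {x : (Fin n → ℤ) × ℤ | x.1 ∈ E ∧ x.2 - -lam j ∈ lacunarySumset lam k}) (2 * C) N :=
    fun j => (h.of_translate (lam j) fun x hx => hx).union (h.of_translate (-lam j) fun x hx => hx)
  have hsub : ∀ j, (block j : Set ((Fin n → ℤ) × ℤ)) ⊆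
      ({x : (Fin n → ℤ) × ℤ | x.1 ∈ E ∧ x.2 - lam j ∈ lacunarySumset lam k} ∪
        {x : (Fin n → ℤ) × ℤ | x.1 ∈ E ∧ x.2 - -lam j ∈ lacunarySumset lam k}) := fun j x hx =>
    (hmem hx).2.1.imp (fun h => ⟨(hmem hx).1, h⟩) (fun h => ⟨(hmem hx).1, h⟩)
  set a : ℕ → ℝ := fun j => √(∑ x ∈ block j, ‖c x‖ ^ 2) with ha
  have ha0 : ∀ j, 0 ≤ a j := fun j => Real.sqrt_nonneg _
  set d := √(2 * C * q ^ N) with hd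
  have hd0 : 0 ≤ d := Real.sqrt_nonneg _
  have hd2 : d ^ 2 = 2 * C * q ^ N := Real.sq_sqrt (by positivity)
  set f : ℕ → TorusProd n → ℂ := fun j => trigPoly (block j) c with hf
  set f' : ℕ → TorusProd n → ℂ := fun j =>
    trigPoly (block j) (fun x => 2 * Real.pi * Complex.I * x.2 * c x) with hf'
  set G : ℕ → TorusProd n → ℂ := fun j =>
    trigPoly (block j) (fun x => (2 * Real.pi * Complex.I * x.2)⁻¹ * c x) with hG
  have hfc : ∀ j, Continuous (f j) := fun j => continuous_trigPoly _ _
  have hfc' : ∀ j, Continuous (f' j) := fun j => continuous_trigPoly _ _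
  have hGc : ∀ j, Continuous (G j) := fun j => continuous_trigPoly _ _
  have df : ∀ j, HasLastDeriv (f j) (f' j) := fun j => hasLastDeriv_trigPoly _ _
  have dG : ∀ j, HasLastDeriv (G j) (f j) := fun j => by
    have hd := hasLastDeriv_trigPoly (block j) (fun x => (2 * Real.pi * Complex.I * x.2)⁻¹ * c x)
    refine (congrArg (HasLastDeriv (G j)) (trigPoly_congr fun x hx => ?_)).mp hd
    refine mul_inv_cancel_left₀ ?_ _
    rw [← norm_pos_iff, norm_two_pi_I_mul]
    have := hlow hx
    positivity
  have nf' : ∀ j, evenNorm q (f' j) ≤ 4 * Real.pi * d * (lam j * a j) := fun j => by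
    have := (hbd j).evenNorm_trigPoly_le hq (hsub j) (c := c) (K := 4 * Real.pi * lam j)
      (d := fun x => 2 * Real.pi * Complex.I * x.2 * c x) (by positivity) (by positivity)
      (fun x hx => by
        rw [norm_mul, norm_two_pi_I_mul]
        have h1 := (hmem hx).2.2.2
        have h2 := Real.pi_pos
        refine mul_le_mul_of_nonneg_right ?_ (norm_nonneg _)
        nlinarith)
    refine this.trans (le_of_eq ?_)
    simp only [ha, hd]
    ring
  have nG : ∀ j, evenNorm q (G j) ≤ 2 ^ k / (2 * Real.pi * lam j) * d * a j := fun j => by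
    have hlj := hl j
    have := (hbd j).evenNorm_trigPoly_le hq (hsub j) (c := c) (K := 2 ^ k / (2 * Real.pi * lam j))
      (d := fun x => (2 * Real.pi * Complex.I * x.2)⁻¹ * c x) (by positivity) (by positivity)
      (fun x hx => by
        rw [norm_mul, norm_inv, norm_two_pi_I_mul]
        have h1 := (hmem hx).2.2.1
        have h2 := hlow hx
        refine mul_le_mul_of_nonneg_right ?_ (norm_nonneg _)
        rw [inv_eq_one_div, div_le_div_iff₀ (by positivity) (by positivity)]
        rw [one_div, inv_pow, inv_mul_le_iff₀ (by positivity)] at h1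
        nlinarith [mul_le_mul_of_nonneg_left h1 Real.pi_pos.le])
    refine this.trans (le_of_eq ?_)
    simp only [ha, hd]
    ring
  have key : ∀ M, evenNorm q (∑ j ∈ Finset.range M, f j) ^ 2 ≤ 8 * q * 2 ^ k * d ^ 2 *
      ∑ j ∈ Finset.range M, (∑ i ∈ Finset.range (j + 1), lam i * a i) / lam j * a j := by
    intro M
    induction M with
    | zero => simp [evenNorm]
    | succ M ih =>
      have hstep := evenNorm_add_sq_le (q := q) (by omega)
        (F := ∑ j ∈ Finset.range M, f j) (F' := ∑ j ∈ Finset.range M, f' j)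
        (f := f M) (f' := f' M) (G := G M)
        (by simp only [Finset.sum_fn]; fun_prop)
        (by simp only [Finset.sum_fn]; fun_prop) (hfc M) (hfc' M) (hGc M)
        (HasLastDeriv.sum fun j _ => df j) (df M) (dG M)
      rw [Finset.sum_range_succ f, Finset.sum_range_succ (fun j => (∑ i ∈ _, _) / _ * _), mul_add]
      refine hstep.trans (add_le_add ih ?_)
      have h1 : evenNorm q (∑ j ∈ Finset.range M, f' j) + evenNorm q (f' M) ≤
          4 * Real.pi * d * ∑ i ∈ Finset.range (M + 1), lam i * a i := by
        rw [Finset.sum_range_succ, mul_add, Finset.mul_sum]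
        exact add_le_add ((evenNorm_sum_le (by omega) fun j _ => hfc' j).trans
          (Finset.sum_le_sum fun j _ => nf' j)) (nf' M)
      have h2 := mul_le_mul h1 (nG M) (evenNorm_nonneg _ _)
        ((add_nonneg (evenNorm_nonneg _ _) (evenNorm_nonneg _ _)).trans h1)
      refine (mul_le_mul_of_nonneg_left h2 (by positivity)).trans (le_of_eq ?_)
      have := (hl M).ne'
      have := Real.pi_pos.ne'
      field_simp
      ring
  set M := S.sup top + 1 with hM
  have hmaps : ∀ x ∈ S, top x ∈ Finset.range M := fun x hx =>
    Finset.mem_range.mpr (Nat.lt_succ_of_le (Finset.le_sup hx))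
  have hfS : ∑ j ∈ Finset.range M, f j = trigPoly S c :=
    Finset.sum_fiberwise_of_maps_to hmaps fun x => c x • prodChar x
  have haS : ∑ j ∈ Finset.range M, a j ^ 2 = ∑ x ∈ S, ‖c x‖ ^ 2 := by
    rw [← Finset.sum_fiberwise_of_maps_to hmaps]
    exact Finset.sum_congr rfl fun j _ => Real.sq_sqrt (Finset.sum_nonneg fun _ _ => by positivity)
  have hkey := key M
  rw [hfS] at hkey
  refine hkey.trans ((mul_le_mul_of_nonneg_left (sum_lacunary_average_mul_le hpos hlac ha0 M)
    (by positivity)).trans (le_of_eq ?_))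
  rw [haS, hd2]
  ring

lemma integral_fourier_eq_ite (l : ℤ) :
    ∫ x : AddCircle (1 : ℝ), fourier l x ∂AddCircle.haarAddCircle = if l = 0 then 1 else 0 := by
  split_ifs with h
  · simp [h]
  · exact integral_eq_zero_of_add_right_eq_neg (fourier_add_half_inv_index h one_pos)

lemma integral_prod_fourier_mul_conj {n : ℕ} (m m' : Fin n → ℤ) :
    ∫ θ, (∏ j, fourier (m j) (θ j)) * (starRingEnd ℂ) (∏ j, fourier (m' j) (θ j)) ∂(haarPi n) =
      if m = m' then 1 else 0 := by
  simp only [map_prod, ← Finset.prod_mul_distrib, ← fourier_neg, ← fourier_add]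
  rw [haarPi, integral_fintype_prod_eq_prod (fun j (x : AddCircle (1 : ℝ)) =>
    (fourier (m j + -m' j) x : ℂ))]
  simp only [integral_fourier_eq_ite]
  split_ifs with h
  · simp [h]
  · obtain ⟨i, hi⟩ := Function.ne_iff.mp h
    refine Finset.prod_eq_zero (Finset.mem_univ i) (if_neg ?_)
    rwa [← sub_eq_add_neg, sub_eq_zero]

lemma integral_norm_sq_sum_prod_fourier {n : ℕ} (F : Finset (Fin n → ℤ)) (c : (Fin n → ℤ) → ℂ) :
    ∫ θ, ‖∑ m ∈ F, c m * ∏ j, fourier (m j) (θ j)‖ ^ 2 ∂(haarPi n) = ∑ m ∈ F, ‖c m‖ ^ 2 := by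
  have hint : ∀ {u : (Fin n → AddCircle (1 : ℝ)) → ℂ}, Continuous u →
      Integrable u (haarPi n) := fun hu =>
    hu.integrable_of_hasCompactSupport (HasCompactSupport.of_compactSpace _)
  rw [← Complex.ofReal_inj, ← integral_complex_ofReal]
  push_cast
  simp only [← Complex.mul_conj', map_sum, Finset.sum_mul_sum]
  rw [integral_finsetSum _ fun i _ => hint (by fun_prop)]
  refine Finset.sum_congr rfl fun m hm => ?_
  rw [integral_finsetSum _ fun i _ => hint (by fun_prop)]
  have : ∀ m', ∫ θ, c m * (∏ j, (fourier (m j) (θ j) : ℂ)) *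
      (starRingEnd ℂ) (c m' * ∏ j, fourier (m' j) (θ j)) ∂(haarPi n) =
      c m * (starRingEnd ℂ) (c m') * if m = m' then 1 else 0 := fun m' => by
    rw [← integral_prod_fourier_mul_conj, ← integral_const_mul]
    congr 1
    ext θ
    rw [map_mul]
    ring
  simp only [this, mul_ite, mul_one, mul_zero, Finset.sum_ite_eq, hm, if_true]

lemma lpNorm_two_sum_prod_fourier {n : ℕ} (F : Finset (Fin n → ℤ)) (c : (Fin n → ℤ) → ℂ) :
    lpNorm (fun θ => ∑ m ∈ F, c m * ∏ j, fourier (m j) (θ j)) 2 (haarPi n) =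
      √(∑ m ∈ F, ‖c m‖ ^ 2) := by
  rw [lpNorm_eq_integral_norm_rpow_toReal two_ne_zero ENNReal.ofNat_ne_top
    (Continuous.aestronglyMeasurable (by fun_prop)), ← integral_norm_sq_sum_prod_fourier,
    Real.sqrt_eq_rpow]
  simp

lemma lacunarySumset_zero (lam : ℕ → ℕ) {x : ℤ} (hx : x ∈ lacunarySumset lam 0) : x = 0 := by
  obtain ⟨_, _, _, _, rfl⟩ := hx
  simp

lemma hasEvenBound_prod_lacunarySumset_zero {n : ℕ} {E : Set (Fin n → ℤ)} {CE : ℝ} (hCE : 0 < CE)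
    {NE : ℕ}
    (hE : ∀ g : (Fin n → AddCircle (1 : ℝ)) → ℂ,
      (∃ (F : Finset (Fin n → ℤ)) (c : (Fin n → ℤ) → ℂ), ↑F ⊆ E ∧
        g = fun θ => ∑ m ∈ F, c m * ∏ j, fourier (m j) (θ j)) →
      ∀ p : ℝ, 2 < p →
        eLpNorm g (ENNReal.ofReal p) (haarPi n) ≤
          ENNReal.ofReal (CE * p ^ ((NE : ℝ) / 2)) * eLpNorm g 2 (haarPi n))
    (lam : ℕ → ℕ) :
    HasEvenBound {x : (Fin n → ℤ) × ℤ | x.1 ∈ E ∧ x.2 ∈ lacunarySumset lam 0}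
      (CE ^ 2 * 2 ^ NE) NE := by
  classical
  intro q hq S c hS
  have h0 : ∀ x ∈ S, x.2 = 0 := fun x hx => lacunarySumset_zero lam (hS hx).2
  have hinj : Set.InjOn Prod.fst (S : Set ((Fin n → ℤ) × ℤ)) := fun x hx y hy hxy =>
    Prod.ext hxy ((h0 x hx).trans (h0 y hy).symm)
  set F := S.image Prod.fst with hF
  set g : (Fin n → AddCircle (1 : ℝ)) → ℂ :=
    fun θ => ∑ m ∈ F, c (m, 0) * ∏ j, fourier (m j) (θ j) with hg
  have hgc : Continuous g := by fun_prop
  have hFE : (F : Set (Fin n → ℤ)) ⊆ E := fun m hm => by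
    obtain ⟨x, hx, rfl⟩ := Finset.mem_image.mp hm
    exact (hS hx).1
  have hx0 : ∀ x ∈ S, (x.1, (0 : ℤ)) = x := fun x hx => Prod.ext rfl (h0 x hx).symm
  have hsum : ∑ m ∈ F, ‖c (m, 0)‖ ^ 2 = ∑ x ∈ S, ‖c x‖ ^ 2 := by
    rw [hF, Finset.sum_image hinj]
    exact Finset.sum_congr rfl fun x hx => by rw [hx0 x hx]
  have hpoly : trigPoly S c = g ∘ Prod.fst := by
    ext θ
    rw [trigPoly_apply, Function.comp_apply, hg]
    simp only
    rw [hF, Finset.sum_image hinj]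
    refine Finset.sum_congr rfl fun x hx => ?_
    rw [hx0 x hx, prodChar, h0 x hx]
    simp
  have hq2 : (2 : ℝ) < ((2 * q : ℕ) : ℝ) := by exact_mod_cast (by omega : 2 < 2 * q)
  have hb := hE g ⟨F, _, hFE, rfl⟩ _ hq2
  have hmem : MemLp g 2 (haarPi n) :=
    hgc.memLp_of_hasCompactSupport (HasCompactSupport.of_compactSpace g)
  have hg2 : (eLpNorm g 2 (haarPi n)).toReal = √(∑ x ∈ S, ‖c x‖ ^ 2) := by
    rw [toReal_eLpNorm hgc.aestronglyMeasurable, hg, lpNorm_two_sum_prod_fourier, hsum]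
  have hb' := ENNReal.toReal_mono (ENNReal.mul_ne_top ENNReal.ofReal_ne_top hmem.eLpNorm_ne_top) hb
  rw [ENNReal.toReal_mul, ENNReal.toReal_ofReal (by positivity),
    hg2] at hb'
  have hnorm : evenNorm q (trigPoly S c) =
      (eLpNorm g (ENNReal.ofReal ((2 * q : ℕ) : ℝ)) (haarPi n)).toReal := by
    rw [evenNorm, ← toReal_eLpNorm (continuous_trigPoly S c).aestronglyMeasurable, hpoly, haarPiProd,
      eLpNorm_comp_measurePreserving hgc.aestronglyMeasurable measurePreserving_fst,
      ENNReal.ofReal_natCast]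
  rw [hnorm]
  refine (pow_le_pow_left₀ ENNReal.toReal_nonneg hb' 2).trans (le_of_eq ?_)
  have hpow : (((2 * q : ℕ) : ℝ) ^ ((NE : ℝ) / 2)) ^ 2 = 2 ^ NE * (q : ℝ) ^ NE := by
    rw [← Real.rpow_natCast (_ ^ _) 2, ← Real.rpow_mul (by positivity), Nat.cast_ofNat,
      div_mul_cancel₀ _ two_ne_zero, Real.rpow_natCast]
    push_cast
    exact mul_pow _ _ _
  rw [mul_pow, mul_pow, Real.sq_sqrt (Finset.sum_nonneg fun _ _ => by positivity), hpow]
  ring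

lemma exists_hasEvenBound_prod_lacunarySumset {n : ℕ} {E : Set (Fin n → ℤ)} {CE : ℝ}
    (hCE : 0 < CE) {NE : ℕ}
    (hE : ∀ g : (Fin n → AddCircle (1 : ℝ)) → ℂ,
      (∃ (F : Finset (Fin n → ℤ)) (c : (Fin n → ℤ) → ℂ), ↑F ⊆ E ∧
        g = fun θ => ∑ m ∈ F, c m * ∏ j, fourier (m j) (θ j)) →
      ∀ p : ℝ, 2 < p →
        eLpNorm g (ENNReal.ofReal p) (haarPi n) ≤
          ENNReal.ofReal (CE * p ^ ((NE : ℝ) / 2)) * eLpNorm g 2 (haarPi n))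
    {lam : ℕ → ℕ} (hpos : ∀ m, 0 < lam m) (hmono : StrictMono lam)
    (hlac : ∀ m, 2 * lam m ≤ lam (m + 1)) (k : ℕ) :
    ∃ C : ℝ, 0 < C ∧
      HasEvenBound {x : (Fin n → ℤ) × ℤ | x.1 ∈ E ∧ x.2 ∈ lacunarySumset lam k} C (NE + k) := by
  induction k with
  | zero => exact ⟨_, by positivity, hasEvenBound_prod_lacunarySumset_zero hCE hE lam⟩
  | succ k ih =>
    obtain ⟨C, hC, h⟩ := ih
    exact ⟨_, by positivity, h.prod_lacunarySumset_succ hpos hmono hlac hC.le⟩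

/-- The threshold separating the two regimes of Young's inequality at level `q`. -/
noncomputable def youngWeight (C : ℝ) (N q : ℕ) : ℝ := √(2 * Real.exp 1 * C * q ^ N)

lemma youngWeight_pos {C : ℝ} (hC : 0 < C) (N : ℕ) {q : ℕ} (hq : 0 < q) :
    0 < youngWeight C N q := by
  have : (0 : ℝ) < q := by exact_mod_cast hq
  unfold youngWeight
  positivity

lemma sq_youngWeight {C : ℝ} (hC : 0 < C) (N q : ℕ) :
    youngWeight C N q ^ 2 = 2 * Real.exp 1 * C * q ^ N :=
  Real.sq_sqrt (by positivity)

lemma summable_youngWeight_mul_geometric {C : ℝ} (hC : 0 < C) (N : ℕ) :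
    Summable fun q : ℕ => youngWeight C N q * (1 / 2) ^ q := by
  have h1 : Summable fun q : ℕ => (1 / 2 : ℝ) ^ q := summable_geometric_two
  have h2 : Summable fun q : ℕ => ((q : ℝ) ^ N * (1 / 2 : ℝ) ^ q) :=
    summable_pow_mul_geometric_of_norm_lt_one N (by norm_num)
  refine Summable.of_nonneg_of_le (fun q => mul_nonneg (Real.sqrt_nonneg _) (by positivity))
    (fun q => ?_) (h1.add (h2.mul_left (2 * Real.exp 1 * C)))
  have h3 : youngWeight C N q ≤ 1 + 2 * Real.exp 1 * C * q ^ N := by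
    rw [youngWeight, Real.sqrt_le_left (by positivity)]
    have : 0 ≤ 2 * Real.exp 1 * C * q ^ N := by positivity
    nlinarith
  calc youngWeight C N q * (1 / 2) ^ q ≤ (1 + 2 * Real.exp 1 * C * q ^ N) * (1 / 2) ^ q := by gcongr
    _ = _ := by ring

/-- A Young type inequality interpolating between `L log^{N/2} L` and the `L^{2q}` norms. -/
lemma exists_mul_le_youngWeight {C : ℝ} (hC : 0 < C) (N : ℕ) {a b : ℝ} (ha : 0 ≤ a) (hb : 0 ≤ b) :
    ∃ i : ℕ, a * b ≤ √(2 * Real.exp 1 * C * 3 ^ N) * (a * Real.log (1 + a) ^ ((N : ℝ) / 2)) +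
      2 * √(2 * Real.exp 1 * C * 3 ^ N) +
      Real.exp 1 ^ (i + 2) * b ^ (2 * (i + 2)) / youngWeight C N (i + 2) ^ (2 * i + 3) := by
  set L := Real.log (1 + a) with hL
  have hL0 : 0 ≤ L := Real.log_nonneg (by linarith)
  set A := √(2 * Real.exp 1 * C * 3 ^ N) with hA
  have hA0 : 0 ≤ A := Real.sqrt_nonneg _
  set i := ⌊L⌋₊ with hi
  have hω := youngWeight_pos hC N (q := i + 2) (by omega)
  set ω := youngWeight C N (i + 2) with hωdef
  have hae : a ≤ Real.exp 1 ^ (i + 2) := by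
    rw [← Real.exp_nat_mul, mul_one]
    have h1 : L ≤ ((i + 2 : ℕ) : ℝ) := by
      push_cast
      linarith [Nat.lt_floor_add_one L]
    have h2 := Real.exp_le_exp.mpr h1
    rw [hL, Real.exp_log (by linarith)] at h2
    linarith
  have haω : a * ω ≤ A * (a * L ^ ((N : ℝ) / 2)) + 2 * A := by
    rcases le_or_gt 1 L with h1 | h1
    · have h2 : ((i + 2 : ℕ) : ℝ) ≤ 3 * L := by
        push_cast
        linarith [Nat.floor_le hL0]
      have h3 : ω ≤ A * L ^ ((N : ℝ) / 2) := by
        have : L ^ ((N : ℝ) / 2) = √(L ^ N) := by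
          rw [Real.sqrt_eq_rpow, ← Real.rpow_natCast, ← Real.rpow_mul hL0]
          ring_nf
        rw [this, hA, ← Real.sqrt_mul (by positivity), hωdef, youngWeight, mul_assoc _ (3 ^ N),
          ← mul_pow]
        gcongr
      nlinarith [mul_le_mul_of_nonneg_left h3 ha]
    · have h2 : i = 0 := Nat.floor_eq_zero.mpr h1
      have h3 : ω ≤ A := by
        rw [hωdef, h2, youngWeight, hA]
        gcongr
        norm_num
      have h4 : a ≤ 2 := by
        have := (Real.log_lt_iff_lt_exp (by linarith)).mp h1
        linarith [Real.exp_one_lt_d9]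
      have h5 : 0 ≤ A * (a * L ^ ((N : ℝ) / 2)) := by positivity
      nlinarith
  refine ⟨i, ?_⟩
  have hh : 0 ≤ Real.exp 1 ^ (i + 2) * b ^ (2 * (i + 2)) / ω ^ (2 * i + 3) := by positivity
  rcases le_or_gt b ω with h | h
  · have := mul_le_mul_of_nonneg_left h ha
    linarith
  · have h1 : a * b ≤ Real.exp 1 ^ (i + 2) * b ^ (2 * (i + 2)) / ω ^ (2 * i + 3) := by
      rw [le_div_iff₀ (by positivity)]
      calc a * b * ω ^ (2 * i + 3) ≤ Real.exp 1 ^ (i + 2) * b * b ^ (2 * i + 3) := by gcongr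
        _ = _ := by ring
    have h2 : 0 ≤ a * ω := by positivity
    linarith

lemma integral_norm_pow_div_youngWeight_le {n : ℕ} {C : ℝ} (hC : 0 < C) {N q : ℕ} (hq : 2 ≤ q)
    {u : TorusProd n → ℂ} (hu : Continuous u) (h : evenNorm q u ^ 2 ≤ C * q ^ N) :
    ∫ θ, Real.exp 1 ^ q * ‖u θ‖ ^ (2 * q) / youngWeight C N q ^ (2 * q - 1) ∂(haarPiProd n) ≤
      youngWeight C N q * (1 / 2) ^ q := by
  have hω := youngWeight_pos hC N (q := q) (by omega)
  rw [integral_div, integral_const_mul, integral_norm_pow_eq_evenNorm (by omega) hu,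
    div_le_iff₀ (by positivity), pow_mul]
  have h1 : youngWeight C N q * youngWeight C N q ^ (2 * q - 1) =
      (2 * Real.exp 1 * C * q ^ N) ^ q := by
    rw [← sq_youngWeight hC, ← pow_mul, ← pow_succ']
    congr 1
    omega
  calc Real.exp 1 ^ q * (evenNorm q u ^ 2) ^ q ≤ Real.exp 1 ^ q * (C * q ^ N) ^ q := by gcongr
    _ = youngWeight C N q * youngWeight C N q ^ (2 * q - 1) * (1 / 2) ^ q := by
      rw [h1, ← mul_pow, ← mul_pow]
      ring
    _ = _ := by ring

/-- Duality between `L log^{N/2} L` and functions with `‖u‖_{2q}² ≤ C q^N` for all `q ≥ 2`. -/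
lemma lintegral_mul_le_of_evenNorm_le {n : ℕ} {C : ℝ} (hC : 0 < C) {N : ℕ}
    (f : TorusProd n → ℂ) {u : TorusProd n → ℂ} (hu : Continuous u)
    (h : ∀ q : ℕ, 2 ≤ q → evenNorm q u ^ 2 ≤ C * q ^ N) :
    ∫⁻ θ, ‖f θ‖ₑ * ‖u θ‖ₑ ∂(haarPiProd n) ≤
      ENNReal.ofReal √(2 * Real.exp 1 * C * 3 ^ N) *
        (∫⁻ θ, ‖f θ‖ₑ * ENNReal.ofReal (Real.log (1 + ‖f θ‖) ^ ((N : ℝ) / 2)) ∂(haarPiProd n)) +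
      ENNReal.ofReal (2 * √(2 * Real.exp 1 * C * 3 ^ N) +
        ∑' i : ℕ, youngWeight C N (i + 2) * (1 / 2) ^ (i + 2)) := by
  set A := √(2 * Real.exp 1 * C * 3 ^ N) with hA
  have hA0 : 0 ≤ A := Real.sqrt_nonneg _
  have hω : ∀ i : ℕ, 0 < youngWeight C N (i + 2) := fun i => youngWeight_pos hC N (by omega)
  set H : ℕ → TorusProd n → ℝ := fun i θ =>
    Real.exp 1 ^ (i + 2) * ‖u θ‖ ^ (2 * (i + 2)) / youngWeight C N (i + 2) ^ (2 * i + 3) with hH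
  have hH0 : ∀ i θ, 0 ≤ H i θ := fun i θ => by
    have := hω i
    simp only [hH]
    positivity
  have hHc : ∀ i, Continuous (H i) := fun i => by simp only [hH]; fun_prop
  have hsummable : Summable fun i : ℕ => youngWeight C N (i + 2) * (1 / 2) ^ (i + 2) :=
    (_root_.summable_nat_add_iff 2).mpr (summable_youngWeight_mul_geometric hC N)
  have hpt : ∀ θ, ‖f θ‖ₑ * ‖u θ‖ₑ ≤
      ENNReal.ofReal A * (‖f θ‖ₑ * ENNReal.ofReal (Real.log (1 + ‖f θ‖) ^ ((N : ℝ) / 2))) +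
        (ENNReal.ofReal (2 * A) + ∑' i, ENNReal.ofReal (H i θ)) := fun θ => by
    obtain ⟨i, hi⟩ := exists_mul_le_youngWeight hC N (norm_nonneg (f θ)) (norm_nonneg (u θ))
    have hL : 0 ≤ Real.log (1 + ‖f θ‖) := Real.log_nonneg (by linarith [norm_nonneg (f θ)])
    rw [← hA] at hi
    refine le_trans ?_ (add_le_add_right (add_le_add_right (ENNReal.le_tsum i) _) _)
    rw [← ofReal_norm, ← ofReal_norm, ← ENNReal.ofReal_mul (norm_nonneg _),
      ← ENNReal.ofReal_mul (norm_nonneg _), ← ENNReal.ofReal_mul hA0,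
      ← ENNReal.ofReal_add (by positivity) (hH0 i θ),
      ← ENNReal.ofReal_add (by positivity) (add_nonneg (by positivity) (hH0 i θ)), ← add_assoc]
    exact ENNReal.ofReal_le_ofReal hi
  have hHint : ∀ i, ∫⁻ θ, ENNReal.ofReal (H i θ) ∂(haarPiProd n) ≤
      ENNReal.ofReal (youngWeight C N (i + 2) * (1 / 2) ^ (i + 2)) := fun i => by
    rw [← ofReal_integral_eq_lintegral_ofReal (hHc i).integrable_haarPiProd
      (.of_forall fun θ => hH0 i θ)]
    exact ENNReal.ofReal_le_ofReal
      (integral_norm_pow_div_youngWeight_le hC (by omega) hu (h (i + 2) (by omega)))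
  have hmeas : Measurable fun θ => ∑' i, ENNReal.ofReal (H i θ) :=
    Measurable.tsum fun i => (hHc i).measurable.ennreal_ofReal
  have hmeas' : Measurable fun θ => ENNReal.ofReal (2 * A) + ∑' i, ENNReal.ofReal (H i θ) :=
    measurable_const.add hmeas
  refine (lintegral_mono hpt).trans ?_
  rw [lintegral_add_right _ hmeas', lintegral_add_right _ hmeas,
    lintegral_const_mul' _ _ ENNReal.ofReal_ne_top, lintegral_const, measure_univ, mul_one,
    lintegral_tsum fun i => (hHc i).measurable.ennreal_ofReal.aemeasurable,
    ENNReal.ofReal_add (by positivity) (tsum_nonneg fun i => by have := hω i; positivity),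
    ENNReal.ofReal_tsum_of_nonneg (fun i => by have := hω i; positivity) hsummable]
  gcongr with i
  exact hHint i

lemma conj_prodChar {n : ℕ} (q : (Fin n → ℤ) × ℤ) (θ : TorusProd n) :
    (starRingEnd ℂ) (prodChar q θ) =
      (∏ j, fourier (-(q.1 j)) (θ.1 j)) * fourier (-q.2) θ.2 := by
  simp only [prodChar, map_mul, map_prod, fourier_neg]

lemma integral_conj_trigPoly_mul {n : ℕ} {f : TorusProd n → ℂ} (hf : Integrable f (haarPiProd n))
    (S : Finset ((Fin n → ℤ) × ℤ)) (c : (Fin n → ℤ) × ℤ → ℂ) :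
    ∫ θ, (starRingEnd ℂ) (trigPoly S c θ) * f θ ∂(haarPiProd n) =
      ∑ q ∈ S, (starRingEnd ℂ) (c q) * prodFourierCoeff f q.1 q.2 := by
  have hint : ∀ q, Integrable (fun θ => (starRingEnd ℂ) (prodChar q θ) * f θ) (haarPiProd n) :=
    fun q => hf.bdd_mul (c := 1) (Continuous.aestronglyMeasurable (by fun_prop))
      (.of_forall fun θ => by
        simp only [RCLike.norm_conj, prodChar, norm_mul, norm_prod, norm_fourier_apply_eq_one,
          Finset.prod_const_one, mul_one, le_refl])
  simp only [trigPoly_apply, map_sum, map_mul, Finset.sum_mul, mul_assoc]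
  rw [integral_finsetSum _ fun q _ => (hint q).const_mul _]
  refine Finset.sum_congr rfl fun q _ => ?_
  rw [integral_const_mul, prodFourierCoeff]
  simp only [conj_prodChar]

lemma sqrt_sum_sq_prodFourierCoeff_le {n : ℕ} {Λ : Set ((Fin n → ℤ) × ℤ)} {C : ℝ} (hC : 0 < C)
    {N : ℕ} (h : HasEvenBound Λ C N) {f : TorusProd n → ℂ} (hf : Integrable f (haarPiProd n))
    {S : Finset ((Fin n → ℤ) × ℤ)} (hS : ↑S ⊆ Λ) :
    ENNReal.ofReal √(∑ q ∈ S, ‖prodFourierCoeff f q.1 q.2‖ ^ 2) ≤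
      ENNReal.ofReal √(2 * Real.exp 1 * C * 3 ^ N) *
        (∫⁻ θ, ‖f θ‖ₑ * ENNReal.ofReal (Real.log (1 + ‖f θ‖) ^ ((N : ℝ) / 2)) ∂(haarPiProd n)) +
      ENNReal.ofReal (2 * √(2 * Real.exp 1 * C * 3 ^ N) +
        ∑' i : ℕ, youngWeight C N (i + 2) * (1 / 2) ^ (i + 2)) := by
  set R := √(∑ q ∈ S, ‖prodFourierCoeff f q.1 q.2‖ ^ 2) with hR
  have hR2 : R ^ 2 = ∑ q ∈ S, ‖prodFourierCoeff f q.1 q.2‖ ^ 2 :=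
    Real.sq_sqrt (Finset.sum_nonneg fun _ _ => by positivity)
  rcases (Real.sqrt_nonneg _ : 0 ≤ R).eq_or_lt with h0 | h0
  · rw [hR, ← h0, ENNReal.ofReal_zero]
    exact zero_le
  set c : (Fin n → ℤ) × ℤ → ℂ := fun q => (R : ℂ)⁻¹ * prodFourierCoeff f q.1 q.2 with hc
  have hcsum : ∑ q ∈ S, ‖c q‖ ^ 2 = 1 := by
    simp only [hc, norm_mul, mul_pow, ← Finset.mul_sum, ← hR2]
    rw [norm_inv, Complex.norm_real, Real.norm_of_nonneg h0.le, ← mul_pow,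
      inv_mul_cancel₀ h0.ne', one_pow]
  have hpair : ∫ θ, (starRingEnd ℂ) (trigPoly S c θ) * f θ ∂(haarPiProd n) = R := by
    rw [integral_conj_trigPoly_mul hf]
    simp only [hc, map_mul, map_inv₀, Complex.conj_ofReal, mul_assoc, Complex.conj_mul']
    rw [← Finset.mul_sum]
    have : ∑ q ∈ S, (‖prodFourierCoeff f q.1 q.2‖ : ℂ) ^ 2 = (R : ℂ) ^ 2 := by
      exact_mod_cast hR2.symm
    rw [this]
    have : (R : ℂ) ≠ 0 := by exact_mod_cast h0.ne'
    field_simp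
  refine le_trans ?_ (lintegral_mul_le_of_evenNorm_le hC f (continuous_trigPoly S c)
    fun q hq => by simpa [hcsum] using h q hq S c hS)
  have hle := enorm_integral_le_lintegral_enorm (μ := haarPiProd n)
    (fun θ => (starRingEnd ℂ) (trigPoly S c θ) * f θ)
  rw [hpair, ← ofReal_norm, Complex.norm_real, Real.norm_of_nonneg h0.le] at hle
  refine hle.trans (le_of_eq (lintegral_congr fun θ => ?_))
  rw [enorm_mul, mul_comm, ← ofReal_norm ((starRingEnd ℂ) _), RCLike.norm_conj, ofReal_norm]

/-- **The inductive lemma for the higher-dimensional Bonami theorem.** If `E ⊆ ℤⁿ` carries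
`Λ(p)` bounds `‖g‖_p ≤ C_E p^{N_E/2} ‖g‖₂` for all `E`-polynomials, and `Λ^{(k)}` is the
`k`-fold sumset of a lacunary sequence with ratio at least `2`, then the spectral set
`E × Λ^{(k)} ⊆ ℤ^{n+1}` satisfies a Zygmund inequality with exponent `(N_E + k)/2`. -/
theorem zygmund_for_product_with_lacunary_sumset
    {n : ℕ} (hn : 1 ≤ n) (E : Set (Fin n → ℤ))
    (CE : ℝ) (hCE : 0 < CE) (NE : ℕ) (hNE : 1 ≤ NE)
    (hE : ∀ g : (Fin n → AddCircle (1 : ℝ)) → ℂ,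
      (∃ (F : Finset (Fin n → ℤ)) (c : (Fin n → ℤ) → ℂ), ↑F ⊆ E ∧
        g = fun θ => ∑ m ∈ F, c m * ∏ j, fourier (m j) (θ j)) →
      ∀ p : ℝ, 2 < p →
        eLpNorm g (ENNReal.ofReal p) (haarPi n) ≤
          ENNReal.ofReal (CE * p ^ ((NE : ℝ) / 2)) * eLpNorm g 2 (haarPi n))
    (lam : ℕ → ℕ) (hpos : ∀ m, 0 < lam m) (hmono : StrictMono lam)
    (hlac : ∀ m, 2 * lam m ≤ lam (m + 1)) (k : ℕ) (hk : 1 ≤ k) :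
    ∃ A B : ℝ, 0 < A ∧ 0 < B ∧
      ∀ f : (Fin n → AddCircle (1 : ℝ)) × AddCircle (1 : ℝ) → ℂ,
        Integrable f (haarPiProd n) →
        (∑' q : {q : (Fin n → ℤ) × ℤ // q.1 ∈ E ∧ q.2 ∈ lacunarySumset lam k},
            (‖prodFourierCoeff f q.1.1 q.1.2‖₊ : ℝ≥0∞) ^ 2) ^ ((1 : ℝ) / 2)
          ≤ ENNReal.ofReal A *
              (∫⁻ θ, (‖f θ‖₊ : ℝ≥0∞) *
                ENNReal.ofReal (Real.log (1 + ‖f θ‖) ^ (((NE + k : ℕ) : ℝ) / 2))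
                ∂(haarPiProd n))
            + ENNReal.ofReal B := by
  obtain ⟨C, hC, h⟩ := exists_hasEvenBound_prod_lacunarySumset hCE hE hpos hmono hlac k
  have hA : 0 < √(2 * Real.exp 1 * C * 3 ^ (NE + k)) := by positivity
  have hB : 0 ≤ ∑' i : ℕ, youngWeight C (NE + k) (i + 2) * (1 / 2) ^ (i + 2) :=
    tsum_nonneg fun i => by
      have := youngWeight_pos hC (NE + k) (q := i + 2) (by omega)
      positivity
  refine ⟨_, _, hA, add_pos_of_pos_of_nonneg (mul_pos two_pos hA) hB, fun f hf => ?_⟩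
  refine (le_of_eq (by rw [one_div])).trans ((ENNReal.rpow_inv_le_iff two_pos).mpr ?_)
  rw [ENNReal.rpow_ofNat, ENNReal.tsum_eq_iSup_sum]
  refine iSup_le fun T => ?_
  have hT := sqrt_sum_sq_prodFourierCoeff_le hC h hf
    (S := T.map (Function.Embedding.subtype _)) (fun x hx => by
      obtain ⟨y, _, rfl⟩ := Finset.mem_map.mp hx
      exact y.2)
  rw [Finset.sum_map] at hT
  refine le_trans (le_of_eq ?_) (pow_le_pow_left' hT 2)
  rw [← ENNReal.ofReal_pow (Real.sqrt_nonneg _),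
    Real.sq_sqrt (Finset.sum_nonneg fun _ _ => by positivity),
    ENNReal.ofReal_sum_of_nonneg fun _ _ => by positivity]
  refine Finset.sum_congr rfl fun q _ => ?_
  rw [ENNReal.ofReal_pow (norm_nonneg _), ofReal_norm]
  rfl
end

section
/- Let Λ₁ = (λ_{1,m})_{m∈ℕ} and Λ₂ = (λ_{2,m})_{m∈ℕ} be strictly increasing sequences of positive integers with λ_{j,m+1} ≥ 2 λ_{j,m} for all m and j = 1, 2. Then there is a constant C > 0, depending only on Λ₁ and Λ₂, such that for every p > 2 and every trigonometric polynomial f on 𝕋² whose Fourier coefficients are supported in Λ₁ × Λ₂, ‖f‖_{L^p(𝕋²)} ≤ C · p · ‖f‖_{L²(𝕋²)}. -/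
open MeasureTheory ENNReal NNReal

/-- The normalized Haar measure on `𝕋² = 𝕋 × 𝕋`. -/
noncomputable def haarT2 : Measure (AddCircle (1 : ℝ) × AddCircle (1 : ℝ)) :=
  AddCircle.haarAddCircle.prod AddCircle.haarAddCircle

open AddCircle ComplexConjugate

theorem Continuous.integrable_haarAddCircle {E : Type*} [NormedAddCommGroup E]
    {g : AddCircle (1 : ℝ) → E} (hg : Continuous g) : Integrable g haarAddCircle :=
  hg.integrable_of_hasCompactSupport (HasCompactSupport.of_compactSpace g)

theorem integral_fourier_haarAddCircle (k : ℤ) :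
    ∫ θ : AddCircle (1 : ℝ), fourier k θ ∂haarAddCircle = if k = 0 then 1 else 0 := by
  have h := congrFun (fourierCoeff_fourier (T := 1) k) 0
  simp only [fourierCoeff, neg_zero, fourier_zero, one_smul, Pi.single_apply] at h
  rw [h]
  simp only [eq_comm]

theorem sum_range_lt_of_two_mul_le {lam : ℕ → ℕ} (hpos : ∀ m, 0 < lam m)
    (hlac : ∀ m, 2 * lam m ≤ lam (m + 1)) (n : ℕ) : ∑ i ∈ Finset.range n, lam i < lam n := by
  induction n with
  | zero => simpa using hpos 0
  | succ n ih =>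
    rw [Finset.sum_range_succ]
    have := hlac n
    omega

theorem continuous_rieszProduct (lam : ℕ → ℕ) (b : ℕ → ℂ) (n : ℕ) :
    Continuous fun θ : AddCircle (1 : ℝ) => ∏ i ∈ Finset.range n,
      (1 + b i * fourier (lam i) θ + conj (b i) * fourier (-(lam i : ℤ)) θ) :=
  continuous_finsetProd _ fun _ _ =>
    (continuous_const.add (continuous_const.mul (map_continuous _))).add
      (continuous_const.mul (map_continuous _))

theorem integral_rieszProduct_succ_mul_fourier (lam : ℕ → ℕ) (b : ℕ → ℂ) (n : ℕ) (k : ℤ) :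
    ∫ θ : AddCircle (1 : ℝ), (∏ i ∈ Finset.range (n + 1),
      (1 + b i * fourier (lam i) θ + conj (b i) * fourier (-(lam i : ℤ)) θ)) * fourier k θ
        ∂haarAddCircle =
    (∫ θ : AddCircle (1 : ℝ), (∏ i ∈ Finset.range n,
      (1 + b i * fourier (lam i) θ + conj (b i) * fourier (-(lam i : ℤ)) θ)) * fourier k θ
        ∂haarAddCircle) +
    b n * (∫ θ : AddCircle (1 : ℝ), (∏ i ∈ Finset.range n,
      (1 + b i * fourier (lam i) θ + conj (b i) * fourier (-(lam i : ℤ)) θ)) *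
        fourier (lam n + k) θ ∂haarAddCircle) +
    conj (b n) * (∫ θ : AddCircle (1 : ℝ), (∏ i ∈ Finset.range n,
      (1 + b i * fourier (lam i) θ + conj (b i) * fourier (-(lam i : ℤ)) θ)) *
        fourier (-(lam n : ℤ) + k) θ ∂haarAddCircle) := by
  set P := fun θ : AddCircle (1 : ℝ) => ∏ i ∈ Finset.range n,
    (1 + b i * fourier (lam i) θ + conj (b i) * fourier (-(lam i : ℤ)) θ)
  have hi (l : ℤ) : Integrable (fun θ => P θ * fourier l θ) haarAddCircle :=
    ((continuous_rieszProduct lam b n).mul (map_continuous (fourier l))).integrable_haarAddCircle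
  rw [← integral_const_mul, ← integral_const_mul, ← integral_add (hi _) ((hi _).const_mul _),
    ← integral_add (f := fun θ => P θ * fourier k θ + b n * (P θ * fourier (lam n + k) θ))
      ((hi _).add ((hi _).const_mul _)) ((hi _).const_mul _)]
  congr 1 with θ
  rw [Finset.prod_range_succ, fourier_add, fourier_add]
  ring

theorem integral_rieszProduct_mul_fourier_eq_zero (lam : ℕ → ℕ) (b : ℕ → ℂ) (n : ℕ) (k : ℤ)
    (hk : ((∑ i ∈ Finset.range n, lam i : ℕ) : ℤ) < |k|) :
    ∫ θ : AddCircle (1 : ℝ), (∏ i ∈ Finset.range n,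
      (1 + b i * fourier (lam i) θ + conj (b i) * fourier (-(lam i : ℤ)) θ)) * fourier k θ
        ∂haarAddCircle = 0 := by
  induction n generalizing k with
  | zero =>
    have : k ≠ 0 := by simpa using hk
    simp only [Finset.range_zero, Finset.prod_empty, one_mul]
    rw [integral_fourier_haarAddCircle, if_neg this]
  | succ n ih =>
    rw [Finset.sum_range_succ, Nat.cast_add] at hk
    have h1 := abs_sub_abs_le_abs_sub k (-(lam n : ℤ))
    have h2 := abs_sub_abs_le_abs_sub k (lam n : ℤ)
    rw [abs_neg, sub_neg_eq_add, add_comm k] at h1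
    rw [sub_eq_neg_add k] at h2
    rw [Nat.abs_cast] at h1 h2
    rw [integral_rieszProduct_succ_mul_fourier, ih _ (by linarith), ih _ (by linarith),
      ih _ (by linarith)]
    simp

theorem integral_rieszProduct {lam : ℕ → ℕ} (hpos : ∀ m, 0 < lam m)
    (hlac : ∀ m, 2 * lam m ≤ lam (m + 1)) (b : ℕ → ℂ) (n : ℕ) :
    ∫ θ : AddCircle (1 : ℝ), ∏ i ∈ Finset.range n,
      (1 + b i * fourier (lam i) θ + conj (b i) * fourier (-(lam i : ℤ)) θ)
        ∂haarAddCircle = 1 := by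
  induction n with
  | zero => simp
  | succ n ih =>
    have h := integral_rieszProduct_succ_mul_fourier lam b n 0
    have hn : ((∑ i ∈ Finset.range n, lam i : ℕ) : ℤ) < lam n :=
      mod_cast sum_range_lt_of_two_mul_le hpos hlac n
    rw [integral_rieszProduct_mul_fourier_eq_zero lam b n (lam n + 0) (by simpa using hn),
      integral_rieszProduct_mul_fourier_eq_zero lam b n (-lam n + 0) (by simpa using hn)] at h
    simp only [fourier_zero, mul_one, mul_zero, add_zero] at h
    rw [h, ih]

theorem Real.exp_le_cosh_add_mul_sinh {x r : ℝ} (hx : |x| ≤ r) :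
    Real.exp x ≤ Real.cosh r + x / r * Real.sinh r := by
  rcases eq_or_lt_of_le ((abs_nonneg x).trans hx) with rfl | hr
  · simp [abs_nonpos_iff.1 hx]
  obtain ⟨h1, h2⟩ := abs_le.1 hx
  have l1 : -1 ≤ x / r := by rw [le_div_iff₀ hr]; linarith
  have l2 : x / r ≤ 1 := by rwa [div_le_one hr]
  have h := convexOn_exp.2 (Set.mem_univ r) (Set.mem_univ (-r))
    (show 0 ≤ (1 + x / r) / 2 by linarith) (show 0 ≤ (1 - x / r) / 2 by linarith) (by ring)
  have e : ((1 + x / r) / 2) • r + ((1 - x / r) / 2) • (-r) = x := by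
    simp only [smul_eq_mul]; field_simp; ring
  rw [e] at h
  refine h.trans (le_of_eq ?_)
  rw [Real.cosh_eq, Real.sinh_eq]
  simp only [smul_eq_mul]
  ring

theorem exists_exp_re_mul_le (a : ℂ) : ∃ τ : ℝ, ∀ z : ℂ, ‖z‖ = 1 →
    Real.exp (a * z).re ≤ Real.exp (‖a‖ ^ 2 / 2) * (1 + τ * (a * z).re) := by
  refine ⟨Real.sinh ‖a‖ / (‖a‖ * Real.cosh ‖a‖), fun z hz => ?_⟩
  have hc := Real.cosh_pos ‖a‖
  have hx : |(a * z).re| ≤ ‖a‖ := (Complex.abs_re_le_norm _).trans (by simp [hz])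
  have h : Real.exp (a * z).re ≤
      Real.cosh ‖a‖ * (1 + Real.sinh ‖a‖ / (‖a‖ * Real.cosh ‖a‖) * (a * z).re) := by
    refine (Real.exp_le_cosh_add_mul_sinh hx).trans (le_of_eq ?_)
    rcases eq_or_ne ‖a‖ 0 with h0 | h0
    · simp [h0]
    · field_simp
  refine h.trans (mul_le_mul_of_nonneg_right (Real.cosh_le_exp_half_sq _) ?_)
  exact (pos_of_mul_pos_right ((Real.exp_pos _).trans_le h) hc.le).le

theorem continuous_sum_mul_fourier (lam : ℕ → ℕ) (a : ℕ → ℂ) (n : ℕ) :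
    Continuous fun θ : AddCircle (1 : ℝ) => ∑ i ∈ Finset.range n, a i * fourier (lam i) θ :=
  continuous_finsetSum _ fun _ _ => continuous_const.mul (map_continuous _)

theorem integral_exp_re_sum_mul_fourier_le {lam : ℕ → ℕ} (hpos : ∀ m, 0 < lam m)
    (hlac : ∀ m, 2 * lam m ≤ lam (m + 1)) (a : ℕ → ℂ) (n : ℕ) :
    ∫ θ : AddCircle (1 : ℝ), Real.exp (∑ i ∈ Finset.range n, a i * fourier (lam i) θ).re
      ∂haarAddCircle ≤ Real.exp ((∑ i ∈ Finset.range n, ‖a i‖ ^ 2) / 2) := by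
  choose τ hτ using fun i => exists_exp_re_mul_le (a i)
  have hP (θ : AddCircle (1 : ℝ)) :
      ((∏ i ∈ Finset.range n, (1 + τ i * (a i * fourier (lam i) θ).re) : ℝ) : ℂ) =
      ∏ i ∈ Finset.range n, (1 + (τ i / 2 * a i) * fourier (lam i) θ +
        conj (τ i / 2 * a i : ℂ) * fourier (-(lam i : ℤ)) θ) := by
    push_cast
    refine Finset.prod_congr rfl fun i _ => ?_
    rw [fourier_neg, ← map_mul, Complex.re_eq_add_conj]
    simp only [map_mul, map_div₀, Complex.conj_ofReal, Complex.conj_ofNat]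
    ring
  have hint : ∫ θ : AddCircle (1 : ℝ),
      ∏ i ∈ Finset.range n, (1 + τ i * (a i * fourier (lam i) θ).re) ∂haarAddCircle = 1 := by
    have h := integral_rieszProduct hpos hlac (fun i => (τ i / 2 * a i : ℂ)) n
    rw [← integral_congr_ae (.of_forall hP), integral_complex_ofReal] at h
    exact_mod_cast h
  have hcont : Continuous fun θ : AddCircle (1 : ℝ) =>
      ∏ i ∈ Finset.range n, (1 + τ i * (a i * fourier (lam i) θ).re) :=
    continuous_finsetProd _ fun _ _ => continuous_const.add <| continuous_const.mul <|
      Complex.continuous_re.comp <| continuous_const.mul <| map_continuous _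
  calc
    _ ≤ ∫ θ : AddCircle (1 : ℝ), Real.exp ((∑ i ∈ Finset.range n, ‖a i‖ ^ 2) / 2) *
        ∏ i ∈ Finset.range n, (1 + τ i * (a i * fourier (lam i) θ).re) ∂haarAddCircle := by
      refine integral_mono ?_ ?_ fun θ => ?_
      · exact (Real.continuous_exp.comp (Complex.continuous_re.comp
          (continuous_sum_mul_fourier lam a n))).integrable_haarAddCircle
      · exact (continuous_const.mul hcont).integrable_haarAddCircle
      · simp only
        rw [Complex.re_sum, Real.exp_sum, Finset.sum_div, Real.exp_sum, ← Finset.prod_mul_distrib]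
        exact Finset.prod_le_prod (fun _ _ => (Real.exp_pos _).le)
          fun i _ => hτ i _ (Circle.norm_coe _)
    _ = _ := by rw [integral_const_mul, hint, mul_one]

theorem Complex.norm_rpow_le_sum_exp {p s : ℝ} (hp : 0 < p) (hs : 0 < s) (z : ℂ) :
    ‖z‖ ^ p ≤ (2 * p / s) ^ p *
      (Real.exp (s * z).re + Real.exp (-s * z).re +
        (Real.exp (s * Complex.I * z).re + Real.exp (-s * Complex.I * z).re)) := by
  set M := max |z.re| |z.im| with hM
  have h1 : ‖z‖ ≤ 2 * M := (Complex.norm_le_abs_re_add_abs_im z).trans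
    (by linarith [le_max_left |z.re| |z.im|, le_max_right |z.re| |z.im|])
  have h2 : ‖z‖ ≤ 2 * p / s * Real.exp (s * M / p) := by
    refine h1.trans ?_
    have := Real.add_one_le_exp (s * M / p)
    calc 2 * M = 2 * p / s * (s * M / p) := by field_simp
      _ ≤ _ := by gcongr; linarith
  have h3 : Real.exp (s * M) ≤ Real.exp (s * z).re + Real.exp (-s * z).re +
        (Real.exp (s * Complex.I * z).re + Real.exp (-s * Complex.I * z).re) := by
    simp only [Complex.mul_re, Complex.mul_im, Complex.neg_re, Complex.neg_im, Complex.ofReal_re,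
      Complex.ofReal_im, Complex.I_re, Complex.I_im]
    have e1 := Real.exp_abs_le (s * z.re)
    have e2 := Real.exp_abs_le (s * z.im)
    rw [abs_mul, abs_of_pos hs] at e1 e2
    have p1 := Real.exp_pos (s * z.re)
    have p2 := Real.exp_pos (-(s * z.re))
    have p3 := Real.exp_pos (s * z.im)
    have p4 := Real.exp_pos (-(s * z.im))
    ring_nf at *
    rcases max_choice |z.re| |z.im| with h | h <;> rw [hM, h] <;> linarith
  calc ‖z‖ ^ p ≤ (2 * p / s * Real.exp (s * M / p)) ^ p := by gcongr
    _ = (2 * p / s) ^ p * Real.exp (s * M) := by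
      rw [Real.mul_rpow (by positivity) (by positivity), ← Real.exp_mul, div_mul_cancel₀ _ hp.ne']
    _ ≤ _ := by gcongr

theorem integral_norm_sum_mul_fourier_rpow_le {lam : ℕ → ℕ} (hpos : ∀ m, 0 < lam m)
    (hlac : ∀ m, 2 * lam m ≤ lam (m + 1)) (a : ℕ → ℂ) (n : ℕ) {p : ℝ} (hp : 1 ≤ p) :
    ∫ θ : AddCircle (1 : ℝ), ‖∑ i ∈ Finset.range n, a i * fourier (lam i) θ‖ ^ p
      ∂haarAddCircle ≤
      (8 * Real.exp 1 * √p) ^ p * (∑ i ∈ Finset.range n, ‖a i‖ ^ 2) ^ (p / 2) := by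
  have hp0 : 0 < p := by linarith
  set V := ∑ i ∈ Finset.range n, ‖a i‖ ^ 2 with hV
  have hV0 : 0 ≤ V := by positivity
  rcases hV0.eq_or_lt with h0 | hVpos
  · have ha : ∀ i ∈ Finset.range n, a i = 0 := by
      have := (Finset.sum_eq_zero_iff_of_nonneg (fun i _ => by positivity)).1 (hV ▸ h0.symm)
      simpa using this
    have : ∀ θ : AddCircle (1 : ℝ), ∑ i ∈ Finset.range n, a i * fourier (lam i) θ = 0 := fun θ =>
      Finset.sum_eq_zero fun i hi => by rw [ha i hi, zero_mul]
    simp only [this, norm_zero, Real.zero_rpow hp0.ne', integral_zero]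
    positivity
  set s := √(p / V) with hs
  have hs0 : 0 < s := Real.sqrt_pos.2 (by positivity)
  have hs2 : s ^ 2 = p / V := Real.sq_sqrt (by positivity)
  set g := fun θ : AddCircle (1 : ℝ) => ∑ i ∈ Finset.range n, a i * fourier (lam i) θ with hg
  have hgc : Continuous g := continuous_sum_mul_fourier lam a n
  have hic (u : ℂ) : Integrable (fun θ => Real.exp (u * g θ).re) haarAddCircle :=
    (Real.continuous_exp.comp (Complex.continuous_re.comp
      (continuous_const.mul hgc))).integrable_haarAddCircle
  have hexp (u : ℂ) (hu : ‖u‖ = s) :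
      ∫ θ, Real.exp (u * g θ).re ∂haarAddCircle ≤ Real.exp (p / 2) := by
    have h := integral_exp_re_sum_mul_fourier_le hpos hlac (fun i => u * a i) n
    simp only [norm_mul, mul_pow, hu, ← Finset.mul_sum, ← hV, hs2, mul_assoc] at h
    rwa [div_mul_cancel₀ _ hVpos.ne'] at h
  calc
    ∫ θ, ‖g θ‖ ^ p ∂haarAddCircle ≤ ∫ θ, (2 * p / s) ^ p *
      (Real.exp (s * g θ).re + Real.exp (-s * g θ).re +
        (Real.exp (s * Complex.I * g θ).re + Real.exp (-s * Complex.I * g θ).re))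
          ∂haarAddCircle := by
      refine integral_mono ?_ ?_ fun θ => Complex.norm_rpow_le_sum_exp hp0 hs0 (g θ)
      · exact (hgc.norm.rpow_const fun _ => .inr hp0.le).integrable_haarAddCircle
      · exact (((hic _).add (hic _)).add ((hic _).add (hic _))).const_mul _
    _ ≤ (2 * p / s) ^ p * (4 * Real.exp (p / 2)) := by
      rw [integral_const_mul, integral_add
          (f := fun θ => Real.exp (s * g θ).re + Real.exp (-s * g θ).re)
          (g := fun θ => Real.exp (s * Complex.I * g θ).re + Real.exp (-s * Complex.I * g θ).re)
          ((hic _).add (hic _)) ((hic _).add (hic _)),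
        integral_add (hic _) (hic _), integral_add (hic _) (hic _)]
      gcongr
      have n1 : ‖(s : ℂ)‖ = s := by simp [abs_of_pos hs0]
      linarith [hexp s n1, hexp (-s) (by simpa using n1), hexp (s * Complex.I) (by simpa using n1),
        hexp (-s * Complex.I) (by simpa using n1)]
    _ ≤ (2 * p / s) ^ p * (4 ^ p * Real.exp 1 ^ p) := by
      gcongr
      · exact Real.self_le_rpow_of_one_le (by norm_num) hp
      · rw [← Real.exp_mul]
        gcongr
        linarith
    _ = _ := by
      have e : 2 * p / s = 2 * √p * √V := by
        rw [hs, Real.sqrt_div hp0.le, div_div_eq_mul_div]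
        nth_rewrite 1 [← Real.mul_self_sqrt hp0.le]
        have := (Real.sqrt_pos.2 hp0).ne'
        field_simp
      have e2 : V ^ (p / 2) = √V ^ p := by
        rw [Real.sqrt_eq_rpow, ← Real.rpow_mul hV0]
        congr 1
        ring
      rw [e, e2, ← Real.mul_rpow (by positivity) (by positivity),
        ← Real.mul_rpow (by positivity) (by positivity),
        ← Real.mul_rpow (by positivity) (by positivity)]
      congr 1
      ring

theorem lintegral_enorm_sum_mul_fourier_rpow_le {lam : ℕ → ℕ} (hpos : ∀ m, 0 < lam m)
    (hlac : ∀ m, 2 * lam m ≤ lam (m + 1)) (a : ℕ → ℂ) (n : ℕ) {p : ℝ} (hp : 1 ≤ p) :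
    ∫⁻ θ : AddCircle (1 : ℝ), ‖∑ i ∈ Finset.range n, a i * fourier (lam i) θ‖ₑ ^ p
      ∂haarAddCircle ≤
      ENNReal.ofReal (8 * Real.exp 1 * √p) ^ p *
        (∑ i ∈ Finset.range n, ‖a i‖ₑ ^ (2 : ℝ)) ^ (p / 2) := by
  have hp0 : 0 ≤ p := by linarith
  have h := ENNReal.ofReal_le_ofReal (integral_norm_sum_mul_fourier_rpow_le hpos hlac a n hp)
  rw [ofReal_integral_eq_lintegral_ofReal
    (((continuous_sum_mul_fourier lam a n).norm.rpow_const
      fun _ => .inr hp0).integrable_haarAddCircle) (.of_forall fun _ => by positivity),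
    ENNReal.ofReal_mul (by positivity), ← ENNReal.ofReal_rpow_of_nonneg (by positivity) hp0,
    ← ENNReal.ofReal_rpow_of_nonneg (by positivity) (by positivity),
    ENNReal.ofReal_sum_of_nonneg (fun _ _ => by positivity)] at h
  simpa only [← ENNReal.ofReal_rpow_of_nonneg (norm_nonneg _) hp0, ofReal_norm,
    ENNReal.ofReal_pow (norm_nonneg _), ENNReal.rpow_two] using h

theorem eLpNorm_sum_mul_fourier_le {lam : ℕ → ℕ} (hpos : ∀ m, 0 < lam m)
    (hlac : ∀ m, 2 * lam m ≤ lam (m + 1)) (a : ℕ → ℂ) (n : ℕ) {p : ℝ} (hp : 1 ≤ p) :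
    eLpNorm (fun θ : AddCircle (1 : ℝ) => ∑ i ∈ Finset.range n, a i * fourier (lam i) θ)
      (ENNReal.ofReal p) haarAddCircle ≤
      ENNReal.ofReal (8 * Real.exp 1 * √p) *
        (∑ i ∈ Finset.range n, ‖a i‖ₑ ^ (2 : ℝ)) ^ (1 / 2 : ℝ) := by
  have hp0 : 0 < p := by linarith
  rw [eLpNorm_eq_lintegral_rpow_enorm_toReal (by simpa using hp0) ENNReal.ofReal_ne_top,
    ENNReal.toReal_ofReal hp0.le, one_div, ENNReal.rpow_inv_le_iff hp0,
    ENNReal.mul_rpow_of_nonneg _ _ hp0.le, ← ENNReal.rpow_mul, one_div_mul_eq_div]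
  exact lintegral_enorm_sum_mul_fourier_rpow_le hpos hlac a n hp

theorem lintegral_enorm_sum_mul_fourier_sq {lam : ℕ → ℕ} (hmono : StrictMono lam)
    (a : ℕ → ℂ) (n : ℕ) :
    ∫⁻ θ : AddCircle (1 : ℝ), ‖∑ i ∈ Finset.range n, a i * fourier (lam i) θ‖ₑ ^ (2 : ℝ)
      ∂haarAddCircle = ∑ i ∈ Finset.range n, ‖a i‖ₑ ^ (2 : ℝ) := by
  have h : ∫ θ : AddCircle (1 : ℝ), ‖∑ i ∈ Finset.range n, a i * fourier (lam i) θ‖ ^ 2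
      ∂haarAddCircle = ∑ i ∈ Finset.range n, ‖a i‖ ^ 2 := by
    have hexpand (θ : AddCircle (1 : ℝ)) :
        ((‖∑ i ∈ Finset.range n, a i * fourier (lam i) θ‖ ^ 2 : ℝ) : ℂ) =
        ∑ i ∈ Finset.range n, ∑ j ∈ Finset.range n,
          a i * conj (a j) * fourier (lam i + -(lam j : ℤ)) θ := by
      push_cast
      rw [← Complex.mul_conj', map_sum, Finset.sum_mul_sum]
      refine Finset.sum_congr rfl fun i _ => Finset.sum_congr rfl fun j _ => ?_
      rw [fourier_add, fourier_neg, map_mul]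
      ring
    have hi (c : ℂ) (k : ℤ) :
        Integrable (fun θ : AddCircle (1 : ℝ) => c * fourier k θ) haarAddCircle :=
      (continuous_const.mul (map_continuous _)).integrable_haarAddCircle
    have hval (i j : ℕ) : ∫ θ : AddCircle (1 : ℝ),
        a i * conj (a j) * fourier (lam i + -(lam j : ℤ)) θ ∂haarAddCircle =
        if i = j then ((‖a i‖ ^ 2 : ℝ) : ℂ) else 0 := by
      rw [integral_const_mul, integral_fourier_haarAddCircle]
      have hij : (lam i + -(lam j : ℤ) = 0) ↔ i = j := by
        rw [← sub_eq_add_neg, sub_eq_zero, Nat.cast_inj, hmono.injective.eq_iff]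
      simp only [hij]
      split_ifs with h
      · rw [h, mul_one, Complex.mul_conj']
        norm_cast
      · rw [mul_zero]
    apply Complex.ofReal_injective
    rw [← integral_complex_ofReal, integral_congr_ae (.of_forall hexpand),
      integral_finsetSum _ fun i _ => integrable_finsetSum _ fun j _ => hi _ _]
    simp only [integral_finsetSum _ fun j _ => hi _ _, hval]
    rw [Complex.ofReal_sum]
    refine Finset.sum_congr rfl fun i hi => ?_
    rw [Finset.sum_ite_eq, if_pos hi]
  have h' := congrArg ENNReal.ofReal h
  rw [ofReal_integral_eq_lintegral_ofReal
    (f := fun θ => ‖∑ i ∈ Finset.range n, a i * fourier (lam i) θ‖ ^ 2)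
    (((continuous_sum_mul_fourier lam a n).norm.pow 2).integrable_haarAddCircle)
      (.of_forall fun _ => by positivity),
    ENNReal.ofReal_sum_of_nonneg (fun _ _ => by positivity)] at h'
  simpa only [ofReal_norm, ENNReal.ofReal_pow (norm_nonneg _), ENNReal.rpow_two] using h'

/-- The double sum with coefficients `d` and frequencies in `lam1 × lam2`, summed first in the
second variable. -/
noncomputable def doubleTrigSum (lam1 lam2 : ℕ → ℕ) (d : ℕ → ℕ → ℂ) (n : ℕ)
    (z : AddCircle (1 : ℝ) × AddCircle (1 : ℝ)) : ℂ :=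
  ∑ i ∈ Finset.range n,
    (∑ j ∈ Finset.range n, d i j * fourier (lam2 j) z.2) * fourier (lam1 i) z.1

theorem continuous_doubleTrigSum (lam1 lam2 : ℕ → ℕ) (d : ℕ → ℕ → ℂ) (n : ℕ) :
    Continuous (doubleTrigSum lam1 lam2 d n) :=
  continuous_finsetSum _ fun i _ =>
    ((continuous_sum_mul_fourier lam2 (d i) n).comp continuous_snd).mul
      ((map_continuous _).comp continuous_fst)

theorem lintegral_enorm_doubleTrigSum_rpow (lam1 lam2 : ℕ → ℕ) (d : ℕ → ℕ → ℂ) (n : ℕ) (p : ℝ) :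
    ∫⁻ z, ‖doubleTrigSum lam1 lam2 d n z‖ₑ ^ p ∂haarT2 =
      ∫⁻ y, ∫⁻ x, ‖doubleTrigSum lam1 lam2 d n (x, y)‖ₑ ^ p ∂haarAddCircle ∂haarAddCircle :=
  lintegral_prod_symm _
    ((continuous_doubleTrigSum lam1 lam2 d n).measurable.enorm.pow_const p).aemeasurable

theorem eLpNorm_two_doubleTrigSum {lam1 lam2 : ℕ → ℕ} (hmono1 : StrictMono lam1)
    (hmono2 : StrictMono lam2) (d : ℕ → ℕ → ℂ) (n : ℕ) :
    eLpNorm (doubleTrigSum lam1 lam2 d n) 2 haarT2 =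
      (∑ i ∈ Finset.range n, ∑ j ∈ Finset.range n, ‖d i j‖ₑ ^ (2 : ℝ)) ^ (1 / 2 : ℝ) := by
  rw [eLpNorm_eq_lintegral_rpow_enorm_toReal two_ne_zero ENNReal.ofNat_ne_top,
    ENNReal.toReal_ofNat, lintegral_enorm_doubleTrigSum_rpow]
  simp only [doubleTrigSum, lintegral_enorm_sum_mul_fourier_sq hmono1]
  rw [lintegral_finsetSum]
  · simp only [lintegral_enorm_sum_mul_fourier_sq hmono2]
  · exact fun i _ => (continuous_sum_mul_fourier lam2 (d i) n).measurable.enorm.pow_const _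

theorem eLpNorm_doubleTrigSum_le {lam1 lam2 : ℕ → ℕ}
    (hpos1 : ∀ m, 0 < lam1 m) (hpos2 : ∀ m, 0 < lam2 m)
    (hlac1 : ∀ m, 2 * lam1 m ≤ lam1 (m + 1)) (hlac2 : ∀ m, 2 * lam2 m ≤ lam2 (m + 1))
    (d : ℕ → ℕ → ℂ) (n : ℕ) {p : ℝ} (hp : 2 ≤ p) :
    eLpNorm (doubleTrigSum lam1 lam2 d n) (ENNReal.ofReal p) haarT2 ≤
      ENNReal.ofReal ((8 * Real.exp 1) ^ 2 * p) *
        (∑ i ∈ Finset.range n, ∑ j ∈ Finset.range n, ‖d i j‖ₑ ^ (2 : ℝ)) ^ (1 / 2 : ℝ) := by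
  have hp0 : 0 < p := by linarith
  have hp1 : 1 ≤ p := by linarith
  set A := ENNReal.ofReal (8 * Real.exp 1 * √p) with hA
  have hA2 : ENNReal.ofReal ((8 * Real.exp 1) ^ 2 * p) = A * A := by
    rw [hA, ← ENNReal.ofReal_mul (by positivity)]
    congr 1
    linear_combination (-(8 * Real.exp 1) ^ 2) * Real.mul_self_sqrt hp0.le
  set S := ∑ i ∈ Finset.range n, ∑ j ∈ Finset.range n, ‖d i j‖ₑ ^ (2 : ℝ) with hS
  let g (i : ℕ) (y : AddCircle (1 : ℝ)) : ℂ := ∑ j ∈ Finset.range n, d i j * fourier (lam2 j) y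
  have hgm (i : ℕ) : Measurable (g i) := (continuous_sum_mul_fourier lam2 (d i) n).measurable
  have hg (i : ℕ) : eLpNorm (fun y => ‖g i y‖ₑ ^ (2 : ℝ)) (ENNReal.ofReal (p / 2)) haarAddCircle ≤
      A ^ (2 : ℝ) * ∑ j ∈ Finset.range n, ‖d i j‖ₑ ^ (2 : ℝ) := by
    rw [eLpNorm_enorm_rpow _ two_pos, ← ENNReal.ofReal_mul (by positivity),
      div_mul_cancel₀ _ two_ne_zero]
    refine (ENNReal.rpow_le_rpow (eLpNorm_sum_mul_fourier_le hpos2 hlac2 (d i) n hp1)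
      zero_le_two).trans_eq ?_
    rw [ENNReal.mul_rpow_of_nonneg _ _ zero_le_two, ← ENNReal.rpow_mul,
      one_div_mul_cancel two_ne_zero, ENNReal.rpow_one]
  have hsum : ∫⁻ y, (∑ i ∈ Finset.range n, ‖g i y‖ₑ ^ (2 : ℝ)) ^ (p / 2) ∂haarAddCircle ≤
      (A ^ (2 : ℝ) * S) ^ (p / 2) := by
    have h := (eLpNorm_sum_le (μ := haarAddCircle) (s := Finset.range n)
      (f := fun i y => ‖g i y‖ₑ ^ (2 : ℝ)) (p := ENNReal.ofReal (p / 2))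
      (fun i _ => ((hgm i).enorm.pow_const _).aestronglyMeasurable)
      (by rw [ENNReal.one_le_ofReal]; linarith)).trans (Finset.sum_le_sum fun i _ => hg i)
    rw [← Finset.mul_sum, ← hS,
      eLpNorm_eq_lintegral_rpow_enorm_toReal (by simpa using hp0) ENNReal.ofReal_ne_top,
      ENNReal.toReal_ofReal (by positivity), one_div, ENNReal.rpow_inv_le_iff (by positivity)] at h
    simpa only [Finset.sum_apply, enorm_eq_self] using h
  rw [eLpNorm_eq_lintegral_rpow_enorm_toReal (by simpa using hp0) ENNReal.ofReal_ne_top,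
    ENNReal.toReal_ofReal hp0.le, one_div, ENNReal.rpow_inv_le_iff hp0,
    lintegral_enorm_doubleTrigSum_rpow]
  calc
    _ ≤ ∫⁻ y, A ^ p * (∑ i ∈ Finset.range n, ‖g i y‖ₑ ^ (2 : ℝ)) ^ (p / 2) ∂haarAddCircle :=
      lintegral_mono fun y =>
        lintegral_enorm_sum_mul_fourier_rpow_le hpos1 hlac1 (fun i => g i y) n hp1
    _ ≤ A ^ p * (A ^ (2 : ℝ) * S) ^ (p / 2) := by
      rw [lintegral_const_mul]
      · gcongr
      · exact (Finset.measurable_fun_sum _ fun i _ => (hgm i).enorm.pow_const _).pow_const _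
    _ = _ := by
      rw [hA2, ENNReal.mul_rpow_of_nonneg _ _ hp0.le, ENNReal.mul_rpow_of_nonneg _ _ hp0.le,
        ENNReal.mul_rpow_of_nonneg _ _ (by positivity), ← ENNReal.rpow_mul, ← ENNReal.rpow_mul,
        mul_div_cancel₀ _ two_ne_zero, one_div_mul_eq_div, mul_assoc]

theorem exists_eq_doubleTrigSum {lam1 lam2 : ℕ → ℕ} (hmono1 : StrictMono lam1)
    (hmono2 : StrictMono lam2) (F : Finset (ℤ × ℤ)) (c : ℤ × ℤ → ℂ)
    (hF : ∀ q ∈ F, (∃ i, (lam1 i : ℤ) = q.1) ∧ (∃ i, (lam2 i : ℤ) = q.2)) :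
    ∃ (d : ℕ → ℕ → ℂ) (n : ℕ),
      (fun θ => ∑ q ∈ F, c q * (fourier q.1 θ.1 * fourier q.2 θ.2)) =
        doubleTrigSum lam1 lam2 d n := by
  classical
  let e : ℕ × ℕ → ℤ × ℤ := Prod.map (fun i => (lam1 i : ℤ)) (fun j => (lam2 j : ℤ))
  have he : Function.Injective e :=
    (Nat.cast_injective.comp hmono1.injective).prodMap (Nat.cast_injective.comp hmono2.injective)
  let G := F.preimage e he.injOn
  obtain ⟨n, hn⟩ : ∃ n, G ⊆ Finset.range n ×ˢ Finset.range n := by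
    refine ⟨G.sup (fun q => max q.1 q.2) + 1, fun q hq => ?_⟩
    have := Finset.le_sup (f := fun q : ℕ × ℕ => max q.1 q.2) hq
    simp only [Finset.mem_product, Finset.mem_range]
    omega
  refine ⟨fun i j => if (i, j) ∈ G then c (e (i, j)) else 0, n, funext fun θ => ?_⟩
  have h1 : ∑ q ∈ F, c q * (fourier q.1 θ.1 * fourier q.2 θ.2) =
      ∑ q ∈ G, c (e q) * (fourier (e q).1 θ.1 * fourier (e q).2 θ.2) := by
    refine (Finset.sum_preimage e F he.injOn _ fun q hq hq' => (hq' ?_).elim).symm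
    obtain ⟨⟨i, hi⟩, j, hj⟩ := hF q hq
    exact ⟨(i, j), Prod.ext hi hj⟩
  rw [h1, Finset.sum_subset_zero_on_sdiff hn
    (f := fun q => c (e q) * (fourier (e q).1 θ.1 * fourier (e q).2 θ.2))
    (g := fun q => (if q ∈ G then c (e q) else 0) * (fourier (e q).1 θ.1 * fourier (e q).2 θ.2))
    (fun q hq => by rw [if_neg (Finset.mem_sdiff.1 hq).2, zero_mul])
    (fun q hq => by rw [if_pos hq]), Finset.sum_product]
  refine Finset.sum_congr rfl fun i _ => ?_
  rw [Finset.sum_mul]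
  refine Finset.sum_congr rfl fun j _ => ?_
  simp only [e, Prod.map_apply]
  ring

/-- **Two-dimensional Zygmund inequality in `Λ(p)` form.** If `Λ₁, Λ₂` are lacunary sequences
of positive integers with ratio at least `2`, then every trigonometric polynomial on `𝕋²` with
Fourier coefficients supported in `Λ₁ × Λ₂` satisfies `‖f‖_p ≤ C p ‖f‖₂` for all `p > 2`. -/
theorem lambda_p_bound_for_product_of_two_lacunary
    (lam1 lam2 : ℕ → ℕ)
    (hpos1 : ∀ m, 0 < lam1 m) (hpos2 : ∀ m, 0 < lam2 m)
    (hmono1 : StrictMono lam1) (hmono2 : StrictMono lam2)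
    (hlac1 : ∀ m, 2 * lam1 m ≤ lam1 (m + 1)) (hlac2 : ∀ m, 2 * lam2 m ≤ lam2 (m + 1)) :
    ∃ C : ℝ, 0 < C ∧
      ∀ p : ℝ, 2 < p →
        ∀ f : AddCircle (1 : ℝ) × AddCircle (1 : ℝ) → ℂ,
          (∃ (F : Finset (ℤ × ℤ)) (c : ℤ × ℤ → ℂ),
            (∀ q ∈ F, (∃ i, (lam1 i : ℤ) = q.1) ∧ (∃ i, (lam2 i : ℤ) = q.2)) ∧
            f = fun θ => ∑ q ∈ F, c q * (fourier q.1 θ.1 * fourier q.2 θ.2)) →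
          eLpNorm f (ENNReal.ofReal p) haarT2 ≤ ENNReal.ofReal (C * p) * eLpNorm f 2 haarT2 := by
  refine ⟨(8 * Real.exp 1) ^ 2, by positivity, ?_⟩
  rintro p hp f ⟨F, c, hF, rfl⟩
  obtain ⟨d, n, h⟩ := exists_eq_doubleTrigSum hmono1 hmono2 F c hF
  rw [h, eLpNorm_two_doubleTrigSum hmono1 hmono2]
  exact eLpNorm_doubleTrigSum_le hpos1 hpos2 hlac1 hlac2 d n hp.le
end

section
/- Let n ≥ 1 and for j = 1, …, n let Λ_j = (λ_{j,m})_{m∈ℕ} be a strictly increasing sequence of positive integers with λ_{j,m+1} ≥ 2 λ_{j,m} for all m. Then there exist positive constants A and B, depending only on Λ₁, …, Λₙ and n, such that for every integrable function f : 𝕋ⁿ → ℂ, ( ∑_{(m₁,…,mₙ) ∈ Λ₁ × ⋯ × Λₙ} |f̂(m₁,…,mₙ)|² )^{1/2} ≤ A ∫_{𝕋ⁿ} |f(θ)| log^{n/2}(1 + |f(θ)|) dθ + B. -/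
open MeasureTheory ENNReal NNReal

open Finset Polynomial in
/-- For a lacunary sequence `l` of ratio at least `2`, the coefficients of `(∑_{i < M} X ^ l i) ^ k`
are at most `k! 4 ^ k`, with additional decay in the degree. -/
lemma coeff_lacunary_pow_le (l : ℕ → ℕ) (hpos : ∀ m, 0 < l m)
    (hl : ∀ m, 2 * l m ≤ l (m + 1)) (M k N : ℕ) :
    ((∑ i ∈ range M, (X : ℕ[X]) ^ l i) ^ k).coeff N ≤ k.factorial * 4 ^ k ∧
      2 * (((∑ i ∈ range M, (X : ℕ[X]) ^ l i) ^ k).coeff N * N) ≤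
        k.factorial * 4 ^ k * l M := by
  induction M generalizing k N with
  | zero =>
    rcases k with _ | k
    · rcases N with _ | N <;> simp [coeff_one]
    · simp
  | succ M ih =>
    set Q : ℕ[X] := ∑ i ∈ range M, X ^ l i with hQ
    set D : ℕ → ℕ := fun k => k.factorial * 4 ^ k with hD
    have expand : ((∑ i ∈ range (M + 1), (X : ℕ[X]) ^ l i) ^ k).coeff N =
        ∑ m ∈ range (k + 1), k.choose m *
          (if m * l M ≤ N then (Q ^ (k - m)).coeff (N - m * l M) else 0) := by
      rw [sum_range_succ, ← hQ, add_comm, add_pow, finsetSum_coeff]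
      refine sum_congr rfl fun m _ => ?_
      rw [← pow_mul, mul_comm (l M) m, ← C_eq_natCast, coeff_mul_C, coeff_X_pow_mul', mul_comm]
      simp
    have fact : ∀ m ∈ range (k + 1), k.choose m * (D (k - m) * (1 + 2 * m)) ≤
        k.factorial * (4 ^ (k - m) * if m = 0 then 1 else 3) := by
      intro m hm
      have hmk : m ≤ k := Nat.lt_succ_iff.1 (mem_range.1 hm)
      have h1 : 1 + 2 * m ≤ m.factorial * if m = 0 then 1 else 3 := by
        rcases m with _ | m
        · simp
        · have := Nat.self_le_factorial (m + 1)
          simp only [Nat.add_eq_zero_iff, one_ne_zero, and_false, if_false]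
          omega
      calc k.choose m * (D (k - m) * (1 + 2 * m))
          ≤ k.choose m * (D (k - m) * (m.factorial * if m = 0 then 1 else 3)) := by gcongr
        _ = (k.choose m * m.factorial * (k - m).factorial) *
              (4 ^ (k - m) * if m = 0 then 1 else 3) := by simp only [hD]; ring
        _ = _ := by rw [Nat.choose_mul_factorial_mul_factorial hmk]
    have geom : ∑ m ∈ range (k + 1), 4 ^ (k - m) * (if m = 0 then 1 else 3) ≤ 2 * 4 ^ k := by
      rw [sum_range_succ']
      have : ∑ m ∈ range k, 4 ^ (k - (m + 1)) * 3 + 1 = 4 ^ k := by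
        rw [← sum_mul]
        have h3 : ∑ m ∈ range k, 4 ^ (k - (m + 1)) = ∑ i ∈ range k, 4 ^ i :=
          (sum_congr rfl fun i _ => by congr 1; omega).trans (sum_range_reflect (fun i => 4 ^ i) k)
        rw [h3]
        exact geom_sum_mul_add 3 k
      simp only [Nat.add_eq_zero_iff, one_ne_zero, and_false, if_false, if_true, Nat.sub_zero]
      omega
    have key : ((∑ i ∈ range (M + 1), (X : ℕ[X]) ^ l i) ^ k).coeff N * N ≤ D k * l M := by
      suffices 2 * (((∑ i ∈ range (M + 1), (X : ℕ[X]) ^ l i) ^ k).coeff N * N) ≤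
        2 * (D k * l M) by omega
      calc 2 * (((∑ i ∈ range (M + 1), (X : ℕ[X]) ^ l i) ^ k).coeff N * N)
          = ∑ m ∈ range (k + 1), k.choose m *
            (2 * ((if m * l M ≤ N then (Q ^ (k - m)).coeff (N - m * l M) else 0) * N)) := by
            rw [expand, sum_mul, mul_sum]
            exact sum_congr rfl fun m _ => by ring
        _ ≤ ∑ m ∈ range (k + 1), k.choose m * (D (k - m) * (1 + 2 * m) * l M) := by
            refine sum_le_sum fun m _ => Nat.mul_le_mul_left _ ?_
            split_ifs with h
            · obtain ⟨ih1, ih2⟩ := ih (k - m) (N - m * l M)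
              obtain ⟨u, rfl⟩ := Nat.exists_eq_add_of_le h
              rw [Nat.add_sub_cancel_left] at *
              have := Nat.mul_le_mul_right (2 * (m * l M)) ih1
              simp only [hD]
              nlinarith
            · simp
        _ = (∑ m ∈ range (k + 1), k.choose m * (D (k - m) * (1 + 2 * m))) * l M := by
            rw [sum_mul]
            exact sum_congr rfl fun m _ => by ring
        _ ≤ (∑ m ∈ range (k + 1), k.factorial * (4 ^ (k - m) * if m = 0 then 1 else 3)) * l M := by
            exact Nat.mul_le_mul_right _ (sum_le_sum fact)
        _ ≤ k.factorial * (2 * 4 ^ k) * l M := by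
            rw [← mul_sum]
            gcongr
        _ = 2 * (D k * l M) := by simp only [hD]; ring
    refine ⟨?_, ?_⟩
    · rcases le_or_gt (l M) N with h | h
      · exact Nat.le_of_mul_le_mul_right (key.trans (Nat.mul_le_mul_left _ h))
          ((hpos M).trans_le h)
      · rw [expand, sum_range_succ', sum_eq_zero]
        · simpa using (ih k N).1
        · intro m _
          rw [if_neg, mul_zero]
          nlinarith
    · have := Nat.mul_le_mul_left (D k) (hl M)
      simp only [hD] at this key ⊢
      linarith

open Finset Polynomial in
/-- The number of representations of an integer as an ordered sum of `k` terms of a lacunary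
sequence is at most `k! 4 ^ k`. -/
lemma card_lacunary_sum_le (l : ℕ → ℕ) (hpos : ∀ m, 0 < l m) (hl : ∀ m, 2 * l m ≤ l (m + 1))
    (M k : ℕ) (N : ℤ) :
    #{t : Fin k → Fin M | ∑ i, (l (t i) : ℤ) = N} ≤ k.factorial * 4 ^ k := by
  rcases lt_or_ge N 0 with hN | hN
  · rw [filter_eq_empty_iff.2]
    · simp
    · intro t _ h
      have : 0 ≤ ∑ i, (l (t i) : ℤ) := sum_nonneg fun i _ => by positivity
      omega
  · lift N to ℕ using hN
    refine le_trans (le_of_eq ?_) (coeff_lacunary_pow_le l hpos hl M k N).1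
    rw [← Fin.sum_univ_eq_sum_range (fun i => (X : ℕ[X]) ^ l i), Fintype.sum_pow, finsetSum_coeff,
      card_filter]
    refine sum_congr rfl fun t _ => ?_
    rw [prod_pow_eq_pow_sum, coeff_X_pow]
    norm_cast
    simp only [eq_comm]

open Finset in
/-- The multidimensional analogue of `card_lacunary_sum_le`, for a product of lacunary
sequences. -/
lemma card_pi_lacunary_sum_le {n : ℕ} (lam : Fin n → ℕ → ℕ) (hpos : ∀ j m, 0 < lam j m)
    (hlac : ∀ j m, 2 * lam j m ≤ lam j (m + 1)) (M k : ℕ) (N : Fin n → ℤ) :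
    #{q : Fin k → Fin n → Fin M | ∑ i, (fun j => -(lam j (q i j) : ℤ)) = N} ≤
      (k.factorial * 4 ^ k) ^ n := by
  calc #{q : Fin k → Fin n → Fin M | ∑ i, (fun j => -(lam j (q i j) : ℤ)) = N}
      ≤ #(Fintype.piFinset fun j : Fin n =>
          ({t : Fin k → Fin M | ∑ i, (lam j (t i) : ℤ) = -N j} : Finset (Fin k → Fin M))) := by
        refine card_le_card_of_injOn (fun q j i => q i j) (fun q hq => ?_) fun p _ q _ h => ?_
        · simp only [coe_filter, mem_univ, true_and, Set.mem_ofPred_eq] at hq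
          simp only [Fintype.coe_piFinset, Set.mem_pi, coe_filter, mem_univ, true_and,
            Set.mem_ofPred_eq, ← hq]
          intro j _
          simp
        · ext i j
          exact congrArg Fin.val (congrFun (congrFun h j) i)
    _ = ∏ j, #{t : Fin k → Fin M | ∑ i, (lam j (t i) : ℤ) = -N j} := Fintype.card_piFinset _
    _ ≤ ∏ _j : Fin n, (k.factorial * 4 ^ k) := by
        gcongr with j
        exact card_lacunary_sum_le (lam j) (hpos j) (hlac j) M k _
    _ = _ := by simp

/-- The character of the torus `𝕋ⁿ` of frequency `m`. -/
noncomputable def piFourier {n : ℕ} (m : Fin n → ℤ) (θ : Fin n → AddCircle (1 : ℝ)) : ℂ :=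
  ∏ j, fourier (m j) (θ j)

/-- The normalized Haar measure on the torus `𝕋ⁿ`. -/
noncomputable abbrev piHaar (n : ℕ) : Measure (Fin n → AddCircle (1 : ℝ)) :=
  Measure.pi fun _ : Fin n => AddCircle.haarAddCircle

namespace piFourier

variable {n : ℕ}

@[fun_prop]
lemma continuous (m : Fin n → ℤ) : Continuous (piFourier m) := by
  unfold piFourier
  fun_prop

lemma norm_eq_one (m : Fin n → ℤ) (θ : Fin n → AddCircle (1 : ℝ)) : ‖piFourier m θ‖ = 1 := by
  rw [piFourier, norm_prod]
  exact Finset.prod_eq_one fun j _ => Circle.norm_coe _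

lemma zero (θ : Fin n → AddCircle (1 : ℝ)) : piFourier 0 θ = 1 := by
  simp [piFourier]

lemma add (m m' : Fin n → ℤ) (θ : Fin n → AddCircle (1 : ℝ)) :
    piFourier (m + m') θ = piFourier m θ * piFourier m' θ := by
  simp only [piFourier, Pi.add_apply, fourier_add, Finset.prod_mul_distrib]

lemma conj (m : Fin n → ℤ) (θ : Fin n → AddCircle (1 : ℝ)) :
    starRingEnd ℂ (piFourier m θ) = piFourier (-m) θ := by
  simp only [piFourier, Pi.neg_apply, fourier_neg, map_prod]

lemma sum {ι : Type*} (s : Finset ι) (m : ι → Fin n → ℤ) (θ : Fin n → AddCircle (1 : ℝ)) :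
    piFourier (∑ i ∈ s, m i) θ = ∏ i ∈ s, piFourier (m i) θ := by
  classical
  induction s using Finset.induction_on with
  | empty => simp [zero]
  | insert a s ha ih => rw [Finset.sum_insert ha, Finset.prod_insert ha, add, ih]

lemma integral (m : Fin n → ℤ) :
    ∫ θ, piFourier m θ ∂(piHaar n) = if m = 0 then 1 else 0 := by
  split_ifs with h
  · simp [h, zero]
  · obtain ⟨j, hj⟩ := Function.ne_iff.1 h
    unfold piFourier
    rw [integral_fintype_prod_eq_prod (fun j => fun x => (fourier (m j) x : ℂ))]
    exact Finset.prod_eq_zero (Finset.mem_univ j) (integral_eq_zero_of_add_right_eq_neg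
      (fourier_add_half_inv_index hj one_pos))

end piFourier

/-- A continuous function on the torus is integrable. -/
lemma Continuous.integrable_piHaar {n : ℕ} {E : Type*} [NormedAddCommGroup E]
    {g : (Fin n → AddCircle (1 : ℝ)) → E} (hg : Continuous g) : Integrable g (piHaar n) :=
  hg.integrable_of_hasCompactSupport (HasCompactSupport.of_compactSpace g)

open Finset in
lemma integral_norm_sq_trigPoly_le {n : ℕ} {κ : Type*} [Fintype κ] (A : κ → ℂ) (σ : κ → Fin n → ℤ)
    (R : ℕ) (hR : ∀ N, #{q : κ | σ q = N} ≤ R) :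
    ∫ θ, ‖∑ q, A q * piFourier (σ q) θ‖ ^ 2 ∂(piHaar n) ≤ R * ∑ q, ‖A q‖ ^ 2 := by
  have expand : ∀ θ, ((‖∑ q, A q * piFourier (σ q) θ‖ ^ 2 : ℝ) : ℂ) =
      ∑ p, ∑ q, A p * starRingEnd ℂ (A q) * piFourier (σ p - σ q) θ := by
    intro θ
    rw [Complex.ofReal_pow, ← Complex.mul_conj', map_sum, sum_mul_sum]
    refine sum_congr rfl fun p _ => sum_congr rfl fun q _ => ?_
    rw [map_mul, piFourier.conj, sub_eq_add_neg, piFourier.add]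
    ring
  have int_eq : ((∫ θ, ‖∑ q, A q * piFourier (σ q) θ‖ ^ 2 ∂(piHaar n) : ℝ) : ℂ) =
      ∑ p, ∑ q, A p * starRingEnd ℂ (A q) * if σ p = σ q then 1 else 0 := by
    rw [← integral_complex_ofReal]
    simp_rw [expand]
    rw [integral_finsetSum _ fun p _ => Continuous.integrable_piHaar (by fun_prop)]
    refine sum_congr rfl fun p _ => ?_
    rw [integral_finsetSum _ fun q _ => Continuous.integrable_piHaar (by fun_prop)]
    refine sum_congr rfl fun q _ => ?_
    rw [integral_const_mul, piFourier.integral]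
    simp only [sub_eq_zero]
  have half : ∑ p, ∑ q, (‖A p‖ ^ 2 / 2) * (if σ q = σ p then 1 else 0) ≤
      R * (∑ q, ‖A q‖ ^ 2) / 2 := by
    rw [mul_sum, sum_div]
    refine sum_le_sum fun p _ => ?_
    rw [← mul_sum, sum_boole]
    have : ((#{q : κ | σ q = σ p} : ℕ) : ℝ) ≤ R := by exact_mod_cast hR (σ p)
    nlinarith [sq_nonneg ‖A p‖]
  calc ∫ θ, ‖∑ q, A q * piFourier (σ q) θ‖ ^ 2 ∂(piHaar n)
      ≤ ‖((∫ θ, ‖∑ q, A q * piFourier (σ q) θ‖ ^ 2 ∂(piHaar n) : ℝ) : ℂ)‖ := by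
        rw [Complex.norm_real]
        exact le_abs_self _
    _ ≤ ∑ p, ∑ q, ‖A p‖ * ‖A q‖ * if σ p = σ q then 1 else 0 := by
        rw [int_eq]
        refine (norm_sum_le _ _).trans (sum_le_sum fun p _ => (norm_sum_le _ _).trans
          (sum_le_sum fun q _ => ?_))
        split_ifs <;> simp
    _ ≤ ∑ p, ∑ q, ((‖A p‖ ^ 2 / 2) * (if σ q = σ p then 1 else 0) +
          (‖A q‖ ^ 2 / 2) * (if σ p = σ q then 1 else 0)) := by
        refine sum_le_sum fun p _ => sum_le_sum fun q _ => ?_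
        by_cases h : σ p = σ q
        · simp only [h, if_true]
          nlinarith [sq_nonneg (‖A p‖ - ‖A q‖)]
        · simp [h, Ne.symm h]
    _ ≤ R * (∑ q, ‖A q‖ ^ 2) / 2 + R * (∑ q, ‖A q‖ ^ 2) / 2 := by
        simp only [sum_add_distrib]
        refine add_le_add half ?_
        rw [sum_comm]
        exact half
    _ = _ := by ring

open Finset in
lemma integral_norm_pow_trigPoly_le {n : ℕ} {ι : Type*} [Fintype ι] (a : ι → ℂ)
    (μ : ι → Fin n → ℤ) (k R : ℕ) (hR : ∀ N, #{q : Fin k → ι | ∑ i, μ (q i) = N} ≤ R) :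
    ∫ θ, ‖∑ i, a i * piFourier (μ i) θ‖ ^ (2 * k) ∂(piHaar n) ≤ R * (∑ i, ‖a i‖ ^ 2) ^ k := by
  have expand : ∀ θ, ‖∑ i, a i * piFourier (μ i) θ‖ ^ (2 * k) =
      ‖∑ q : Fin k → ι, (∏ i, a (q i)) * piFourier (∑ i, μ (q i)) θ‖ ^ 2 := fun θ => by
    simp only [mul_comm 2 k, pow_mul, ← norm_pow, Fintype.sum_pow, piFourier.sum, prod_mul_distrib]
  simp only [expand, Fintype.sum_pow, prod_pow, ← norm_prod]
  exact integral_norm_sq_trigPoly_le _ _ R hR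

/-- If all moments of even order `2 k` of `g` are at most `(k! 4 ^ k) ^ n`, then `|g| ^ (2 / n)` is
exponentially integrable. -/
lemma lintegral_exp_le_two {n : ℕ} (hn : 1 ≤ n) (g : (Fin n → AddCircle (1 : ℝ)) → ℂ)
    (hg : Continuous g)
    (hmom : ∀ k : ℕ, ∫ θ, ‖g θ‖ ^ (2 * k) ∂(piHaar n) ≤ ((k.factorial * 4 ^ k : ℕ) : ℝ) ^ n) :
    ∫⁻ θ, ENNReal.ofReal (Real.exp (‖g θ‖ ^ (2 / (n : ℝ)) / 8)) ∂(piHaar n) ≤ 2 := by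
  have hn0 : (n : ℝ) ≠ 0 := by positivity
  set h : (Fin n → AddCircle (1 : ℝ)) → ℝ := fun θ => ‖g θ‖ ^ (2 / (n : ℝ)) with hh
  have h_nonneg : ∀ θ, 0 ≤ h θ := fun θ => by positivity
  have h_cont : Continuous h := hg.norm.rpow_const fun _ => Or.inr (by positivity)
  have moment : ∀ k : ℕ, ∫ θ, h θ ^ k ∂(piHaar n) ≤ k.factorial * 4 ^ k := by
    intro k
    have jensen := (convexOn_pow n).map_integral_le (μ := piHaar n) (f := fun θ => h θ ^ k)
      (by fun_prop) isClosed_Ici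
      (Filter.Eventually.of_forall fun θ => Set.mem_Ici.2 (pow_nonneg (h_nonneg θ) k))
      (Continuous.integrable_piHaar (by fun_prop)) (Continuous.integrable_piHaar (by fun_prop))
    have h_pow : ∀ θ, (h θ ^ k) ^ n = ‖g θ‖ ^ (2 * k) := by
      intro θ
      rw [← pow_mul, hh, ← Real.rpow_natCast, ← Real.rpow_natCast, ← Real.rpow_mul (norm_nonneg _)]
      congr 1
      push_cast
      field_simp
    simp only [h_pow] at jensen
    have := jensen.trans (hmom k)
    rw [pow_le_pow_iff_left₀ (integral_nonneg fun θ => pow_nonneg (h_nonneg θ) k)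
      (by positivity) (by omega)] at this
    exact_mod_cast this
  have series : ∀ θ, ENNReal.ofReal (Real.exp (h θ / 8)) =
      ∑' k : ℕ, ENNReal.ofReal ((h θ / 8) ^ k / k.factorial) := by
    intro θ
    have hs := NormedSpace.expSeries_div_hasSum_exp (h θ / 8)
    rw [← ENNReal.ofReal_tsum_of_nonneg (fun k => by have := h_nonneg θ; positivity) hs.summable,
      hs.tsum_eq, Real.exp_eq_exp_ℝ]
  change ∫⁻ θ, ENNReal.ofReal (Real.exp (h θ / 8)) ∂(piHaar n) ≤ 2
  simp_rw [series]
  rw [lintegral_tsum fun k => by fun_prop]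
  calc ∑' k : ℕ, ∫⁻ θ, ENNReal.ofReal ((h θ / 8) ^ k / k.factorial) ∂(piHaar n)
      ≤ ∑' k : ℕ, ENNReal.ofReal ((1 / 2) ^ k) := by
        refine ENNReal.tsum_le_tsum fun k => ?_
        rw [← ofReal_integral_eq_lintegral_ofReal (Continuous.integrable_piHaar (by fun_prop))
          (Filter.Eventually.of_forall fun θ => by have := h_nonneg θ; positivity)]
        refine ENNReal.ofReal_le_ofReal ?_
        rw [integral_div, div_le_iff₀ (by positivity)]
        simp_rw [div_pow]
        rw [integral_div, div_le_iff₀ (by positivity)]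
        refine (moment k).trans (le_of_eq ?_)
        rw [show (8 : ℝ) = 2 * 4 by norm_num, mul_pow, one_pow]
        field_simp
    _ = 2 := by
        rw [← ENNReal.ofReal_tsum_of_nonneg (fun k => by positivity) summable_geometric_two,
          tsum_geometric_two]
        simp

/-- A Young-type inequality between `s log^{n/2} (1 + s)` and `exp (t ^ (2 / n) / 8)`. -/
lemma mul_le_mul_log_add_exp {n : ℕ} (hn : 1 ≤ n) {s t : ℝ} (hs : 0 ≤ s) (ht : 0 ≤ t) :
    s * t ≤ 4 ^ n * (s * Real.log (1 + s) ^ ((n : ℝ) / 2)) +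
      (16 ^ n * n.factorial + 1) * Real.exp (t ^ (2 / (n : ℝ)) / 8) := by
  have hn0 : (n : ℝ) ≠ 0 := by positivity
  set u := t ^ (2 / (n : ℝ)) with hu
  have hu0 : 0 ≤ u := by positivity
  have htu : t = u ^ ((n : ℝ) / 2) := by
    rw [hu, ← Real.rpow_mul ht, div_mul_div_cancel₀ hn0]
    simp
  have hlog : 0 ≤ Real.log (1 + s) := Real.log_nonneg (by linarith)
  rcases le_or_gt u (16 * Real.log (1 + s)) with h | h
  · have : t ≤ 4 ^ n * Real.log (1 + s) ^ ((n : ℝ) / 2) := by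
      calc t ≤ (16 * Real.log (1 + s)) ^ ((n : ℝ) / 2) := by
            rw [htu]
            gcongr
        _ = _ := by
            rw [Real.mul_rpow (by norm_num) hlog, show (16 : ℝ) = 4 ^ (2 : ℝ) by norm_num,
              ← Real.rpow_mul (by norm_num), mul_div_cancel₀ _ two_ne_zero, Real.rpow_natCast]
    have h1 := mul_le_mul_of_nonneg_left this hs
    have h2 : 0 ≤ (16 ^ n * n.factorial + 1) * Real.exp (u / 8) := by positivity
    linarith
  · have hs' : s ≤ Real.exp (u / 16) := by
      have : 1 + s ≤ Real.exp (u / 16) := by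
        rw [← Real.log_le_iff_le_exp (by linarith)]
        linarith
      linarith
    have ht' : t ≤ (16 ^ n * n.factorial + 1) * Real.exp (u / 16) := by
      have h1 : u ^ ((n : ℝ) / 2) ≤ u ^ n + 1 := by
        rcases le_or_gt u 1 with hu1 | hu1
        · have := Real.rpow_le_one hu0 hu1 (by positivity : 0 ≤ (n : ℝ) / 2)
          have : 0 ≤ u ^ n := by positivity
          linarith
        · have := Real.rpow_le_rpow_of_exponent_le hu1.le
            (by linarith [Nat.cast_nonneg (α := ℝ) n] : (n : ℝ) / 2 ≤ n)
          rw [Real.rpow_natCast] at this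
          linarith
      have h2 := Real.pow_div_factorial_le_exp (u / 16) (by positivity) n
      rw [div_pow, div_div, div_le_iff₀ (by positivity)] at h2
      have h3 := Real.one_le_exp (by positivity : 0 ≤ u / 16)
      rw [htu]
      linarith
    have h1 : 0 ≤ 4 ^ n * (s * Real.log (1 + s) ^ ((n : ℝ) / 2)) := by positivity
    calc s * t ≤ Real.exp (u / 16) * ((16 ^ n * n.factorial + 1) * Real.exp (u / 16)) := by gcongr
      _ = (16 ^ n * n.factorial + 1) * Real.exp (u / 8) := by
          rw [show u / 8 = u / 16 + u / 16 by ring, Real.exp_add]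
          ring
      _ ≤ _ := by linarith

open Finset in
/-- The duality argument: even moment bounds for trigonometric polynomials with frequencies `-μ i`
control the square sum of the Fourier coefficients of `f` at the frequencies `μ i`. -/
lemma sum_sq_piFourierCoeff_le {n : ℕ} (hn : 1 ≤ n) {ι : Type*} [Fintype ι] (μ : ι → Fin n → ℤ)
    (hμ : ∀ (k : ℕ) (N : Fin n → ℤ),
      #{q : Fin k → ι | ∑ i, -μ (q i) = N} ≤ (k.factorial * 4 ^ k) ^ n)
    (f : (Fin n → AddCircle (1 : ℝ)) → ℂ) (hf : Integrable f (piHaar n)) :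
    ENNReal.ofReal √(∑ i, ‖piFourierCoeff f (μ i)‖ ^ 2) ≤
      ENNReal.ofReal (4 ^ n) * (∫⁻ θ, (‖f θ‖₊ : ℝ≥0∞) *
        ENNReal.ofReal (Real.log (1 + ‖f θ‖) ^ ((n : ℝ) / 2)) ∂(piHaar n)) +
      ENNReal.ofReal ((16 ^ n * n.factorial + 1) * 2) := by
  set E := ∑ i, ‖piFourierCoeff f (μ i)‖ ^ 2 with hE
  rcases (show 0 ≤ E by positivity).eq_or_lt with hE0 | hE0
  · simp [← hE0]
  have hsq : (√E) ^ 2 = E := Real.sq_sqrt hE0.le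
  have hsqrt : 0 < √E := Real.sqrt_pos.2 hE0
  set a : ι → ℂ := fun i => starRingEnd ℂ (piFourierCoeff f (μ i)) / (√E : ℝ) with ha
  set g : (Fin n → AddCircle (1 : ℝ)) → ℂ := fun θ => ∑ i, a i * piFourier (-μ i) θ with hg
  have g_cont : Continuous g := by fun_prop
  have a_norm : ∑ i, ‖a i‖ ^ 2 = 1 := by
    simp only [ha, norm_div, RCLike.norm_conj, Complex.norm_real, Real.norm_eq_abs, div_pow, sq_abs,
      hsq, ← sum_div, ← hE]
    exact div_self hE0.ne'
  have exp_int := lintegral_exp_le_two hn g g_cont fun k => by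
    simpa [a_norm] using integral_norm_pow_trigPoly_le a (fun i => -μ i) k _ (hμ k)
  have pairing : ∫ θ, g θ * f θ ∂(piHaar n) = (√E : ℝ) := by
    have hint : ∀ m, Integrable (fun θ => piFourier m θ * f θ) (piHaar n) := fun m =>
      hf.bdd_mul (piFourier.continuous m).aestronglyMeasurable
        (Filter.Eventually.of_forall fun θ => (piFourier.norm_eq_one m θ).le)
    simp only [hg, sum_mul, mul_assoc]
    rw [integral_finsetSum _ fun i _ => (hint _).const_mul _]
    simp only [integral_const_mul]
    change ∑ i, a i * piFourierCoeff f (μ i) = _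
    simp only [ha, div_mul_eq_mul_div, Complex.conj_mul', ← sum_div]
    rw [div_eq_iff (by exact_mod_cast hsqrt.ne')]
    norm_cast
    rw [← sq, hsq]
  calc ENNReal.ofReal √E = ‖∫ θ, g θ * f θ ∂(piHaar n)‖ₑ := by
        rw [pairing, ← ofReal_norm, Complex.norm_real, Real.norm_of_nonneg hsqrt.le]
    _ ≤ ∫⁻ θ, ‖g θ * f θ‖ₑ ∂(piHaar n) := enorm_integral_le_lintegral_enorm _
    _ ≤ ∫⁻ θ, (ENNReal.ofReal (4 ^ n) * ((‖f θ‖₊ : ℝ≥0∞) *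
          ENNReal.ofReal (Real.log (1 + ‖f θ‖) ^ ((n : ℝ) / 2))) +
          ENNReal.ofReal (16 ^ n * n.factorial + 1) *
            ENNReal.ofReal (Real.exp (‖g θ‖ ^ (2 / (n : ℝ)) / 8))) ∂(piHaar n) := by
        refine lintegral_mono fun θ => ?_
        have hlog : 0 ≤ Real.log (1 + ‖f θ‖) :=
          Real.log_nonneg (by linarith [norm_nonneg (f θ)])
        rw [← enorm_eq_nnnorm, ← ofReal_norm, ← ofReal_norm,
          ← ENNReal.ofReal_mul (norm_nonneg _), ← ENNReal.ofReal_mul (by positivity),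
          ← ENNReal.ofReal_mul (by positivity), ← ENNReal.ofReal_add (by positivity) (by positivity),
          norm_mul, mul_comm ‖g θ‖]
        exact ENNReal.ofReal_le_ofReal
          (mul_le_mul_log_add_exp hn (norm_nonneg (f θ)) (norm_nonneg (g θ)))
    _ ≤ _ := by
        have hmeas : Measurable fun θ => ENNReal.ofReal (Real.exp (‖g θ‖ ^ (2 / (n : ℝ)) / 8)) := by
          have := g_cont.measurable
          fun_prop
        rw [lintegral_add_right _ (hmeas.const_mul _), lintegral_const_mul' _ _ ENNReal.ofReal_ne_top,
          lintegral_const_mul' _ _ ENNReal.ofReal_ne_top, ENNReal.ofReal_mul (by positivity),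
          ENNReal.ofReal_ofNat]
        gcongr

/-- **`n`-dimensional Zygmund inequality for products of lacunary sequences** with ratio at
least `2`: `(∑_{m ∈ Λ₁ × ⋯ × Λₙ} |f̂(m)|²)^{1/2} ≤ A ∫ |f| log^{n/2}(1+|f|) + B`. -/
theorem zygmund_for_products_of_lacunary_sequences
    {n : ℕ} (hn : 1 ≤ n) (lam : Fin n → ℕ → ℕ)
    (hpos : ∀ j m, 0 < lam j m) (hmono : ∀ j, StrictMono (lam j))
    (hlac : ∀ j m, 2 * lam j m ≤ lam j (m + 1)) :
    ∃ A B : ℝ, 0 < A ∧ 0 < B ∧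
      ∀ f : (Fin n → AddCircle (1 : ℝ)) → ℂ,
        Integrable f (Measure.pi fun _ : Fin n => AddCircle.haarAddCircle) →
        (∑' v : {v : Fin n → ℤ // ∀ j, ∃ i, (lam j i : ℤ) = v j},
            (‖piFourierCoeff f v.1‖₊ : ℝ≥0∞) ^ 2) ^ ((1 : ℝ) / 2)
          ≤ ENNReal.ofReal A *
              (∫⁻ θ, (‖f θ‖₊ : ℝ≥0∞) *
                ENNReal.ofReal (Real.log (1 + ‖f θ‖) ^ ((n : ℝ) / 2))
                ∂(Measure.pi fun _ : Fin n => AddCircle.haarAddCircle))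
            + ENNReal.ofReal B := by
  refine ⟨4 ^ n, (16 ^ n * n.factorial + 1) * 2, by positivity, by positivity, fun f hf => ?_⟩
  have box := fun M : ℕ => sum_sq_piFourierCoeff_le hn
    (fun (w : Fin n → Fin M) j => (lam j (w j) : ℤ))
    (fun k N => card_pi_lacunary_sum_le lam hpos hlac M k N) f hf
  generalize ENNReal.ofReal (4 ^ n) * _ + _ = C at box ⊢
  rw [one_div, ENNReal.rpow_inv_le_iff two_pos, ENNReal.tsum_eq_iSup_sum]
  refine iSup_le fun S => ?_
  choose idx hidx using fun v : {v : Fin n → ℤ // ∀ j, ∃ i, (lam j i : ℤ) = v j} => v.2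
  obtain ⟨M, hM⟩ : ∃ M, ∀ v ∈ S, ∀ j, idx v j < M := by
    refine ⟨S.sup (fun v => Finset.univ.sup (idx v)) + 1, fun v hv j => Nat.lt_succ_of_le ?_⟩
    exact (Finset.le_sup (f := idx v) (Finset.mem_univ j)).trans
      (Finset.le_sup (f := fun v => Finset.univ.sup (idx v)) hv)
  set μ : (Fin n → Fin M) → Fin n → ℤ := fun w j => (lam j (w j) : ℤ) with hμ
  have hS : ∑ v ∈ S, (‖piFourierCoeff f v.1‖₊ : ℝ≥0∞) ^ 2 ≤
      ∑ w, (‖piFourierCoeff f (μ w)‖₊ : ℝ≥0∞) ^ 2 := by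
    rw [← Finset.sum_attach]
    let e : {v // v ∈ S} → Fin n → Fin M := fun v j => ⟨idx v.1 j, hM v.1 v.2 j⟩
    have he : ∀ v, μ (e v) = v.1.1 := fun v => funext fun j => hidx v.1 j
    have e_inj : Function.Injective e := fun v w h => by
      apply Subtype.ext
      apply Subtype.ext
      rw [← he, ← he, h]
    calc ∑ v ∈ S.attach, (‖piFourierCoeff f v.1.1‖₊ : ℝ≥0∞) ^ 2
        = ∑ w ∈ S.attach.map ⟨e, e_inj⟩, (‖piFourierCoeff f (μ w)‖₊ : ℝ≥0∞) ^ 2 := by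
          simp [he]
      _ ≤ _ := Finset.sum_le_sum_of_subset (Finset.subset_univ _)
  refine hS.trans ?_
  have hsum : ∑ w, (‖piFourierCoeff f (μ w)‖₊ : ℝ≥0∞) ^ 2 =
      ENNReal.ofReal √(∑ w, ‖piFourierCoeff f (μ w)‖ ^ 2) ^ 2 := by
    rw [← ENNReal.ofReal_pow (Real.sqrt_nonneg _), Real.sq_sqrt (by positivity),
      ENNReal.ofReal_sum_of_nonneg fun _ _ => by positivity]
    refine Finset.sum_congr rfl fun w _ => ?_
    rw [ENNReal.ofReal_pow (norm_nonneg _), ofReal_norm, enorm_eq_nnnorm]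
  rw [hsum, ENNReal.rpow_two]
  gcongr
  exact box M
end
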